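/- Let Ω ⊂ ℂ^N be a domain and let p ∈ ∂Ω be a C^{2,α}-smooth strongly pseudoconvex boundary point, α ∈ (0,1] (i.e., near p, ∂Ω is C^{2,α}-smooth and the Levi form of a local defining function is positive definite on the complex tangent space). Then there exist a neighborhood V of p and constants 0 < c < C such that for all z, w ∈ Ω ∩ V: log(1 + c·A_Ω(z,w)) ≤ k_Ω(z,w) ≤ l_Ω(z,w) ≤ log(1 + C·A_Ω(z,w)). -/

import Mathlib

open Metric Set Filter Topology MeasureTheory

noncomputable section

namespace InvDist

/-- Complex Euclidean `N`-space. -/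
abbrev E (N : ℕ) := EuclideanSpace ℂ (Fin N)

variable {N : ℕ}

/-- The paper's Hermitian product `⟨a,b⟩ = ∑ a_j * conj (b_j)`. -/
def herm (a b : E N) : ℂ := ∑ j, a j * (starRingEnd ℂ) (b j)

/-- Euclidean distance to the boundary of `Ω`. -/
def bdist (Ω : Set (E N)) (x : E N) : ℝ := Metric.infDist x (frontier Ω)

/-- `π` selects, for each point of `Ω`, a closest point on the boundary. -/
def IsClosestPointSelection (Ω : Set (E N)) (π : E N → E N) : Prop :=
  ∀ z ∈ Ω, π z ∈ frontier Ω ∧ dist z (π z) = bdist Ω z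

/-- `‖v_z‖`: modulus of the complex normal component of `v` with respect to the
closest boundary point `π z`; the outer unit normal at `π z` is `(π z - z)/‖π z - z‖`. -/
def ncomp (Ω : Set (E N)) (π : E N → E N) (z v : E N) : ℝ :=
  ‖herm v (π z - z)‖ / bdist Ω z

/-- `‖v_z^ℝ‖`: modulus of the real normal component of `v` at `π z`. -/
def ncompR (Ω : Set (E N)) (π : E N → E N) (z v : E N) : ℝ :=
  |(herm v (π z - z)).re| / bdist Ω z

/-- The quantity `A_Ω(z,w)`. -/
def Afun (Ω : Set (E N)) (π : E N → E N) (z w : E N) : ℝ :=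
  (ncomp Ω π z (z - w) + ‖z - w‖ ^ 2 + ‖z - w‖ * Real.sqrt (bdist Ω z)) /
    (Real.sqrt (bdist Ω z) * Real.sqrt (bdist Ω w))

/-- `h_Ω(z,w) = ‖(z-w)_z‖ + ‖z-w‖ δ_Ω(z)^{1/2}`. -/
def hfun (Ω : Set (E N)) (π : E N → E N) (z w : E N) : ℝ :=
  ncomp Ω π z (z - w) + ‖z - w‖ * Real.sqrt (bdist Ω z)

/-- real analogue of `h_Ω`. -/
def hfunR (Ω : Set (E N)) (π : E N → E N) (z w : E N) : ℝ :=
  ncompR Ω π z (z - w) + ‖z - w‖ * Real.sqrt (bdist Ω z)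

/-- inverse hyperbolic tangent -/
def artanh (x : ℝ) : ℝ := Real.log ((1 + x) / (1 - x)) / 2

/-- The Lempert function of `Ω`. -/
def lempert (Ω : Set (E N)) (z w : E N) : ℝ :=
  artanh (sInf { r : ℝ | ∃ φ : ℂ → E N, DifferentiableOn ℂ φ (ball 0 1) ∧
    MapsTo φ (ball (0:ℂ) 1) Ω ∧ φ 0 = z ∧ ∃ a ∈ ball (0:ℂ) 1, φ a = w ∧ r = ‖a‖ })

/-- The Carathéodory distance of `Ω`. -/
def caratheodory (Ω : Set (E N)) (z w : E N) : ℝ :=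
  artanh (sSup { r : ℝ | ∃ f : E N → ℂ, DifferentiableOn ℂ f Ω ∧
    MapsTo f Ω (ball (0:ℂ) 1) ∧ f z = 0 ∧ r = ‖f w‖ })

/-- The Kobayashi distance: the largest pseudodistance not exceeding the Lempert
function, given as an infimum over chains. -/
def kobayashi (Ω : Set (E N)) (z w : E N) : ℝ :=
  sInf { r : ℝ | ∃ (n : ℕ) (p : Fin (n + 1) → E N), p 0 = z ∧ p (Fin.last n) = w ∧
    (∀ i, p i ∈ Ω) ∧ r = ∑ i : Fin n, lempert Ω (p i.castSucc) (p i.succ) }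

/-- The Poincaré distance on the unit disc. -/
def poincare (ζ ξ : ℂ) : ℝ := artanh ‖(ζ - ξ) / (1 - (starRingEnd ℂ) ζ * ξ)‖

/-- A complex geodesic of `Ω`. -/
def IsComplexGeodesic (Ω : Set (E N)) (φ : ℂ → E N) : Prop :=
  DifferentiableOn ℂ φ (ball 0 1) ∧ MapsTo φ (ball (0:ℂ) 1) Ω ∧
    ∀ ζ ∈ ball (0:ℂ) 1, ∀ ξ ∈ ball (0:ℂ) 1, kobayashi Ω (φ ζ) (φ ξ) = poincare ζ ξ

/-- `ρ` is `C^k` on `U` with `α`-Hölder `k`-th derivative. -/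
def IsCkHolderOn (k : ℕ) (α : ℝ) (ρ : E N → ℝ) (U : Set (E N)) : Prop :=
  ContDiffOn ℝ k ρ U ∧ ∃ M : ℝ, ∀ x ∈ U, ∀ y ∈ U,
    ‖iteratedFDeriv ℝ k ρ x - iteratedFDeriv ℝ k ρ y‖ ≤ M * ‖x - y‖ ^ α

/-- The Levi form of `ρ` at `p` evaluated at `v`. -/
def levi (ρ : E N → ℝ) (p v : E N) : ℝ :=
  (iteratedFDeriv ℝ 2 ρ p ![v, v] +
    iteratedFDeriv ℝ 2 ρ p ![(Complex.I : ℂ) • v, (Complex.I : ℂ) • v]) / 4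

/-- Bounded strongly pseudoconvex domain with `C^{k,α}`-smooth boundary. -/
def IsStronglyPseudoconvexDomain (k : ℕ) (α : ℝ) (Ω : Set (E N)) : Prop :=
  IsOpen Ω ∧ IsConnected Ω ∧ Bornology.IsBounded Ω ∧
  ∃ (U : Set (E N)) (ρ : E N → ℝ), IsOpen U ∧ closure Ω ⊆ U ∧
    IsCkHolderOn k α ρ U ∧ Ω = {x ∈ U | ρ x < 0} ∧
    (∀ p ∈ frontier Ω, fderiv ℝ ρ p ≠ 0) ∧
    ∀ p ∈ frontier Ω, ∀ v : E N, v ≠ 0 → fderiv ℝ ρ p v = 0 →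
      fderiv ℝ ρ p ((Complex.I : ℂ) • v) = 0 → 0 < levi ρ p v

/-- `η` is the outer unit normal of `Ω` at the boundary point `p`. -/
def IsOuterUnitNormalAt (Ω : Set (E N)) (p η : E N) : Prop :=
  ‖η‖ = 1 ∧ p ∈ frontier Ω ∧ ∃ ε > 0, ∀ t : ℝ, 0 < t → t < ε →
    p - t • η ∈ Ω ∧ bdist Ω (p - t • η) = t

open Classical in
/-- signed boundary distance -/
def signedDist (Ω : Set (E N)) (x : E N) : ℝ :=
  if x ∈ closure Ω then -(bdist Ω x) else bdist Ω x

/-- Hessian quadratic form of the signed boundary distance. -/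
def hessSD (Ω : Set (E N)) (p v : E N) : ℝ :=
  iteratedFDeriv ℝ 2 (signedDist Ω) p ![v, v]

/-- strict linear convexity at `p` (with outer unit normal `η`). -/
def StrictlyLinearlyConvexAt (Ω : Set (E N)) (p η : E N) : Prop :=
  ∀ v : E N, v ≠ 0 → herm v η = 0 → 0 < hessSD Ω p v

/-- strong convexity at `p` (with outer unit normal `η`). -/
def StronglyConvexAt (Ω : Set (E N)) (p η : E N) : Prop :=
  ∀ v : E N, v ≠ 0 → (herm v η).re = 0 → 0 < hessSD Ω p v

/-- `p` is a `C^k`-smooth boundary point of `Ω`. -/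
def IsCkBoundaryPoint (k : ℕ) (Ω : Set (E N)) (p : E N) : Prop :=
  p ∈ frontier Ω ∧ ∃ (U : Set (E N)) (ρ : E N → ℝ), IsOpen U ∧ p ∈ U ∧
    ContDiffOn ℝ k ρ U ∧ (∀ x ∈ U, (x ∈ Ω ↔ ρ x < 0)) ∧
    ∀ x ∈ U ∩ frontier Ω, fderiv ℝ ρ x ≠ 0

/-- bounded domain with `C^k`-smooth boundary. -/
def IsCkDomain (k : ℕ) (Ω : Set (E N)) : Prop :=
  IsOpen Ω ∧ IsConnected Ω ∧ Bornology.IsBounded Ω ∧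
    ∀ p ∈ frontier Ω, IsCkBoundaryPoint k Ω p

/-- bounded domain with `C^{1,1}`-smooth boundary. -/
def IsC11Domain (Ω : Set (E N)) : Prop :=
  IsOpen Ω ∧ IsConnected Ω ∧ Bornology.IsBounded Ω ∧
  ∀ p ∈ frontier Ω, ∃ (U : Set (E N)) (ρ : E N → ℝ), IsOpen U ∧ p ∈ U ∧
    IsCkHolderOn 1 1 ρ U ∧ (∀ x ∈ U, (x ∈ Ω ↔ ρ x < 0)) ∧
    ∀ x ∈ U ∩ frontier Ω, fderiv ℝ ρ x ≠ 0

/-- `p` is a `C^{2,α}`-smooth strongly pseudoconvex boundary point of `Ω`. -/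
def IsSPSCBoundaryPoint (α : ℝ) (Ω : Set (E N)) (p : E N) : Prop :=
  p ∈ frontier Ω ∧ ∃ (U : Set (E N)) (ρ : E N → ℝ), IsOpen U ∧ p ∈ U ∧
    IsCkHolderOn 2 α ρ U ∧ (∀ x ∈ U, (x ∈ Ω ↔ ρ x < 0)) ∧
    (∀ x ∈ U ∩ frontier Ω, fderiv ℝ ρ x ≠ 0) ∧
    ∀ x ∈ U ∩ frontier Ω, ∀ v : E N, v ≠ 0 → fderiv ℝ ρ x v = 0 →
      fderiv ℝ ρ x ((Complex.I : ℂ) • v) = 0 → 0 < levi ρ x v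

instance (N : ℕ) : MeasurableSpace (E N) := borel _

instance (N : ℕ) : BorelSpace (E N) := ⟨rfl⟩

/-- Lebesgue measure on `E N`. -/
def vol (N : ℕ) : Measure (E N) :=
  letI : InnerProductSpace ℝ (E N) := InnerProductSpace.rclikeToReal ℂ (E N)
  letI : MeasureSpace (E N) := measureSpaceOfInnerProductSpace
  volume

/-- Bergman kernel on the diagonal. -/
def bergmanKernelDiag (Ω : Set (E N)) (z : E N) : ℝ :=
  sSup { r : ℝ | ∃ f : E N → ℂ, DifferentiableOn ℂ f Ω ∧
    (∫ x in Ω, ‖f x‖ ^ 2 ∂(vol N)) ≤ 1 ∧ r = ‖f z‖ ^ 2 }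

/-- `M_Ω(z;v)`. -/
def bergmanM (Ω : Set (E N)) (z v : E N) : ℝ :=
  sSup { r : ℝ | ∃ f : E N → ℂ, DifferentiableOn ℂ f Ω ∧
    (∫ x in Ω, ‖f x‖ ^ 2 ∂(vol N)) ≤ 1 ∧ f z = 0 ∧ r = ‖fderiv ℂ f z v‖ }

/-- The Bergman metric. -/
def bergmanMetric (Ω : Set (E N)) (z v : E N) : ℝ :=
  bergmanM Ω z v / Real.sqrt (bergmanKernelDiag Ω z)

/-- The Bergman distance: inner distance of the Bergman metric. -/
def bergmanDist (Ω : Set (E N)) (z w : E N) : ℝ :=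
  sInf { r : ℝ | ∃ γ : ℝ → E N, ContDiffOn ℝ 1 γ (Icc 0 1) ∧ γ 0 = z ∧ γ 1 = w ∧
    (∀ t ∈ Icc (0:ℝ) 1, γ t ∈ Ω) ∧
    r = ∫ t in (0:ℝ)..(1:ℝ), bergmanMetric Ω (γ t) (derivWithin γ (Icc 0 1) t) }

/-- Uniform second order Taylor expansion of a `C²` function near a point. -/
lemma exists_taylor_two {ρ : E N → ℝ} {p : E N} (hρ : ContDiffAt ℝ 2 ρ p) {ε : ℝ} (hε : 0 < ε) :
    ∃ s > 0, ∀ x ∈ ball p s, ∀ y ∈ ball p s,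
      |ρ y - ρ x - fderiv ℝ ρ x (y - x) - fderiv ℝ (fderiv ℝ ρ) p (y - x) (y - x) / 2|
        ≤ ε * ‖y - x‖ ^ 2 ∧
      ‖fderiv ℝ ρ x - fderiv ℝ ρ y‖ ≤ (‖fderiv ℝ (fderiv ℝ ρ) p‖ + ε) * ‖x - y‖ := by
  set B := fderiv ℝ (fderiv ℝ ρ) p with hB
  have h1 : ContDiffAt ℝ 1 (fderiv ℝ ρ) p := hρ.fderiv_right (by norm_num)
  have h2 : HasStrictFDerivAt (fderiv ℝ ρ) B p := h1.hasStrictFDerivAt (by norm_num)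
  have h3 := h2.isLittleO.def hε
  have h4 : ∀ᶠ x in 𝓝 p, DifferentiableAt ℝ ρ x := by
    filter_upwards [hρ.eventually (by norm_num)] with x hx
    exact hx.differentiableAt (by norm_num)
  obtain ⟨s1, hs1, H1⟩ := Metric.eventually_nhds_iff_ball.1 h3
  obtain ⟨s2, hs2, H2⟩ := Metric.eventually_nhds_iff_ball.1 h4
  refine ⟨min s1 s2, lt_min hs1 hs2, fun x hx y hy => ?_⟩
  have key : ∀ u ∈ ball p (min s1 s2), ∀ v ∈ ball p (min s1 s2),
      ‖fderiv ℝ ρ u - fderiv ℝ ρ v - B (u - v)‖ ≤ ε * ‖u - v‖ := by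
    intro u hu v hv
    refine H1 (u, v) ?_
    rw [← ball_prod_same]
    exact ⟨ball_subset_ball (min_le_left _ _) hu, ball_subset_ball (min_le_left _ _) hv⟩
  constructor
  · set v := y - x with hv
    have hseg : ∀ t ∈ Icc (0:ℝ) 1, x + t • v ∈ ball p (min s1 s2) := by
      intro t ht
      have := (convex_ball p (min s1 s2)).add_smul_sub_mem hx hy ht
      simpa [hv] using this
    let g : ℝ → ℝ := fun t => ρ (x + t • v) - t * fderiv ℝ ρ x v - t ^ 2 / 2 * B v v
    have hg : ∀ t ∈ Icc (0:ℝ) 1, HasDerivWithinAt g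
        (fderiv ℝ ρ (x + t • v) v - fderiv ℝ ρ x v - t * B v v) (Icc 0 1) t := by
      intro t ht
      have hd : HasFDerivAt ρ (fderiv ℝ ρ (x + t • v)) (x + t • v) :=
        (H2 _ (ball_subset_ball (min_le_right _ _) (hseg t ht))).hasFDerivAt
      have hl : HasDerivAt (fun t : ℝ => x + t • v) v t := by
        simpa using ((hasDerivAt_id t).smul_const v).const_add x
      have h5 := hd.comp_hasDerivAt t hl
      have h6 : HasDerivAt (fun t : ℝ => t * fderiv ℝ ρ x v) (fderiv ℝ ρ x v) t := by
        simpa using (hasDerivAt_id t).mul_const (fderiv ℝ ρ x v)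
      have h7 : HasDerivAt (fun t : ℝ => t ^ 2 / 2 * B v v) (t * B v v) t := by
        refine (((hasDerivAt_pow 2 t).div_const 2).mul_const (B v v)).congr_deriv ?_
        norm_num
      exact ((h5.sub h6).sub h7).hasDerivWithinAt
    have hb : ∀ t ∈ Ico (0:ℝ) 1,
        ‖fderiv ℝ ρ (x + t • v) v - fderiv ℝ ρ x v - t * B v v‖ ≤ ε * ‖v‖ ^ 2 := by
      intro t ht
      have ht' : t ∈ Icc (0:ℝ) 1 := ⟨ht.1, ht.2.le⟩
      have h8 := key _ (hseg t ht') x hx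
      have h9 : fderiv ℝ ρ (x + t • v) v - fderiv ℝ ρ x v - t * B v v
          = (fderiv ℝ ρ (x + t • v) - fderiv ℝ ρ x - B (x + t • v - x)) v := by
        simp
      rw [h9]
      refine (ContinuousLinearMap.le_opNorm _ _).trans ?_
      have h10 : ‖x + t • v - x‖ ≤ ‖v‖ := by
        rw [add_sub_cancel_left, norm_smul, Real.norm_eq_abs, abs_of_nonneg ht.1]
        nlinarith [norm_nonneg v, ht.2]
      calc _ ≤ (ε * ‖x + t • v - x‖) * ‖v‖ := by gcongr
        _ ≤ (ε * ‖v‖) * ‖v‖ := by gcongr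
        _ = ε * ‖v‖ ^ 2 := by ring
    have := norm_image_sub_le_of_norm_deriv_le_segment_01' hg hb
    have h11 : g 1 - g 0 = ρ y - ρ x - fderiv ℝ ρ x v - B v v / 2 := by
      simp [g, hv]; ring
    rw [h11] at this
    exact this
  · have := key x hx y hy
    calc ‖fderiv ℝ ρ x - fderiv ℝ ρ y‖
        = ‖(fderiv ℝ ρ x - fderiv ℝ ρ y - B (x - y)) + B (x - y)‖ := by simp
      _ ≤ ε * ‖x - y‖ + ‖B‖ * ‖x - y‖ :=
          (norm_add_le _ _).trans (add_le_add this (B.le_opNorm _))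
      _ = _ := by ring

/-- Polarization of `holQuad`. -/
def holBilin (B : E N →L[ℝ] E N →L[ℝ] ℝ) (x y : E N) : ℂ :=
  ((B x y - B (Complex.I • x) (Complex.I • y)) / 4 : ℝ) -
    Complex.I * ((B x (Complex.I • y) + B (Complex.I • x) y) / 4 : ℝ)

lemma complex_smul_eq (c : ℂ) (x : E N) : c • x = c.re • x + c.im • (Complex.I • x) := by
  conv_lhs => rw [← Complex.re_add_im c]
  rw [add_smul, mul_smul]
  rfl

lemma I_smul_complex_smul (c : ℂ) (x : E N) :
    Complex.I • (c • x) = c.re • (Complex.I • x) - c.im • x := by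
  rw [complex_smul_eq c x, smul_add, smul_comm Complex.I c.re, smul_comm Complex.I c.im,
    smul_smul Complex.I Complex.I, Complex.I_mul_I, neg_one_smul, smul_neg, sub_eq_add_neg]

lemma holBilin_swap (B : E N →L[ℝ] E N →L[ℝ] ℝ) (x y : E N) :
    holBilin B x y = holBilin B.flip y x := by
  simp [holBilin, add_comm]

lemma holBilin_smul_left (B : E N →L[ℝ] E N →L[ℝ] ℝ) (c : ℂ) (x y : E N) :
    holBilin B (c • x) y = c • holBilin B x y := by
  have h1 : ∀ u, B (c • x) u = c.re * B x u + c.im * B (Complex.I • x) u := by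
    intro u; rw [complex_smul_eq c x, map_add, map_smul B, map_smul B]; rfl
  have h2 : ∀ u, B (Complex.I • (c • x)) u = c.re * B (Complex.I • x) u - c.im * B x u := by
    intro u; rw [I_smul_complex_smul c x, map_sub, map_smul B, map_smul B]; rfl
  simp only [holBilin, h1, h2]
  apply Complex.ext <;> simp <;> ring

lemma holBilin_add_left (B : E N →L[ℝ] E N →L[ℝ] ℝ) (x y z : E N) :
    holBilin B (x + y) z = holBilin B x z + holBilin B y z := by
  simp [holBilin]; ring

lemma holBilin_norm_le (B : E N →L[ℝ] E N →L[ℝ] ℝ) (x y : E N) :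
    ‖holBilin B x y‖ ≤ ‖B‖ * ‖x‖ * ‖y‖ := by
  have hI : ∀ v : E N, ‖(Complex.I : ℂ) • v‖ = ‖v‖ := fun v => by simp [norm_smul]
  have h : ∀ x' y' : E N, ‖x'‖ = ‖x‖ → ‖y'‖ = ‖y‖ → |B x' y'| ≤ ‖B‖ * ‖x‖ * ‖y‖ := by
    intro x' y' hx hy
    have := B.le_opNorm₂ x' y'
    rwa [hx, hy, Real.norm_eq_abs] at this
  have h1 := abs_le.1 (h x y rfl rfl)
  have h2 := abs_le.1 (h _ _ (hI x) (hI y))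
  have h3 := abs_le.1 (h _ _ rfl (hI y))
  have h4 := abs_le.1 (h _ _ (hI x) rfl)
  unfold holBilin
  refine (norm_sub_le _ _).trans ?_
  rw [norm_mul, Complex.norm_I, one_mul, Complex.norm_real, Complex.norm_real,
    Real.norm_eq_abs, Real.norm_eq_abs]
  have h5 : |(B x y - B (Complex.I • x) (Complex.I • y)) / 4| ≤ ‖B‖ * ‖x‖ * ‖y‖ / 2 := by
    rw [abs_le]; constructor <;> linarith
  have h6 : |(B x (Complex.I • y) + B (Complex.I • x) y) / 4| ≤ ‖B‖ * ‖x‖ * ‖y‖ / 2 := by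
    rw [abs_le]; constructor <;> linarith
  linarith

/-- The `(2,0)` part of a real quadratic form. -/
def holQuad (B : E N →L[ℝ] E N →L[ℝ] ℝ) (v : E N) : ℂ := holBilin B v v

lemma holQuad_norm_le (B : E N →L[ℝ] E N →L[ℝ] ℝ) (v : E N) :
    ‖holQuad B v‖ ≤ ‖B‖ * ‖v‖ ^ 2 :=
  (holBilin_norm_le B v v).trans_eq (by ring)

lemma holQuad_re (B : E N →L[ℝ] E N →L[ℝ] ℝ) (v : E N) :
    B v v / 2 = (holQuad B v).re + (B v v + B (Complex.I • v) (Complex.I • v)) / 4 := by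
  simp [holQuad, holBilin]
  ring

lemma holQuad_differentiable (B : E N →L[ℝ] E N →L[ℝ] ℝ) : Differentiable ℂ (holQuad B) := by
  have hb : IsBoundedBilinearMap ℂ (fun q : E N × E N => holBilin B q.1 q.2) :=
    { add_left := fun x y z => holBilin_add_left B x y z
      smul_left := fun c x y => holBilin_smul_left B c x y
      add_right := fun x y z => by
        simp only [holBilin_swap B x, holBilin_add_left]
      smul_right := fun c x y => by
        show holBilin B x (c • y) = c • holBilin B x y
        rw [holBilin_swap B x, holBilin_swap B x, holBilin_smul_left]
      bound := ⟨‖B‖ + 1, by positivity, fun x y => (holBilin_norm_le B x y).trans (by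
        gcongr; linarith)⟩ }
  exact (hb.differentiable (𝕜 := ℂ)).comp (differentiable_id.prodMk differentiable_id)

/-- A quadratic form positive on the kernel of a functional becomes positive definite after
adding a large multiple of the squared modulus of the functional. -/
lemma exists_pos_definite (α : E N →L[ℂ] ℂ) (β : E N → ℝ) (hβ : Continuous β)
    (hhom : ∀ (t : ℝ) (v : E N), β (t • v) = t ^ 2 * β v)
    (hpos : ∀ v, v ≠ 0 → α v = 0 → 0 < β v) :
    ∃ K c : ℝ, 0 ≤ K ∧ 0 < c ∧ ∀ v, c * ‖v‖ ^ 2 ≤ β v + K * ‖α v‖ ^ 2 := by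
  have hcomp : IsCompact (sphere (0 : E N) 1) := isCompact_sphere _ _
  let W : ℕ → Set (E N) := fun n => {v | 0 < β v + n * ‖α v‖ ^ 2}
  have hW : ∀ n, IsOpen (W n) := fun n =>
    isOpen_lt continuous_const (by fun_prop)
  have hcov : sphere (0 : E N) 1 ⊆ ⋃ n, W n := by
    intro v hv
    rw [mem_iUnion]
    have hv0 : v ≠ 0 := by rintro rfl; simp at hv
    by_cases h : α v = 0
    · exact ⟨0, by simpa [W] using hpos v hv0 h⟩
    · have hp : 0 < ‖α v‖ ^ 2 := by positivity
      obtain ⟨n, hn⟩ := exists_nat_gt (-β v / ‖α v‖ ^ 2)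
      refine ⟨n, ?_⟩
      rw [div_lt_iff₀ hp] at hn
      simp only [W, mem_ofPred_eq]; linarith
  have hdir : Directed (· ⊆ ·) W := by
    refine Monotone.directed_le (fun m n hmn v hv => ?_)
    have hv' : 0 < β v + m * ‖α v‖ ^ 2 := hv
    have : (m : ℝ) ≤ n := by exact_mod_cast hmn
    show 0 < β v + n * ‖α v‖ ^ 2
    nlinarith [sq_nonneg ‖α v‖]
  obtain ⟨n, hn⟩ := hcomp.elim_directed_cover W hW hcov hdir
  obtain ⟨c, hc, hc'⟩ := hcomp.exists_forall_le' (f := fun v => β v + n * ‖α v‖ ^ 2)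
    (by fun_prop) (a := 0) (fun v hv => hn hv)
  refine ⟨n, c, Nat.cast_nonneg n, hc, fun v => ?_⟩
  by_cases hv : v = 0
  · subst hv
    have := hhom 0 0
    simp at this
    simp [this]
  · have hnv : 0 < ‖v‖ := norm_pos_iff.2 hv
    have h1 := hc' (‖v‖⁻¹ • v) (by simp [norm_smul, hnv.ne'])
    have h2 : α (‖v‖⁻¹ • v) = (‖v‖⁻¹ : ℝ) • α v := by
      exact ContinuousLinearMap.map_smul_of_tower α _ _
    simp only [hhom, h2, norm_smul] at h1
    have h3 : c * ‖v‖ ^ 2 ≤ (‖v‖⁻¹ ^ 2 * β v + n * (‖(‖v‖⁻¹ : ℝ)‖ * ‖α v‖) ^ 2) * ‖v‖ ^ 2 := by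
      gcongr
    rw [norm_inv, norm_norm] at h3
    calc _ ≤ _ := h3
      _ = _ := by field_simp

/-- A strictly plurisubharmonic local defining function `r` of `Ω` near `p`, together with the
complex linear forms `a x = 2∂r(x)` and a holomorphic quadratic form `Q` giving two-sided Taylor
estimates that are uniform on `ball p s`. -/
structure Model (Ω : Set (E N)) (p : E N) where
  r : E N → ℝ
  a : E N → (E N →L[ℂ] ℂ)
  Q : E N → ℂ
  n : E N
  s : ℝ
  C : ℝ
  c : ℝ
  s_pos : 0 < s
  s_le : s ≤ 1
  C_ge : 1 ≤ C
  c_pos : 0 < c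
  c_le : c ≤ 1
  isOpen : IsOpen Ω
  mem_frontier : p ∈ frontier Ω
  mem_iff : ∀ x ∈ ball p s, (x ∈ Ω ↔ r x < 0)
  Q_diff : Differentiable ℂ Q
  Q_bound : ∀ v, ‖Q v‖ ≤ C * ‖v‖ ^ 2
  taylor : ∀ x ∈ ball p s, ∀ y ∈ ball p s, |r y - r x - (a x (y - x)).re| ≤ C * ‖y - x‖ ^ 2
  levi_lower : ∀ x ∈ ball p s, ∀ y ∈ ball p s,
    r x + (a x (y - x) + Q (y - x)).re + c * ‖y - x‖ ^ 2 ≤ r y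
  a_lip : ∀ x ∈ ball p s, ∀ y ∈ ball p s, ‖a x - a y‖ ≤ C * ‖x - y‖
  a_bound : ∀ x ∈ ball p s, ‖a x‖ ≤ C
  a_n : a p n = -1

lemma eq_zero_of_mem_frontier {Ω U : Set (E N)} (hop : IsOpen Ω) (hU : IsOpen U) {ρ : E N → ℝ}
    {p : E N} (hp : p ∈ frontier Ω) (hpU : p ∈ U) (hc : ContinuousAt ρ p)
    (h : ∀ x ∈ U, (x ∈ Ω ↔ ρ x < 0)) : ρ p = 0 := by
  rw [hop.frontier_eq] at hp
  have h1 : 0 ≤ ρ p := by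
    by_contra! hlt
    exact hp.2 ((h p hpU).2 hlt)
  refine le_antisymm ?_ h1
  by_contra! hlt
  have h2 : ∀ᶠ x in 𝓝 p, 0 < ρ x ∧ x ∈ U :=
    (hc.eventually (lt_mem_nhds hlt)).and (hU.mem_nhds hpU)
  obtain ⟨x, hx, hxΩ⟩ := mem_closure_iff_nhds.1 hp.1 _ h2
  have hx0 : 0 < ρ x ∧ x ∈ U := hx
  linarith [(h x hx0.2).1 hxΩ]

/-- Lower bound for the second order remainder of `ρ + K ρ ^ 2`. -/
lemma convexified_lower {K β L₀ ε b c₁ V ry rx A e q : ℝ} {A0 : ℂ} (hK : 0 ≤ K)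
    (hV : 0 ≤ V) (hε : 0 ≤ ε) (hε1 : ε ≤ 1)
    (hΔ : ry - rx = A + b + e) (hb : |b| ≤ L₀ * V ^ 2) (hbq : b = q + β)
    (he : |e| ≤ ε * V ^ 2) (hrx : |2 * K * rx| ≤ ε)
    (h0 : |ry - rx - A0.re| ≤ ε * V) (hun : ‖A0‖ ≤ L₀ * V)
    (hpos : c₁ * V ^ 2 ≤ β + K / 2 * ‖A0‖ ^ 2) :
    (c₁ - ε * (L₀ + 2 + K * (2 * L₀ + 1))) * V ^ 2 ≤
    (ry + K * ry ^ 2) - (rx + K * rx ^ 2) - (1 + 2 * K * rx) * A - q - K / 2 * ((A0 ^ 2).re) := by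
  have hL : |A0.re| ≤ L₀ * V := (Complex.abs_re_le_norm A0).trans hun
  have hsq : (A0 ^ 2).re = 2 * A0.re ^ 2 - ‖A0‖ ^ 2 := by
    rw [← Complex.normSq_eq_norm_sq, Complex.normSq_apply, pow_two A0, Complex.mul_re]; ring
  generalize A0.re = u at *
  set Δ := ry - rx with hΔd
  have e1 : (ry + K * ry ^ 2) - (rx + K * rx ^ 2) = (1 + 2 * K * rx) * Δ + K * Δ ^ 2 := by
    rw [hΔd]; ring
  have h1 : |2 * K * rx * b| ≤ ε * (L₀ * V ^ 2) := by
    rw [abs_mul]; gcongr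
  have h2 : |(1 + 2 * K * rx) * e| ≤ 2 * (ε * V ^ 2) := by
    rw [abs_mul]; gcongr
    have := abs_le.1 hrx; rw [abs_le]; constructor <;> linarith
  have h3 : |(Δ - u) * (Δ + u)| ≤ (ε * V) * ((2 * L₀ + 1) * V) := by
    rw [abs_mul]; gcongr
    have h4 := abs_le.1 h0
    have h5 := abs_le.1 hL
    have : ε * V ≤ V := mul_le_of_le_one_left hV hε1
    rw [abs_le]; constructor <;> linarith
  have h4 : K * |(Δ - u) * (Δ + u)| ≤ K * ((ε * V) * ((2 * L₀ + 1) * V)) := by gcongr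
  have h5 : -(K * |(Δ - u) * (Δ + u)|) ≤ K * ((Δ - u) * (Δ + u)) := by
    rw [← mul_neg]; gcongr; exact neg_abs_le _
  rw [e1, hsq]
  have key : (1 + 2 * K * rx) * Δ + K * Δ ^ 2 - (1 + 2 * K * rx) * A - q
      - K / 2 * (2 * u ^ 2 - ‖A0‖ ^ 2) = β + K / 2 * ‖A0‖ ^ 2 + 2 * K * rx * b
        + (1 + 2 * K * rx) * e + K * ((Δ - u) * (Δ + u)) := by
    have hq : q = b - β := by linarith
    rw [hq, hΔ]; ring
  rw [key]
  nlinarith [(abs_le.1 h1).1, (abs_le.1 h2).1]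

set_option maxHeartbeats 1000000 in
/-- A strongly pseudoconvex boundary point admits a `Model`. -/
lemma nonempty_model {Ω : Set (E N)} {p : E N} {α : ℝ} (hop : IsOpen Ω)
    (hp : IsSPSCBoundaryPoint α Ω p) : Nonempty (Model Ω p) := by
  obtain ⟨hpf, U, ρ, hU, hpU, ⟨hC2, -⟩, hmem, hgrad, hlevi⟩ := hp
  have hat : ContDiffAt ℝ 2 ρ p := by
    have := hC2.contDiffAt (hU.mem_nhds hpU)
    exact_mod_cast this
  have hρ0 : ρ p = 0 := eq_zero_of_mem_frontier hop hU hpf hpU hat.continuousAt hmem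
  set B := fderiv ℝ (fderiv ℝ ρ) p with hB
  let α' : E N → (E N →L[ℂ] ℂ) := fun x =>
    StrongDual.extendRCLikeₗᵢ (𝕜 := ℂ) (F := E N) (fderiv ℝ ρ x)
  have hα're : ∀ x v, (α' x v).re = fderiv ℝ ρ x v := fun x v =>
    StrongDual.re_extendRCLike_apply (𝕜 := ℂ) (fderiv ℝ ρ x) v
  have hα'norm : ∀ x, ‖α' x‖ = ‖fderiv ℝ ρ x‖ := fun x => LinearIsometryEquiv.norm_map _ _
  have hα'sub : ∀ x y, ‖α' x - α' y‖ = ‖fderiv ℝ ρ x - fderiv ℝ ρ y‖ := fun x y => by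
    simp only [α', ← map_sub, LinearIsometryEquiv.norm_map]
  let β : E N → ℝ := fun v => (B v v + B (Complex.I • v) (Complex.I • v)) / 4
  have hβc : Continuous β := by fun_prop
  have hβh : ∀ (t : ℝ) (v : E N), β (t • v) = t ^ 2 * β v := by
    intro t v
    simp only [β, smul_comm Complex.I t v, map_smul, smul_apply, smul_eq_mul]
    ring
  obtain ⟨K0, c1, hK0, hc1, hpd⟩ := exists_pos_definite (α' p) β hβc hβh (by
    intro v hv h0
    have h1 := hlevi p ⟨hpU, hpf⟩ v hv (by rw [← hα're, h0]; rfl) (by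
      rw [← hα're, map_smul, h0]; simp)
    simpa [levi, iteratedFDeriv_two_apply, β] using h1)
  have hpne : fderiv ℝ ρ p ≠ 0 := hgrad p ⟨hpU, hpf⟩
  obtain ⟨n, hn⟩ : ∃ n, α' p n = -1 := by
    have : α' p ≠ 0 := by
      rw [← norm_pos_iff, hα'norm, norm_pos_iff]; exact hpne
    obtain ⟨v, hv⟩ : ∃ v, α' p v ≠ 0 := by
      by_contra! h
      exact this (ContinuousLinearMap.ext h)
    exact ⟨(-(α' p v)⁻¹) • v, by rw [map_smul, smul_eq_mul]; field_simp⟩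
  set K := 2 * K0 with hK
  have hKn : 0 ≤ K := by positivity
  set L := ‖B‖ + ‖α' p‖ + 1 with hL
  have hBn := norm_nonneg B
  have hαn := norm_nonneg (α' p)
  have hL1 : 1 ≤ L := by linarith
  set D := L + 2 + K * (2 * L + 1) with hD
  have hD1 : 1 ≤ D := by nlinarith
  obtain ⟨ε, hε, hε1, hεc⟩ : ∃ ε : ℝ, 0 < ε ∧ ε ≤ 1 ∧ ε * D ≤ c1 / 2 := by
    refine ⟨min 1 (c1 / 2 / D), by positivity, min_le_left _ _, ?_⟩
    rw [← le_div_iff₀ (by positivity)]; exact min_le_right _ _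
  obtain ⟨s0, hs0, hT⟩ := exists_taylor_two hat hε
  obtain ⟨s1, hs1, hsU⟩ := Metric.isOpen_iff.1 hU p hpU
  obtain ⟨s, hs, hss0, hss1, hsh, hsε, hsK⟩ : ∃ s : ℝ, 0 < s ∧ s ≤ s0 ∧ s ≤ s1 ∧ s ≤ 1 / 2 ∧
      5 * L * s ≤ ε ∧ 8 * K * L * s ≤ ε := by
    refine ⟨min (min s0 s1) (min (1/2) (min (ε / (5 * L)) (ε / (8 * K * L + 1)))), by positivity,
      ?_, ?_, ?_, ?_, ?_⟩
    · exact (min_le_left _ _).trans (min_le_left _ _)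
    · exact (min_le_left _ _).trans (min_le_right _ _)
    · exact (min_le_right _ _).trans (min_le_left _ _)
    · rw [mul_comm, ← le_div_iff₀ (by positivity)]
      exact (min_le_right _ _).trans ((min_le_right _ _).trans (min_le_left _ _))
    · have h : min (min s0 s1) (min (1/2) (min (ε / (5 * L)) (ε / (8 * K * L + 1))))
        ≤ ε / (8 * K * L + 1) :=
        (min_le_right _ _).trans ((min_le_right _ _).trans (min_le_right _ _))
      have h0 : 0 ≤ min (min s0 s1) (min (1/2) (min (ε / (5 * L)) (ε / (8 * K * L + 1)))) := by
        positivity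
      rw [le_div_iff₀ (by positivity)] at h
      linarith
  have hb0 : ball p s ⊆ ball p s0 := ball_subset_ball hss0
  have hpb : p ∈ ball p s := mem_ball_self hs
  -- first order information
  have hVlt : ∀ x ∈ ball p s, ∀ y ∈ ball p s, ‖y - x‖ ≤ 2 * s := by
    intro x hx y hy
    have h1 := mem_ball.1 hx
    have h2 := mem_ball.1 hy
    rw [← dist_eq_norm]
    linarith [dist_triangle_right y x p]
  have hlip : ∀ x ∈ ball p s, ∀ y ∈ ball p s, ‖α' x - α' y‖ ≤ L * ‖x - y‖ := by
    intro x hx y hy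
    rw [hα'sub]
    refine (hT x (hb0 hx) y (hb0 hy)).2.trans ?_
    gcongr
    linarith
  have hsmall : ∀ x ∈ ball p s, ‖α' x - α' p‖ ≤ L * s := by
    intro x hx
    refine (hlip x hx p hpb).trans ?_
    gcongr
    rw [← dist_eq_norm]; exact (mem_ball.1 hx).le
  have hbd : ∀ x ∈ ball p s, ‖α' x‖ ≤ 2 * L := by
    intro x hx
    have h1 := norm_sub_norm_le (α' x) (α' p)
    have h2 := hsmall x hx
    have h3 : L * s ≤ L * (1 / 2) := by gcongr
    linarith
  have hBb : ∀ v, |B v v / 2| ≤ L * ‖v‖ ^ 2 := by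
    intro v
    have h := B.le_opNorm₂ v v
    rw [Real.norm_eq_abs] at h
    rw [abs_div, abs_two]
    nlinarith [sq_nonneg ‖v‖, mul_nonneg hαn (sq_nonneg ‖v‖), mul_nonneg hBn (sq_nonneg ‖v‖)]
  have hquad : ∀ x ∈ ball p s, ∀ y ∈ ball p s,
      |ρ y - ρ x - (α' x (y - x)).re| ≤ (L + 1) * ‖y - x‖ ^ 2 := by
    intro x hx y hy
    have h1 := (hT x (hb0 hx) y (hb0 hy)).1
    have h2 := hBb (y - x)
    rw [hα're]
    have h3 : ε * ‖y - x‖ ^ 2 ≤ 1 * ‖y - x‖ ^ 2 := by gcongr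
    rw [abs_le] at *
    constructor <;> linarith
  have hΔ : ∀ x ∈ ball p s, ∀ y ∈ ball p s, |ρ y - ρ x| ≤ 4 * L * ‖y - x‖ := by
    intro x hx y hy
    have h1 := hquad x hx y hy
    have h2 : |(α' x (y - x)).re| ≤ 2 * L * ‖y - x‖ :=
      (Complex.abs_re_le_norm _).trans (((α' x).le_opNorm _).trans (by gcongr; exact hbd x hx))
    have h3 : (L + 1) * ‖y - x‖ ^ 2 ≤ (L + 1) * (1 * ‖y - x‖) := by
      rw [pow_two]; gcongr; linarith [hVlt x hx y hy]
    have h4 := norm_nonneg (y - x)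
    rw [abs_le] at *
    constructor <;> nlinarith
  have hρb : ∀ x ∈ ball p s, |ρ x| ≤ 4 * L * s := by
    intro x hx
    have h := hΔ p hpb x hx
    rw [hρ0, sub_zero] at h
    refine h.trans ?_
    gcongr
    rw [← dist_eq_norm]; exact (mem_ball.1 hx).le
  have hKρ : ∀ x ∈ ball p s, |2 * K * ρ x| ≤ ε := by
    intro x hx
    rw [abs_mul, abs_of_nonneg (by positivity : 0 ≤ 2 * K)]
    have := mul_le_mul_of_nonneg_left (hρb x hx) (by positivity : 0 ≤ 2 * K)
    linarith
  have hfac : ∀ x ∈ ball p s, |1 + 2 * K * ρ x| ≤ 2 := by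
    intro x hx
    have := abs_le.1 (hKρ x hx); rw [abs_le]; constructor <;> linarith
  have hC0 : 0 ≤ K * L ^ 2 := by positivity
  refine ⟨{
    r := fun x => ρ x + K * ρ x ^ 2
    a := fun x => ((1 + 2 * K * ρ x : ℝ) : ℂ) • α' x
    Q := fun v => holQuad B v + (K / 2 : ℝ) * (α' p v) ^ 2
    n := n
    s := s
    C := 5 + 6 * L + 16 * (K * L ^ 2)
    c := min (c1 / 2) 1
    s_pos := hs
    s_le := by linarith
    C_ge := by linarith
    c_pos := by positivity
    c_le := min_le_right _ _
    isOpen := hop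
    mem_frontier := hpf
    mem_iff := ?_
    Q_diff := ?_
    Q_bound := ?_
    taylor := ?_
    levi_lower := ?_
    a_lip := ?_
    a_bound := ?_
    a_n := ?_ }⟩
  · intro x hx
    rw [hmem x (hsU (ball_subset_ball hss1 hx))]
    have h1 := abs_le.1 (hKρ x hx)
    have h2 : ρ x + K * ρ x ^ 2 = ρ x * (1 + K * ρ x) := by ring
    have h3 : 0 < 1 + K * ρ x := by linarith
    simp only [h2]
    rw [mul_neg_iff]
    constructor
    · intro h; right; exact ⟨h, h3⟩
    · rintro (⟨-, h⟩ | ⟨h, -⟩)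
      · linarith
      · exact h
  · have := holQuad_differentiable B
    fun_prop
  · intro v
    have h1 := holQuad_norm_le B v
    have h2 : ‖α' p v‖ ≤ L * ‖v‖ := ((α' p).le_opNorm v).trans (by gcongr; linarith)
    have h3 : ‖((K / 2 : ℝ) : ℂ) * (α' p v) ^ 2‖ ≤ K / 2 * (L * ‖v‖) ^ 2 := by
      rw [norm_mul, norm_pow, Complex.norm_real, Real.norm_of_nonneg (by positivity)]
      gcongr
    refine (norm_add_le _ _).trans ?_
    have h4 : ‖B‖ * ‖v‖ ^ 2 ≤ L * ‖v‖ ^ 2 := by gcongr; linarith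
    have h5 := mul_nonneg hC0 (sq_nonneg ‖v‖)
    nlinarith [sq_nonneg ‖v‖, mul_nonneg (by linarith : 0 ≤ L) (sq_nonneg ‖v‖)]
  · intro x hx y hy
    have h1 := hquad x hx y hy
    have h2 := hΔ x hx y hy
    have h3 := hfac x hx
    have e1 : ρ y + K * ρ y ^ 2 - (ρ x + K * ρ x ^ 2)
        - ((((1 + 2 * K * ρ x : ℝ) : ℂ) • α' x) (y - x)).re =
        (1 + 2 * K * ρ x) * (ρ y - ρ x - (α' x (y - x)).re) + K * (ρ y - ρ x) ^ 2 := by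
      simp only [smul_apply, smul_eq_mul, Complex.re_ofReal_mul]
      ring
    simp only [e1]
    have h4 : |(1 + 2 * K * ρ x) * (ρ y - ρ x - (α' x (y - x)).re)|
        ≤ 2 * ((L + 1) * ‖y - x‖ ^ 2) := by rw [abs_mul]; gcongr
    have h5 : |K * (ρ y - ρ x) ^ 2| ≤ K * (4 * L * ‖y - x‖) ^ 2 := by
      rw [abs_mul, abs_of_nonneg hKn, abs_pow]; gcongr
    refine (abs_add_le _ _).trans ?_
    nlinarith [sq_nonneg ‖y - x‖, mul_nonneg (by linarith : 0 ≤ L) (sq_nonneg ‖y - x‖)]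
  · intro x hx y hy
    have hst : |ρ y - ρ x - (α' p (y - x)).re| ≤ ε * ‖y - x‖ := by
      have h1 := hquad x hx y hy
      have h2 : ‖α' x (y - x) - α' p (y - x)‖ ≤ L * s * ‖y - x‖ :=
        ((α' x - α' p).le_opNorm (y - x)).trans (by gcongr; exact hsmall x hx)
      have h2' := (Complex.abs_re_le_norm _).trans h2
      rw [Complex.sub_re] at h2'
      have h3 : (L + 1) * ‖y - x‖ ^ 2 ≤ (L + 1) * ((2 * s) * ‖y - x‖) := by
        rw [pow_two]; gcongr; exact hVlt x hx y hy
      have h4 : 5 * L * s * ‖y - x‖ ≤ ε * ‖y - x‖ := by gcongr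
      have h5 : s * ‖y - x‖ ≤ L * (s * ‖y - x‖) := le_mul_of_one_le_left (by positivity) hL1
      have h1' := abs_le.1 (h1.trans h3)
      have h2'' := abs_le.1 h2'
      rw [abs_le]
      constructor <;> linarith
    have key := convexified_lower (K := K) (β := β (y - x)) (L₀ := L) (ε := ε)
      (b := B (y - x) (y - x) / 2) (c₁ := c1) (V := ‖y - x‖) (ry := ρ y) (rx := ρ x)
      (A := (α' x (y - x)).re) (q := (holQuad B (y - x)).re) (A0 := α' p (y - x))
      (e := ρ y - ρ x - fderiv ℝ ρ x (y - x) - B (y - x) (y - x) / 2)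
      hKn (norm_nonneg _) hε.le hε1 (by rw [hα're]; ring) (hBb _)
      (holQuad_re B _) (hT x (hb0 hx) y (hb0 hy)).1 (hKρ x hx) hst
      (((α' p).le_opNorm _).trans (by gcongr; linarith))
      (by have := hpd (y - x); rw [hK]; linarith)
    have h1 : min (c1 / 2) 1 * ‖y - x‖ ^ 2 ≤ (c1 - ε * D) * ‖y - x‖ ^ 2 := by
      gcongr
      exact (min_le_left _ _).trans (by linarith)
    have e2 : ((((1 + 2 * K * ρ x : ℝ) : ℂ) • α' x) (y - x) +
        (holQuad B (y - x) + ((K / 2 : ℝ) : ℂ) * (α' p (y - x)) ^ 2)).re =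
        (1 + 2 * K * ρ x) * (α' x (y - x)).re + (holQuad B (y - x)).re
          + K / 2 * ((α' p (y - x)) ^ 2).re := by
      simp only [smul_apply, smul_eq_mul, Complex.re_ofReal_mul, Complex.add_re]
      ring
    rw [e2]
    linarith
  · intro x hx y hy
    have e1 : ((1 + 2 * K * ρ x : ℝ) : ℂ) • α' x - ((1 + 2 * K * ρ y : ℝ) : ℂ) • α' y =
        ((1 + 2 * K * ρ x : ℝ) : ℂ) • (α' x - α' y) + ((2 * K * (ρ x - ρ y) : ℝ) : ℂ) • α' y := by
      push_cast; module
    simp only [e1]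
    refine (norm_add_le _ _).trans ?_
    rw [norm_smul, norm_smul, Complex.norm_real, Complex.norm_real, Real.norm_eq_abs,
      Real.norm_eq_abs, abs_mul (2 * K), abs_of_nonneg (by positivity : 0 ≤ 2 * K)]
    have h1 : |1 + 2 * K * ρ x| * ‖α' x - α' y‖ ≤ 2 * (L * ‖x - y‖) := by
      gcongr; exacts [hfac x hx, hlip x hx y hy]
    have h2 : 2 * K * |ρ x - ρ y| * ‖α' y‖ ≤ 2 * K * (4 * L * ‖x - y‖) * (2 * L) := by
      gcongr; exacts [hΔ y hy x hx, hbd y hy]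
    nlinarith [norm_nonneg (x - y), mul_nonneg (by linarith : 0 ≤ L) (norm_nonneg (x - y))]
  · intro x hx
    rw [norm_smul, Complex.norm_real, Real.norm_eq_abs]
    have : |1 + 2 * K * ρ x| * ‖α' x‖ ≤ 2 * (2 * L) := by
      gcongr; exacts [hfac x hx, hbd x hx]
    linarith
  · simp [hρ0, hn]

namespace Model

variable {Ω : Set (E N)} {p : E N} (m : Model Ω p)

/-- The Levi polynomial of `m.r` at `z`, normalised to have positive real part in `Ω`. -/
def P (z y : E N) : ℂ := -((2 * m.r z : ℝ) : ℂ) - m.a z (y - z) - m.Q (y - z)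

/-- A quantity comparable to `‖P z w‖`. -/
def Mf (z w : E N) : ℝ := -m.r z - m.r w + ‖m.a z (z - w)‖ + ‖z - w‖ ^ 2

/-- The invariant quantity with `-r` replacing the boundary distance. -/
def Bf (z w : E N) : ℝ :=
  (‖m.a z (z - w)‖ + ‖z - w‖ ^ 2 + ‖z - w‖ * √(-m.r z)) / (√(-m.r z) * √(-m.r w))

lemma C_pos : 0 < m.C := one_pos.trans_le m.C_ge

lemma neg_r_pos {z : E N} (hz : z ∈ Ω) (hzs : z ∈ ball p m.s) : 0 < -m.r z :=
  neg_pos.2 ((m.mem_iff z hzs).1 hz)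

lemma Q_zero : m.Q 0 = 0 := by
  have := m.Q_bound 0
  simpa using this

lemma P_self (z : E N) : m.P z z = ((-2 * m.r z : ℝ) : ℂ) := by
  simp [P, m.Q_zero]

lemma P_differentiable (z : E N) : Differentiable ℂ (m.P z) := by
  unfold P
  have h := m.Q_diff
  have h2 : Differentiable ℂ fun y => m.Q (y - z) := h.comp (by fun_prop)
  fun_prop

lemma norm_sub_le_two {x y : E N} {s : ℝ} (hx : x ∈ ball p s) (hy : y ∈ ball p s) :
    ‖y - x‖ ≤ 2 * s := by
  have h1 := mem_ball.1 hx
  have h2 := mem_ball.1 hy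
  rw [← dist_eq_norm]
  linarith [dist_triangle_right y x p]

lemma P_re_ge {z y : E N} (hz : z ∈ ball p m.s) (hy : y ∈ ball p m.s) :
    -m.r z - m.r y + m.c * ‖y - z‖ ^ 2 ≤ (m.P z y).re := by
  have := m.levi_lower z hz y hy
  simp only [P, Complex.sub_re, Complex.neg_re, Complex.ofReal_re, Complex.add_re] at *
  linarith

lemma a_apply_le {z : E N} (hz : z ∈ ball p m.s) (v : E N) : ‖m.a z v‖ ≤ m.C * ‖v‖ :=
  ((m.a z).le_opNorm v).trans (by gcongr; exact m.a_bound z hz)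

lemma a_sub_apply_le {z w : E N} (hz : z ∈ ball p m.s) (hw : w ∈ ball p m.s) (v : E N) :
    ‖m.a z v - m.a w v‖ ≤ m.C * ‖z - w‖ * ‖v‖ :=
  ((m.a z - m.a w).le_opNorm v).trans (by gcongr; exact m.a_lip z hz w hw)

lemma r_lip {x y : E N} (hx : x ∈ ball p m.s) (hy : y ∈ ball p m.s) :
    |m.r y - m.r x| ≤ 3 * m.C * ‖y - x‖ := by
  have h1 := m.taylor x hx y hy
  have h2 := (Complex.abs_re_le_norm _).trans (m.a_apply_le hx (y - x))
  have h3 : ‖y - x‖ ≤ 2 := (norm_sub_le_two hx hy).trans (by linarith [m.s_le])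
  have h4 : m.C * ‖y - x‖ ^ 2 ≤ m.C * (2 * ‖y - x‖) := by
    rw [pow_two]; have := m.C_pos; gcongr
  rw [abs_le] at *
  constructor <;> linarith

/-- Constant comparing `Mf` and `P`. -/
def C₄ : ℝ := (8 + 2 * m.C) / m.c

lemma C₄_pos : 0 < m.C₄ := div_pos (by linarith [m.C_pos]) m.c_pos

lemma Mf_le_P {z w : E N} (hz : z ∈ Ω) (hw : w ∈ Ω) (hzs : z ∈ ball p m.s)
    (hws : w ∈ ball p m.s) : m.Mf z w ≤ m.C₄ * ‖m.P z w‖ := by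
  have h1 := (m.P_re_ge hzs hws).trans (Complex.re_le_norm _)
  have hz0 := m.neg_r_pos hz hzs
  have hw0 := m.neg_r_pos hw hws
  have hc := m.c_pos
  have hc1 := m.c_le
  have hC := m.C_ge
  have h2 : ‖m.a z (w - z)‖ ≤ ‖m.P z w‖ + 2 * (-m.r z) + m.C * ‖w - z‖ ^ 2 := by
    have e : m.a z (w - z) = -m.P z w + ((2 * (-m.r z) : ℝ) : ℂ) - m.Q (w - z) := by
      simp only [P]; push_cast; ring
    rw [e]
    refine (norm_sub_le _ _).trans ?_
    refine add_le_add ((norm_add_le _ _).trans_eq ?_) (m.Q_bound _)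
    rw [norm_neg, Complex.norm_real, Real.norm_of_nonneg (by linarith)]
  have e1 : ‖m.a z (z - w)‖ = ‖m.a z (w - z)‖ := by
    rw [← neg_sub w z, map_neg, norm_neg]
  rw [C₄, div_mul_eq_mul_div, le_div_iff₀ hc, Mf, e1, norm_sub_rev z w]
  set X := ‖m.P z w‖
  set V := ‖w - z‖ ^ 2 with hV
  have hV0 : 0 ≤ V := sq_nonneg _
  have hcV : m.c * V ≤ X := by linarith
  have hX : 0 ≤ X := norm_nonneg _
  have h3 : -m.r z - m.r w + ‖m.a z (w - z)‖ + V ≤ 4 * X + (m.C + 1) * V := by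
    nlinarith [mul_nonneg hc.le hV0]
  calc _ ≤ (4 * X + (m.C + 1) * V) * m.c := by gcongr
    _ = 4 * X * m.c + (m.C + 1) * (m.c * V) := by ring
    _ ≤ 4 * X * 1 + (m.C + 1) * X := by gcongr
    _ ≤ _ := by nlinarith

/-- Quasi-triangle constant. -/
def C₅ : ℝ := 2 + 4 / m.c + 2 * m.C₄ + 2 * m.C / m.c

lemma C₅_pos : 0 < m.C₅ := by
  have := m.C₄_pos; have := m.c_pos; have := m.C_pos
  unfold C₅; positivity

lemma Mf_le_of_P_le {z w y : E N} {t : ℝ} (hz : z ∈ Ω) (hw : w ∈ Ω) (hy : y ∈ Ω)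
    (hzs : z ∈ ball p m.s) (hws : w ∈ ball p m.s) (hys : y ∈ ball p m.s)
    (h1 : ‖m.P z y‖ ≤ t) (h2 : ‖m.P w y‖ ≤ t) : m.Mf z w ≤ m.C₅ * t := by
  have hz0 := m.neg_r_pos hz hzs
  have hw0 := m.neg_r_pos hw hws
  have hy0 := m.neg_r_pos hy hys
  have hc := m.c_pos
  have hC := m.C_pos
  have p1 := (m.P_re_ge hzs hys).trans ((Complex.re_le_norm _).trans h1)
  have p2 := (m.P_re_ge hws hys).trans ((Complex.re_le_norm _).trans h2)
  have q1 := (m.Mf_le_P hz hy hzs hys).trans (mul_le_mul_of_nonneg_left h1 m.C₄_pos.le)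
  have q2 := (m.Mf_le_P hw hy hws hys).trans (mul_le_mul_of_nonneg_left h2 m.C₄_pos.le)
  have v1 : ‖y - z‖ ^ 2 ≤ t / m.c := by
    rw [le_div_iff₀ hc]; linarith
  have v2 : ‖y - w‖ ^ 2 ≤ t / m.c := by
    rw [le_div_iff₀ hc]; nlinarith [sq_nonneg ‖y - z‖]
  have cz : 0 ≤ m.c * ‖y - z‖ ^ 2 := by positivity
  have cw : 0 ≤ m.c * ‖y - w‖ ^ 2 := by positivity
  have v3 : ‖z - w‖ ≤ ‖y - z‖ + ‖y - w‖ := by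
    rw [norm_sub_rev y z]; exact norm_sub_le_norm_sub_add_norm_sub z y w
  have v4 : ‖z - w‖ ^ 2 ≤ 4 / m.c * t := by
    have : ‖z - w‖ ^ 2 ≤ (‖y - z‖ + ‖y - w‖) ^ 2 := by gcongr
    have e : 4 / m.c * t = 4 * (t / m.c) := by ring
    rw [e]
    nlinarith [sq_nonneg (‖y - z‖ - ‖y - w‖)]
  have v5 : ‖z - w‖ * ‖y - w‖ ≤ 2 * (t / m.c) := by
    have : ‖z - w‖ * ‖y - w‖ ≤ (‖y - z‖ + ‖y - w‖) * ‖y - w‖ := by gcongr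
    nlinarith [sq_nonneg (‖y - z‖ - ‖y - w‖)]
  have a1 : ‖m.a z (z - w)‖ ≤ ‖m.a z (z - y)‖ + (‖m.a w (w - y)‖ + m.C * ‖z - w‖ * ‖y - w‖) := by
    have e : m.a z (z - w) =
        m.a z (z - y) + (-(m.a w (w - y)) + (m.a z (y - w) - m.a w (y - w))) := by
      rw [← map_neg, neg_sub, add_sub_cancel, ← map_add]; congr 1; abel
    rw [e]
    refine (norm_add_le _ _).trans (add_le_add le_rfl ((norm_add_le _ _).trans ?_))
    rw [norm_neg]
    exact add_le_add le_rfl (m.a_sub_apply_le hzs hws _)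
  have a2 : m.C * ‖z - w‖ * ‖y - w‖ ≤ m.C * (2 * (t / m.c)) := by
    rw [mul_assoc]; gcongr
  have e : m.C₅ * t = 2 * t + 4 / m.c * t + 2 * (m.C₄ * t) + m.C * (2 * (t / m.c)) := by
    unfold C₅; ring
  rw [e]
  unfold Mf at *
  nlinarith [sq_nonneg ‖z - y‖, sq_nonneg ‖w - y‖]

lemma r_sub_le {z w : E N} (hzs : z ∈ ball p m.s) (hws : w ∈ ball p m.s) :
    |m.r w - m.r z| ≤ m.C * (‖m.a z (z - w)‖ + ‖z - w‖ ^ 2) := by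
  have h1 := m.taylor z hzs w hws
  have e1 : ‖m.a z (z - w)‖ = ‖m.a z (w - z)‖ := by
    rw [← neg_sub w z, map_neg, norm_neg]
  rw [e1, norm_sub_rev z w]
  have h2 := Complex.abs_re_le_norm (m.a z (w - z))
  have h3 := mul_le_mul_of_nonneg_right m.C_ge (norm_nonneg (m.a z (w - z)))
  rw [abs_le] at *
  constructor <;> linarith

lemma Mf_le_Bf {z w : E N} (hz : z ∈ Ω) (hw : w ∈ Ω) (hzs : z ∈ ball p m.s)
    (hws : w ∈ ball p m.s) :
    m.Mf z w ≤ 8 * m.C * (1 + m.Bf z w) * (√(-m.r z) * √(-m.r w)) := by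
  have hz0 := m.neg_r_pos hz hzs
  have hw0 := m.neg_r_pos hw hws
  have h1 := m.r_sub_le hzs hws
  have hC := m.C_ge
  have hx := Real.sqrt_pos.2 hz0
  have hy := Real.sqrt_pos.2 hw0
  have hx2 := Real.sq_sqrt hz0.le
  have hy2 := Real.sq_sqrt hw0.le
  have e : (1 + m.Bf z w) * (√(-m.r z) * √(-m.r w)) = √(-m.r z) * √(-m.r w) +
      (‖m.a z (z - w)‖ + ‖z - w‖ ^ 2 + ‖z - w‖ * √(-m.r z)) := by
    unfold Bf; field_simp
  rw [mul_assoc, e, Mf]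
  set x := √(-m.r z)
  set y := √(-m.r w)
  rw [sub_eq_add_neg (-m.r z) (m.r w), ← hx2, ← hy2]
  set g := ‖m.a z (z - w)‖ + ‖z - w‖ ^ 2 with hg
  have hg0 : 0 ≤ g := by positivity
  have h3 : 0 ≤ ‖z - w‖ * x := by positivity
  have hxy : 0 < x * y := by positivity
  have hr : |x ^ 2 - y ^ 2| ≤ m.C * g := by
    have : m.r w - m.r z = x ^ 2 - y ^ 2 := by rw [hx2, hy2]; ring
    rwa [← this]
  have hr' := abs_le.1 hr
  have key : x ^ 2 + y ^ 2 ≤ 2 * (x * y) + 2 * (m.C * g) := by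
    rcases le_total x y with h | h <;> nlinarith
  have : 2 * (x * y) + 2 * (m.C * g) + g ≤ 8 * m.C * (x * y + (g + ‖z - w‖ * x)) := by
    nlinarith [mul_nonneg m.C_pos.le h3, mul_le_mul_of_nonneg_right hC hxy.le,
      mul_le_mul_of_nonneg_right hC hg0]
  linarith

lemma Bf_le_Mf {z w : E N} (hz : z ∈ Ω) (hw : w ∈ Ω) (hzs : z ∈ ball p m.s)
    (hws : w ∈ ball p m.s) :
    (1 + m.Bf z w) * (√(-m.r z) * √(-m.r w)) ≤ 3 * m.Mf z w := by
  have hz0 := m.neg_r_pos hz hzs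
  have hw0 := m.neg_r_pos hw hws
  have hx := Real.sqrt_pos.2 hz0
  have hy := Real.sqrt_pos.2 hw0
  have hx2 := Real.sq_sqrt hz0.le
  have hy2 := Real.sq_sqrt hw0.le
  have e : (1 + m.Bf z w) * (√(-m.r z) * √(-m.r w)) = √(-m.r z) * √(-m.r w) +
      (‖m.a z (z - w)‖ + ‖z - w‖ ^ 2 + ‖z - w‖ * √(-m.r z)) := by
    unfold Bf; field_simp
  rw [e, Mf]
  set x := √(-m.r z)
  set y := √(-m.r w)
  rw [sub_eq_add_neg (-m.r z) (m.r w), ← hx2, ← hy2]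
  nlinarith [norm_nonneg (m.a z (z - w)), sq_nonneg (x - y), sq_nonneg (‖z - w‖ - x),
    sq_nonneg ‖z - w‖, sq_nonneg x, sq_nonneg y]

lemma Bf_nonneg (z w : E N) : 0 ≤ m.Bf z w := by unfold Bf; positivity

end Model

lemma herm_eq_inner (a b : E N) : herm a b = inner ℂ b a := by
  simp [herm, PiLp.inner_apply]

/-- A point closer to `z ∈ Ω` than the boundary lies in `Ω`. -/
lemma bdist_le_dist_of_notMem {Ω : Set (E N)} {z y : E N} (hz : z ∈ Ω) (hy : y ∉ Ω) :
    bdist Ω z ≤ dist z y := by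
  obtain ⟨q, hqf, hq⟩ := exists_mem_frontier_infDist_compl_eq_dist hz
    (show Ω ≠ univ from fun h => hy (h ▸ mem_univ y))
  calc bdist Ω z ≤ dist z q := infDist_le_dist_of_mem hqf
    _ = infDist z Ωᶜ := hq.symm
    _ ≤ dist z y := infDist_le_dist_of_mem hy

lemma ncomp_nonneg (Ω : Set (E N)) (π : E N → E N) (z v : E N) : 0 ≤ ncomp Ω π z v :=
  div_nonneg (norm_nonneg _) infDist_nonneg

/-- Comparison of two quotients of the type occurring in the invariant quantity. -/
lemma quotient_compare {u U V x X y Y G : ℝ} (hG : 1 ≤ G) (hU : 0 ≤ U) (hV : 0 ≤ V)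
    (hx : 0 < x) (hX : 0 < X) (hY : 0 < Y) (hu : u ≤ G * (U + G * X * V))
    (h1 : x ≤ G * X) (h2 : X ≤ G * x) (h3 : Y ≤ G * y) :
    (u + V ^ 2 + V * x) / (x * y) ≤ 2 * G ^ 4 * ((U + V ^ 2 + V * X) / (X * Y)) := by
  have hG0 : 0 < G := by linarith
  have e : 2 * G ^ 4 * ((U + V ^ 2 + V * X) / (X * Y))
      = (2 * G ^ 2 * (U + V ^ 2 + V * X)) / ((X / G) * (Y / G)) := by
    field_simp
  rw [e]
  have hXx : X / G ≤ x := by rw [div_le_iff₀ hG0]; linarith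
  have hYy : Y / G ≤ y := by rw [div_le_iff₀ hG0]; linarith
  have hGG : G ≤ G ^ 2 := by nlinarith
  have hG2 : 1 ≤ G ^ 2 := by nlinarith
  have hVX : 0 ≤ V * X := by positivity
  have hVx : V * x ≤ V * (G * X) := by gcongr
  gcongr
  have t1 : G * U ≤ G ^ 2 * U := by gcongr
  have t2 : 0 ≤ G ^ 2 * U := by positivity
  have t3 : 1 * V ^ 2 ≤ G ^ 2 * V ^ 2 := by gcongr
  have t4 : 0 ≤ G ^ 2 * V ^ 2 := by positivity
  have t5 : G * (V * X) ≤ G ^ 2 * (V * X) := by gcongr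
  nlinarith

namespace Model

variable {Ω : Set (E N)} {p : E N} (m : Model Ω p)

lemma r_continuousAt {x : E N} (hx : x ∈ ball p m.s) : ContinuousAt m.r x := by
  have h : LipschitzOnWith (Real.toNNReal (3 * m.C)) m.r (ball p m.s) := by
    refine LipschitzOnWith.of_dist_le_mul fun x hx y hy => ?_
    rw [Real.coe_toNNReal _ (by linarith [m.C_pos]), Real.dist_eq, dist_eq_norm]
    exact m.r_lip hy hx
  exact h.continuousOn.continuousAt (isOpen_ball.mem_nhds hx)

lemma r_frontier {x : E N} (hx : x ∈ ball p m.s) (hf : x ∈ frontier Ω) : m.r x = 0 :=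
  eq_zero_of_mem_frontier m.isOpen isOpen_ball hf hx (m.r_continuousAt hx) m.mem_iff

lemma p_mem : p ∈ ball p m.s := mem_ball_self m.s_pos

lemma a_n_close {x : E N} (hx : x ∈ ball p m.s) :
    ‖m.a x m.n + 1‖ ≤ m.C * ‖x - p‖ * ‖m.n‖ := by
  have := m.a_sub_apply_le hx m.p_mem m.n
  rwa [m.a_n, sub_neg_eq_add] at this

/-- The radius on which boundary geometry is controlled. -/
def s₂ : ℝ := m.s / (100 * m.C ^ 2 * (1 + ‖m.n‖) ^ 2)

lemma s₂_pos : 0 < m.s₂ := by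
  have := m.s_pos; have := m.C_pos
  unfold s₂; positivity

lemma s₂_mul_le : m.s₂ * (100 * m.C ^ 2 * (1 + ‖m.n‖) ^ 2) = m.s := by
  have := m.C_pos
  unfold s₂; field_simp

lemma s₂_bounds : 100 * m.s₂ ≤ m.s ∧ 100 * (m.C * m.s₂ * ‖m.n‖) ≤ m.s ∧
    100 * (m.C ^ 2 * m.s₂ * ‖m.n‖ ^ 2) ≤ m.s ∧ 100 * (m.C * m.s₂) ≤ m.s := by
  have h := m.s₂_mul_le
  have h0 := m.s₂_pos
  have hn := norm_nonneg m.n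
  have hC := m.C_ge
  have hC2 : 1 ≤ m.C ^ 2 := by nlinarith
  have hCC : m.C ≤ m.C ^ 2 := by nlinarith
  have e1 : 1 ≤ (1 + ‖m.n‖) ^ 2 := by nlinarith
  have e2 : ‖m.n‖ ≤ (1 + ‖m.n‖) ^ 2 := by nlinarith
  have e3 : ‖m.n‖ ^ 2 ≤ (1 + ‖m.n‖) ^ 2 := by nlinarith
  rw [← h]
  refine ⟨?_, ?_, ?_, ?_⟩
  · calc 100 * m.s₂ = m.s₂ * (100 * 1 * 1) := by ring
      _ ≤ _ := by gcongr
  · calc _ = m.s₂ * (100 * m.C * ‖m.n‖) := by ring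
      _ ≤ _ := by gcongr
  · calc _ = m.s₂ * (100 * m.C ^ 2 * ‖m.n‖ ^ 2) := by ring
      _ ≤ _ := by gcongr
  · calc _ = m.s₂ * (100 * m.C * 1) := by ring
      _ ≤ _ := by gcongr

lemma bdist_le_r {z : E N} (hz : z ∈ Ω) (hzs : z ∈ ball p m.s₂) :
    bdist Ω z ≤ 4 * ‖m.n‖ * (-m.r z) := by
  obtain ⟨b1, b2, b3, b4⟩ := m.s₂_bounds
  have hs0 := m.s₂_pos
  have hs := m.s_le
  have hC := m.C_pos
  have hzb : z ∈ ball p m.s := ball_subset_ball (by linarith) hzs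
  have hr := m.neg_r_pos hz hzb
  have hzp : ‖z - p‖ < m.s₂ := by rw [← dist_eq_norm]; exact hzs
  have hrz : -m.r z ≤ 3 * m.C * m.s₂ := by
    have h1 := m.r_lip m.p_mem hzb
    rw [m.r_frontier m.p_mem m.mem_frontier, sub_zero] at h1
    have h2 : 3 * m.C * ‖z - p‖ ≤ 3 * m.C * m.s₂ := by gcongr
    linarith [(abs_le.1 h1).1]
  set t := 4 * (-m.r z) with ht
  have ht0 : 0 < t := by positivity
  set y := z - t • m.n with hy
  have hyz : y - z = -(t • m.n) := by rw [hy]; abel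
  have hnyz : ‖y - z‖ = t * ‖m.n‖ := by
    rw [hyz, norm_neg, norm_smul, Real.norm_of_nonneg ht0.le]
  have htn : t * ‖m.n‖ ≤ 12 * (m.C * m.s₂ * ‖m.n‖) := by
    rw [ht]; nlinarith [norm_nonneg m.n]
  have hyb : y ∈ ball p m.s := by
    rw [mem_ball, dist_eq_norm]
    have : ‖y - p‖ ≤ ‖y - z‖ + ‖z - p‖ := norm_sub_le_norm_sub_add_norm_sub _ _ _
    linarith
  have hyΩ : y ∉ Ω := by
    rw [m.mem_iff y hyb, not_lt]
    have h1 := (abs_le.1 (m.taylor z hzb y hyb)).1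
    have h2 : (m.a z (y - z)).re = t * (-(m.a z m.n).re) := by
      rw [hyz, map_neg, ContinuousLinearMap.map_smul_of_tower]
      simp
    have h3 := (Complex.abs_re_le_norm _).trans (m.a_n_close hzb)
    have h4 : m.C * ‖z - p‖ * ‖m.n‖ ≤ m.C * m.s₂ * ‖m.n‖ := by gcongr
    have h5 : 1 / 2 ≤ -(m.a z m.n).re := by
      have := (abs_le.1 h3).2
      simp at this
      linarith
    have h6 : m.C * ‖y - z‖ ^ 2 ≤ t * (1 / 4) := by
      rw [hnyz]
      have : m.C * (t * ‖m.n‖) ^ 2 = t * (m.C * t * ‖m.n‖ ^ 2) := by ring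
      rw [this]
      gcongr
      have h7 : m.C * t * ‖m.n‖ ^ 2 ≤ m.C * (4 * (3 * m.C * m.s₂)) * ‖m.n‖ ^ 2 := by
        gcongr; linarith
      nlinarith
    have h8 : t * (1 / 2) ≤ t * (-(m.a z m.n).re) := by gcongr
    rw [h2] at h1
    linarith
  refine (bdist_le_dist_of_notMem hz hyΩ).trans_eq ?_
  rw [dist_comm, dist_eq_norm, hnyz, ht]; ring

variable {π : E N → E N}

lemma proj_mem_ball (hπ : IsClosestPointSelection Ω π)
    {z : E N} (hz : z ∈ Ω) (hzs : z ∈ ball p m.s₂) : π z ∈ ball p (2 * m.s₂) ∧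
    bdist Ω z < m.s₂ := by
  have h1 := (hπ z hz).2
  have h2 : bdist Ω z ≤ dist z p := infDist_le_dist_of_mem m.mem_frontier
  have h3 := mem_ball.1 hzs
  refine ⟨?_, by linarith⟩
  rw [mem_ball]
  linarith [dist_triangle_left (π z) p z]

lemma r_le_bdist (hπ : IsClosestPointSelection Ω π)
    {z : E N} (hz : z ∈ Ω) (hzs : z ∈ ball p m.s₂) :
    -m.r z ≤ 3 * m.C * bdist Ω z := by
  obtain ⟨b1, -⟩ := m.s₂_bounds
  have hs0 := m.s₂_pos
  have hzb : z ∈ ball p m.s := ball_subset_ball (by linarith) hzs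
  have hpb : π z ∈ ball p m.s :=
    ball_subset_ball (by linarith) (m.proj_mem_ball hπ hz hzs).1
  have h1 := m.r_lip hzb hpb
  rw [m.r_frontier hpb (hπ z hz).1, ← dist_eq_norm, dist_comm, (hπ z hz).2] at h1
  linarith [(abs_le.1 h1).2]

lemma bdist_pos (hπ : IsClosestPointSelection Ω π)
    {z : E N} (hz : z ∈ Ω) (hzs : z ∈ ball p m.s₂) : 0 < bdist Ω z := by
  obtain ⟨b1, -⟩ := m.s₂_bounds
  have hs0 := m.s₂_pos
  have h := m.r_le_bdist hπ hz hzs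
  have h2 := m.neg_r_pos hz (ball_subset_ball (by linarith) hzs)
  have hC := m.C_pos
  by_contra! hn
  nlinarith

lemma a_proj_re_nonpos (hπ : IsClosestPointSelection Ω π)
    {z v : E N} (hz : z ∈ Ω) (hzs : z ∈ ball p m.s₂)
    (hv : (herm v (π z - z)).re < 0) : (m.a (π z) v).re ≤ 0 := by
  obtain ⟨b1, -⟩ := m.s₂_bounds
  have hs0 := m.s₂_pos
  have hpb : π z ∈ ball p m.s :=
    ball_subset_ball (by linarith) (m.proj_mem_ball hπ hz hzs).1
  have hδ := m.bdist_pos hπ hz hzs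
  have hnorm : ‖π z - z‖ = bdist Ω z := by
    rw [← (hπ z hz).2, dist_comm, dist_eq_norm]
  rw [herm_eq_inner] at hv
  have hlim : Tendsto (fun ε : ℝ => m.C * ε * ‖v‖ ^ 2) (𝓝[>] 0) (𝓝 0) := by
    have : Tendsto (fun ε : ℝ => m.C * ε * ‖v‖ ^ 2) (𝓝 0) (𝓝 (m.C * 0 * ‖v‖ ^ 2)) :=
      Continuous.tendsto (by fun_prop) 0
    simp only [mul_zero, zero_mul] at this
    exact this.mono_left nhdsWithin_le_nhds
  have hball : ∀ᶠ ε : ℝ in 𝓝[>] 0, π z + ε • v ∈ ball p m.s := by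
    have : Tendsto (fun ε : ℝ => π z + ε • v) (𝓝 0) (𝓝 (π z + (0 : ℝ) • v)) :=
      Continuous.tendsto (by fun_prop) 0
    rw [zero_smul, add_zero] at this
    exact (this.eventually (isOpen_ball.mem_nhds hpb)).filter_mono nhdsWithin_le_nhds
  have hsm : ∀ᶠ ε : ℝ in 𝓝[>] 0, 2 * (inner ℂ (π z - z) v).re + ε * ‖v‖ ^ 2 < 0 := by
    have : Tendsto (fun ε : ℝ => 2 * (inner ℂ (π z - z) v).re + ε * ‖v‖ ^ 2) (𝓝 0)
        (𝓝 (2 * (inner ℂ (π z - z) v).re + 0 * ‖v‖ ^ 2)) := Continuous.tendsto (by fun_prop) 0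
    rw [zero_mul, add_zero] at this
    exact (this.eventually (gt_mem_nhds (by linarith))).filter_mono nhdsWithin_le_nhds
  refine ge_of_tendsto hlim ?_
  filter_upwards [hball, hsm, self_mem_nhdsWithin] with ε h1 h2 h3
  have hε : 0 < ε := h3
  have hin : π z + ε • v ∈ Ω := by
    by_contra hn
    have h4 := bdist_le_dist_of_notMem hz hn
    rw [dist_comm, dist_eq_norm, ← hnorm] at h4
    have e : π z + ε • v - z = (π z - z) + (ε : ℂ) • v := by
      rw [Complex.coe_smul]; abel
    have h5 : ‖π z - z‖ ^ 2 ≤ ‖π z + ε • v - z‖ ^ 2 := by gcongr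
    rw [e, norm_add_sq (𝕜 := ℂ), inner_smul_right, norm_smul, Complex.norm_real,
      Real.norm_of_nonneg hε.le] at h5
    simp only [RCLike.re_to_complex, Complex.re_ofReal_mul] at h5
    nlinarith
  have h6 := (abs_le.1 (m.taylor (π z) hpb _ h1)).1
  have h7 := (m.mem_iff _ h1).1 hin
  rw [m.r_frontier hpb (hπ z hz).1, add_sub_cancel_left,
    ContinuousLinearMap.map_smul_of_tower, norm_smul, Real.norm_of_nonneg hε.le] at h6
  simp only [Complex.real_smul, Complex.re_ofReal_mul] at h6
  have h8 : ε * (m.a (π z) v).re ≤ ε * (m.C * ε * ‖v‖ ^ 2) := by nlinarith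
  exact le_of_mul_le_mul_left h8 hε

lemma a_proj_re_nonpos' (hπ : IsClosestPointSelection Ω π)
    {z v : E N} (hz : z ∈ Ω) (hzs : z ∈ ball p m.s₂)
    (hv : (herm v (π z - z)).re = 0) : (m.a (π z) v).re ≤ 0 := by
  have hδ := m.bdist_pos hπ hz hzs
  have hnorm : ‖π z - z‖ = bdist Ω z := by
    rw [← (hπ z hz).2, dist_comm, dist_eq_norm]
  have hlim : Tendsto (fun ε : ℝ => ε * (m.a (π z) (π z - z)).re) (𝓝[>] 0) (𝓝 0) := by
    have : Tendsto (fun ε : ℝ => ε * (m.a (π z) (π z - z)).re) (𝓝 0)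
        (𝓝 (0 * (m.a (π z) (π z - z)).re)) := Continuous.tendsto (by fun_prop) 0
    rw [zero_mul] at this
    exact this.mono_left nhdsWithin_le_nhds
  refine ge_of_tendsto hlim ?_
  filter_upwards [self_mem_nhdsWithin] with ε h3
  have hε : 0 < ε := h3
  have := m.a_proj_re_nonpos hπ (v := v - (ε : ℂ) • (π z - z)) hz hzs (by
    rw [herm_eq_inner] at hv ⊢
    rw [inner_sub_right, inner_smul_right, inner_self_eq_norm_sq_to_K, hnorm, Complex.sub_re, hv,
      Complex.re_ofReal_mul]
    have : ((bdist Ω z : ℂ) ^ 2).re = bdist Ω z ^ 2 := by norm_cast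
    simp only [Complex.coe_algebraMap]
    rw [this]
    have : 0 < ε * bdist Ω z ^ 2 := by positivity
    linarith)
  rw [map_sub, map_smul, smul_eq_mul, Complex.sub_re, Complex.re_ofReal_mul] at this
  linarith

/-- The complex gradient of `r` at the projection is parallel to the normal vector. -/
lemma norm_a_proj (hπ : IsClosestPointSelection Ω π)
    {z : E N} (hz : z ∈ Ω) (hzs : z ∈ ball p m.s₂) (v : E N) :
    ‖m.a (π z) v‖ = ncomp Ω π z v * (‖m.a (π z) (π z - z)‖ / bdist Ω z) := by
  have hδ := m.bdist_pos hπ hz hzs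
  have hnorm : ‖π z - z‖ = bdist Ω z := by
    rw [← (hπ z hz).2, dist_comm, dist_eq_norm]
  have hre : ∀ v, (herm v (π z - z)).re = 0 → (m.a (π z) v).re = 0 := by
    intro v hv
    refine le_antisymm (m.a_proj_re_nonpos' hπ hz hzs hv) ?_
    have := m.a_proj_re_nonpos' hπ (v := -v) hz hzs (by
      rw [herm_eq_inner] at hv ⊢; rw [inner_neg_right, Complex.neg_re, hv, neg_zero])
    rw [map_neg, Complex.neg_re] at this
    linarith
  have hker : ∀ v, herm v (π z - z) = 0 → m.a (π z) v = 0 := by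
    intro v hv
    apply Complex.ext
    · exact hre v (by rw [hv]; rfl)
    · have := hre (Complex.I • v) (by
        rw [herm_eq_inner] at hv ⊢
        rw [inner_smul_right, hv, mul_zero]; rfl)
      simpa using this
  have hself : herm (π z - z) (π z - z) = (bdist Ω z : ℂ) ^ 2 := by
    rw [herm_eq_inner, inner_self_eq_norm_sq_to_K, hnorm]; rfl
  have hδc : (bdist Ω z : ℂ) ≠ 0 := by exact_mod_cast hδ.ne'
  have h1 := hker (v - (herm v (π z - z) / (bdist Ω z : ℂ) ^ 2) • (π z - z)) (by
    have : herm (v - (herm v (π z - z) / (bdist Ω z : ℂ) ^ 2) • (π z - z)) (π z - z) =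
        herm v (π z - z) - (herm v (π z - z) / (bdist Ω z : ℂ) ^ 2) *
          herm (π z - z) (π z - z) := by
      simp only [herm_eq_inner, inner_sub_right, inner_smul_right]
    rw [this, hself]; field_simp; ring)
  rw [map_sub, map_smul, sub_eq_zero, smul_eq_mul] at h1
  rw [h1, norm_mul, norm_div, norm_pow, Complex.norm_real, Real.norm_of_nonneg hδ.le, ncomp]
  field_simp

lemma ncomp_le_norm (hπ : IsClosestPointSelection Ω π)
    {z : E N} (hz : z ∈ Ω) (hzs : z ∈ ball p m.s₂) (v : E N) :
    ncomp Ω π z v ≤ ‖v‖ := by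
  have hδ := m.bdist_pos hπ hz hzs
  have hnorm : ‖π z - z‖ = bdist Ω z := by
    rw [← (hπ z hz).2, dist_comm, dist_eq_norm]
  rw [ncomp, div_le_iff₀ hδ, herm_eq_inner, ← hnorm, mul_comm]
  exact norm_inner_le_norm _ _

lemma a_le_ncomp (hπ : IsClosestPointSelection Ω π)
    {z : E N} (hz : z ∈ Ω) (hzs : z ∈ ball p m.s₂) (v : E N) :
    ‖m.a z v‖ ≤ m.C * (ncomp Ω π z v + bdist Ω z * ‖v‖) := by
  obtain ⟨b1, -⟩ := m.s₂_bounds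
  have hs0 := m.s₂_pos
  have hzb : z ∈ ball p m.s := ball_subset_ball (by linarith) hzs
  have hpb : π z ∈ ball p m.s :=
    ball_subset_ball (by linarith) (m.proj_mem_ball hπ hz hzs).1
  have hδ := m.bdist_pos hπ hz hzs
  have hnorm : ‖π z - z‖ = bdist Ω z := by
    rw [← (hπ z hz).2, dist_comm, dist_eq_norm]
  have h1 := m.norm_a_proj hπ hz hzs v
  have h2 : ‖m.a (π z) (π z - z)‖ / bdist Ω z ≤ m.C := by
    rw [div_le_iff₀ hδ, ← hnorm]; exact m.a_apply_le hpb _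
  have h3 := m.a_sub_apply_le hzb hpb v
  rw [norm_sub_rev z, hnorm] at h3
  have h4 : ‖m.a (π z) v‖ ≤ ncomp Ω π z v * m.C := by
    rw [h1]; have := ncomp_nonneg Ω π z v; gcongr
  have h5 := norm_sub_norm_le (m.a z v) (m.a (π z) v)
  nlinarith

lemma ncomp_le_a (hπ : IsClosestPointSelection Ω π)
    {z : E N} (hz : z ∈ Ω) (hzs : z ∈ ball p m.s₂) (v : E N) :
    ncomp Ω π z v ≤ 2 * ‖m.n‖ * (‖m.a z v‖ + m.C * bdist Ω z * ‖v‖) := by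
  obtain ⟨b1, b2, -⟩ := m.s₂_bounds
  have hs0 := m.s₂_pos
  have hs := m.s_le
  have hC := m.C_pos
  have hzb : z ∈ ball p m.s := ball_subset_ball (by linarith) hzs
  have hpb2 := (m.proj_mem_ball hπ hz hzs).1
  have hpb : π z ∈ ball p m.s := ball_subset_ball (by linarith) hpb2
  have hδ := m.bdist_pos hπ hz hzs
  have hnorm : ‖π z - z‖ = bdist Ω z := by
    rw [← (hπ z hz).2, dist_comm, dist_eq_norm]
  set κ := ‖m.a (π z) (π z - z)‖ / bdist Ω z with hκ
  have h1 := m.norm_a_proj hπ hz hzs v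
  have h2 := m.norm_a_proj hπ hz hzs m.n
  rw [← hκ] at h1 h2
  have hκ0 : 0 ≤ κ := by positivity
  have h3 : 1 / 2 ≤ ‖m.a (π z) m.n‖ := by
    have h4 := m.a_n_close hpb
    have h5 : m.C * ‖π z - p‖ * ‖m.n‖ ≤ m.C * (2 * m.s₂) * ‖m.n‖ := by
      gcongr; rw [← dist_eq_norm]; exact (mem_ball.1 hpb2).le
    have h6 := norm_sub_norm_le (-1 : ℂ) (-(m.a (π z) m.n))
    have h7 : (-1 : ℂ) - -(m.a (π z) m.n) = m.a (π z) m.n + 1 - 2 * 1 := by ring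
    have h8 : ‖(1 : ℂ)‖ ≤ ‖m.a (π z) m.n + 1‖ + ‖m.a (π z) m.n‖ := by
      have : (1 : ℂ) = (m.a (π z) m.n + 1) - m.a (π z) m.n := by ring
      conv_lhs => rw [this]
      exact norm_sub_le _ _
    rw [norm_one] at h8
    nlinarith
  have h4 : 1 / 2 ≤ ‖m.n‖ * κ := by
    rw [h2] at h3
    refine h3.trans ?_
    gcongr
    exact m.ncomp_le_norm hπ hz hzs _
  have h5 := m.a_sub_apply_le hpb hzb v
  rw [hnorm] at h5
  have h6 : ‖m.a (π z) v‖ ≤ ‖m.a z v‖ + m.C * bdist Ω z * ‖v‖ := by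
    linarith [norm_sub_norm_le (m.a (π z) v) (m.a z v)]
  have h7 := ncomp_nonneg Ω π z v
  calc ncomp Ω π z v = 2 * (1 / 2) * ncomp Ω π z v := by ring
    _ ≤ 2 * (‖m.n‖ * κ) * ncomp Ω π z v := by gcongr
    _ = 2 * ‖m.n‖ * (ncomp Ω π z v * κ) := by ring
    _ = 2 * ‖m.n‖ * ‖m.a (π z) v‖ := by rw [h1]
    _ ≤ _ := by gcongr

/-- Near `p` the quantity `Afun` is comparable to its analogue for the defining function. -/
lemma exists_Afun_compare (hπ : IsClosestPointSelection Ω π) :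
    ∃ G : ℝ, 1 ≤ G ∧ ∀ z ∈ Ω, ∀ w ∈ Ω, z ∈ ball p m.s₂ →
    w ∈ ball p m.s₂ → Afun Ω π z w ≤ G * m.Bf z w ∧ m.Bf z w ≤ G * Afun Ω π z w := by
  have hC := m.C_ge
  have hn0 := norm_nonneg m.n
  set G := 3 * m.C + 4 * m.C * ‖m.n‖ with hG
  have hCn := mul_nonneg m.C_pos.le hn0
  have hnC : ‖m.n‖ ≤ m.C * ‖m.n‖ := le_mul_of_one_le_left hn0 hC
  have hG1 : 1 ≤ G := by linarith
  have hG0 : 0 < G := by linarith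
  have hGs : √G ≤ G := by
    rw [Real.sqrt_le_left hG0.le]; nlinarith
  obtain ⟨b1, b2, -⟩ := m.s₂_bounds
  have hs0 := m.s₂_pos
  have hs := m.s_le
  have hpt : ∀ z ∈ Ω, z ∈ ball p m.s₂ → 0 < √(bdist Ω z) ∧ 0 < √(-m.r z) ∧ √(bdist Ω z) ≤ 1 ∧
      √(bdist Ω z) ≤ G * √(-m.r z) ∧ √(-m.r z) ≤ G * √(bdist Ω z) := by
    intro z hz hzs
    have hδ := m.bdist_pos hπ hz hzs
    have hr := m.neg_r_pos hz (ball_subset_ball (by linarith) hzs)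
    refine ⟨Real.sqrt_pos.2 hδ, Real.sqrt_pos.2 hr, ?_, ?_, ?_⟩
    · rw [Real.sqrt_le_one]
      linarith [(m.proj_mem_ball hπ hz hzs).2]
    · calc √(bdist Ω z) ≤ √(G * (-m.r z)) := by
            apply Real.sqrt_le_sqrt
            refine (m.bdist_le_r hz hzs).trans ?_
            gcongr; linarith
        _ = √G * √(-m.r z) := Real.sqrt_mul hG0.le _
        _ ≤ _ := by gcongr
    · calc √(-m.r z) ≤ √(G * bdist Ω z) := by
            apply Real.sqrt_le_sqrt
            refine (m.r_le_bdist hπ hz hzs).trans ?_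
            gcongr; linarith
        _ = √G * √(bdist Ω z) := Real.sqrt_mul hG0.le _
        _ ≤ _ := by gcongr
  refine ⟨2 * G ^ 4, ?_, ?_⟩
  · have : 1 ≤ G ^ 4 := one_le_pow₀ hG1
    linarith
  intro z hz w hw hzs hws
  obtain ⟨x0, X0, x1, xX, Xx⟩ := hpt z hz hzs
  obtain ⟨y0, Y0, y1, yY, Yy⟩ := hpt w hw hws
  have hδ := m.bdist_pos hπ hz hzs
  have hsq : bdist Ω z ≤ √(bdist Ω z) := by
    have := Real.sq_sqrt hδ.le
    nlinarith
  have hV := norm_nonneg (z - w)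
  constructor
  · refine quotient_compare hG1 (norm_nonneg _) hV x0 X0 Y0 ?_ xX Xx Yy
    refine (m.ncomp_le_a hπ hz hzs _).trans ?_
    have e1 : m.C * bdist Ω z * ‖z - w‖ ≤ m.C * (G * √(-m.r z)) * ‖z - w‖ := by
      have := m.C_pos
      gcongr; linarith
    have e2 : 0 ≤ G * √(-m.r z) * ‖z - w‖ := by positivity
    have e3 := norm_nonneg (m.a z (z - w))
    calc _ ≤ 2 * ‖m.n‖ * (‖m.a z (z - w)‖ + m.C * (G * √(-m.r z)) * ‖z - w‖) := by gcongr
      _ ≤ 2 * ‖m.n‖ * (m.C * ‖m.a z (z - w)‖ + m.C * (G * √(-m.r z)) * ‖z - w‖) := by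
        gcongr; exact le_mul_of_one_le_left e3 hC
      _ = 2 * (m.C * ‖m.n‖) * (‖m.a z (z - w)‖ + G * √(-m.r z) * ‖z - w‖) := by ring
      _ ≤ _ := by gcongr; linarith
  · refine quotient_compare hG1 (ncomp_nonneg Ω π _ _) hV X0 x0 y0 ?_ Xx xX yY
    refine (m.a_le_ncomp hπ hz hzs _).trans ?_
    have e2 : 1 * √(bdist Ω z) * ‖z - w‖ ≤ G * √(bdist Ω z) * ‖z - w‖ := by gcongr
    have e1 : bdist Ω z * ‖z - w‖ ≤ √(bdist Ω z) * ‖z - w‖ := by gcongr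
    have e3 := ncomp_nonneg Ω π z (z - w)
    gcongr ?_ * ?_
    · linarith
    · linarith

end Model

lemma artanh_mono {x y : ℝ} (hx : 0 ≤ x) (hxy : x ≤ y) (hy : y < 1) : artanh x ≤ artanh y := by
  unfold artanh
  have h1 : 0 < 1 - y := by linarith
  gcongr
  · exact div_pos (by linarith) (by linarith)
  · linarith

lemma artanh_nonneg {x : ℝ} (hx : 0 ≤ x) (hx1 : x < 1) : 0 ≤ artanh x := by
  have := artanh_mono le_rfl hx hx1
  simpa [artanh] using this

/-- The set of radii in the definition of the Lempert function. -/
def discRadii (Ω : Set (E N)) (z w : E N) : Set ℝ :=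
  { r : ℝ | ∃ φ : ℂ → E N, DifferentiableOn ℂ φ (ball 0 1) ∧
    MapsTo φ (ball (0:ℂ) 1) Ω ∧ φ 0 = z ∧ ∃ a ∈ ball (0:ℂ) 1, φ a = w ∧ r = ‖a‖ }

lemma lempert_eq (Ω : Set (E N)) (z w : E N) : lempert Ω z w = artanh (sInf (discRadii Ω z w)) :=
  rfl

lemma discRadii_nonneg {Ω : Set (E N)} {z w : E N} {r : ℝ} (h : r ∈ discRadii Ω z w) :
    0 ≤ r ∧ r < 1 := by
  obtain ⟨φ, -, -, -, a, ha, -, rfl⟩ := h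
  exact ⟨norm_nonneg _, by simpa using ha⟩

lemma bddBelow_discRadii (Ω : Set (E N)) (z w : E N) : BddBelow (discRadii Ω z w) :=
  ⟨0, fun _ h => (discRadii_nonneg h).1⟩

lemma sInf_discRadii_nonneg (Ω : Set (E N)) (z w : E N) : 0 ≤ sInf (discRadii Ω z w) :=
  Real.sInf_nonneg fun _ h => (discRadii_nonneg h).1

lemma sInf_discRadii_lt_one (Ω : Set (E N)) (z w : E N) : sInf (discRadii Ω z w) < 1 := by
  rcases (discRadii Ω z w).eq_empty_or_nonempty with h | ⟨r, hr⟩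
  · rw [h, Real.sInf_empty]; exact one_pos
  · exact (csInf_le (bddBelow_discRadii Ω z w) hr).trans_lt (discRadii_nonneg hr).2

lemma lempert_nonneg (Ω : Set (E N)) (z w : E N) : 0 ≤ lempert Ω z w :=
  artanh_nonneg (sInf_discRadii_nonneg Ω z w) (sInf_discRadii_lt_one Ω z w)

lemma lempert_le_artanh {Ω : Set (E N)} {z w : E N} {r : ℝ} (h : r ∈ discRadii Ω z w) :
    lempert Ω z w ≤ artanh r :=
  artanh_mono (sInf_discRadii_nonneg Ω z w) (csInf_le (bddBelow_discRadii Ω z w) h)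
    (discRadii_nonneg h).2

/-- The disc automorphism moving `0` to `b`. -/
def mob (b ζ : ℂ) : ℂ := (ζ + b) / (1 + (starRingEnd ℂ) b * ζ)

lemma mob_den_ne {b ζ : ℂ} (hb : ‖b‖ < 1) (hζ : ‖ζ‖ < 1) : 1 + (starRingEnd ℂ) b * ζ ≠ 0 := by
  intro h
  have h1 : ‖(starRingEnd ℂ) b * ζ‖ = 1 := by
    rw [eq_neg_of_add_eq_zero_right h]; simp
  rw [norm_mul, RCLike.norm_conj] at h1
  nlinarith [norm_nonneg b, norm_nonneg ζ]

lemma norm_mob_identity (b ζ : ℂ) : ‖1 + (starRingEnd ℂ) b * ζ‖ ^ 2 - ‖ζ + b‖ ^ 2 =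
    (1 - ‖b‖ ^ 2) * (1 - ‖ζ‖ ^ 2) := by
  simp only [← Complex.normSq_eq_norm_sq, Complex.normSq_apply, Complex.add_re, Complex.add_im,
    Complex.mul_re, Complex.mul_im, Complex.conj_re, Complex.conj_im, Complex.one_re,
    Complex.one_im]
  ring

lemma norm_mob_lt {b ζ : ℂ} (hb : ‖b‖ < 1) (hζ : ‖ζ‖ < 1) : ‖mob b ζ‖ < 1 := by
  have h := norm_mob_identity b ζ
  have hd := norm_pos_iff.2 (mob_den_ne hb hζ)
  rw [mob, norm_div, div_lt_one hd]
  have h1 : 0 < (1 - ‖b‖ ^ 2) * (1 - ‖ζ‖ ^ 2) := by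
    have := norm_nonneg b; have := norm_nonneg ζ
    apply mul_pos <;> nlinarith
  exact lt_of_pow_lt_pow_left₀ 2 hd.le (by linarith)

lemma mob_zero (b : ℂ) : mob b 0 = b := by simp [mob]

lemma mob_mob_neg {b ζ : ℂ} (hb : ‖b‖ < 1) (hζ : ‖ζ‖ < 1) : mob b (mob (-b) ζ) = ζ := by
  have h1 := mob_den_ne (b := -b) (by rwa [norm_neg]) hζ
  have h2 := mob_den_ne hb (norm_mob_lt (b := -b) (by rwa [norm_neg]) hζ)
  rw [mob, div_eq_iff h2, mob]
  rw [map_neg] at h1 ⊢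
  have e : (ζ + -b) / (1 + -(starRingEnd ℂ) b * ζ) + b =
      ζ * (1 + (starRingEnd ℂ) b * ((ζ + -b) / (1 + -(starRingEnd ℂ) b * ζ))) ↔
      (ζ + -b) + b * (1 + -(starRingEnd ℂ) b * ζ) =
      ζ * ((1 + -(starRingEnd ℂ) b * ζ) + (starRingEnd ℂ) b * (ζ + -b)) := by
    generalize 1 + -(starRingEnd ℂ) b * ζ = d at h1 ⊢
    field_simp
  rw [e]
  ring

lemma mob_differentiableOn {b : ℂ} (hb : ‖b‖ < 1) : DifferentiableOn ℂ (mob b) (ball 0 1) := by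
  intro ζ hζ
  have := mob_den_ne hb (mem_ball_zero_iff.1 hζ)
  unfold mob
  exact DifferentiableAt.differentiableWithinAt (by fun_prop (disch := assumption))

/-- A disc through two points, recentred. -/
lemma mem_discRadii_of_disc {Ω : Set (E N)} {φ : ℂ → E N} (hφ : DifferentiableOn ℂ φ (ball 0 1))
    (hm : MapsTo φ (ball (0:ℂ) 1) Ω) {b c : ℂ} (hb : ‖b‖ < 1) (hc : ‖c‖ < 1) :
    ‖mob (-b) c‖ ∈ discRadii Ω (φ b) (φ c) := by
  have hmaps : MapsTo (mob b) (ball 0 1) (ball 0 1) := fun ζ hζ => by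
    rw [mem_ball_zero_iff] at *; exact norm_mob_lt hb hζ
  refine ⟨φ ∘ mob b, hφ.comp (mob_differentiableOn hb) hmaps, hm.comp hmaps, ?_, mob (-b) c, ?_, ?_,
    rfl⟩
  · simp [mob_zero]
  · rw [mem_ball_zero_iff]; exact norm_mob_lt (by rwa [norm_neg]) hc
  · simp [mob_mob_neg hb hc]

/-- An explicit bound for the Lempert function from a disc whose real diameter is
`[-1 - s₂, 1 + s₁]`. -/
lemma lempert_le_log {Ω : Set (E N)} {φ : ℂ → E N} (hφ : Differentiable ℂ φ) {s₁ s₂ : ℝ}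
    (h1 : 0 < s₁) (h2 : 0 < s₂)
    (hm : MapsTo φ (ball (((s₁ - s₂) / 2 : ℝ) : ℂ) ((2 + s₁ + s₂) / 2)) Ω) :
    lempert Ω (φ 1) (φ (-1)) ≤ Real.log ((2 + s₁) * (2 + s₂) / (s₁ * s₂)) / 2 := by
  set T := 2 + s₁ + s₂ with hT
  have hT0 : 0 < T := by positivity
  set ψ : ℂ → E N := fun ζ => φ ((T / 2 : ℝ) * ζ + ((s₁ - s₂) / 2 : ℝ)) with hψ
  have hψd : DifferentiableOn ℂ ψ (ball 0 1) := by
    apply Differentiable.differentiableOn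
    exact hφ.comp (by fun_prop)
  have hψm : MapsTo ψ (ball (0:ℂ) 1) Ω := by
    intro ζ hζ
    apply hm
    rw [mem_ball_zero_iff] at hζ
    rw [mem_ball, dist_eq_norm, add_sub_cancel_right, norm_mul, Complex.norm_real,
      Real.norm_of_nonneg (by positivity)]
    nlinarith
  set x : ℝ := (2 - s₁ + s₂) / T with hx
  set y : ℝ := -(2 + s₁ - s₂) / T with hy
  have hx1 : 1 - x = 2 * s₁ / T := by rw [hx]; field_simp; ring
  have hx2 : 1 + x = (4 + 2 * s₂) / T := by rw [hx]; field_simp; ring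
  have hy1 : 1 - y = (4 + 2 * s₁) / T := by rw [hy]; field_simp; ring
  have hy2 : 1 + y = 2 * s₂ / T := by rw [hy]; field_simp; ring
  have p1 : 0 < 1 - x := by rw [hx1]; positivity
  have p2 : 0 < 1 + x := by rw [hx2]; positivity
  have p3 : 0 < 1 - y := by rw [hy1]; positivity
  have p4 : 0 < 1 + y := by rw [hy2]; positivity
  have hxn : ‖(x : ℂ)‖ < 1 := by
    rw [Complex.norm_real, Real.norm_eq_abs, abs_lt]; constructor <;> linarith
  have hyn : ‖(y : ℂ)‖ < 1 := by
    rw [Complex.norm_real, Real.norm_eq_abs, abs_lt]; constructor <;> linarith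
  have hψx : ψ x = φ 1 := by
    have : (T / 2) * x + (s₁ - s₂) / 2 = 1 := by rw [hx]; field_simp; ring
    simp only [hψ]; congr 1; exact_mod_cast this
  have hψy : ψ y = φ (-1) := by
    have : (T / 2) * y + (s₁ - s₂) / 2 = -1 := by rw [hy]; field_simp; ring
    simp only [hψ]; congr 1; rw [← Complex.ofReal_mul, ← Complex.ofReal_add, this]; simp
  have key := mem_discRadii_of_disc hψd hψm hxn hyn
  rw [hψx, hψy] at key
  refine (lempert_le_artanh key).trans_eq ?_
  have hxy : 0 < x - y := by
    rw [hx, hy, ← sub_div]; apply div_pos _ hT0; ring_nf; norm_num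
  have hden : 0 < 1 - x * y := by nlinarith
  have hmob : ‖mob (-(x : ℂ)) y‖ = (x - y) / (1 - x * y) := by
    rw [mob]
    have : ((y : ℂ) + -(x : ℂ)) / (1 + (starRingEnd ℂ) (-(x : ℂ)) * y) =
        (((y - x) / (1 - x * y) : ℝ) : ℂ) := by
      rw [map_neg, Complex.conj_ofReal]; push_cast; ring
    rw [this, Complex.norm_real, Real.norm_eq_abs, abs_div, abs_of_pos hden,
      abs_of_neg (by linarith)]
    ring
  rw [hmob, artanh]
  congr 2
  have e1 : 1 + (x - y) / (1 - x * y) = (1 + x) * (1 - y) / (1 - x * y) := by field_simp; ring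
  have e2 : 1 - (x - y) / (1 - x * y) = (1 - x) * (1 + y) / (1 - x * y) := by field_simp; ring
  rw [e1, e2, hx1, hx2, hy1, hy2]
  field_simp
  ring

lemma artanh_le_two_mul {x : ℝ} (hx : 0 ≤ x) (hx1 : x ≤ 1 / 2) : artanh x ≤ 2 * x := by
  unfold artanh
  have h : 0 < 1 - x := by linarith
  have := Real.log_le_sub_one_of_pos (x := (1 + x) / (1 - x)) (by positivity)
  have h2 : (1 + x) / (1 - x) - 1 ≤ 4 * x := by
    have e : (1 + x) / (1 - x) - 1 = 2 * x / (1 - x) := by field_simp; ring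
    rw [e, div_le_iff₀ h]; nlinarith
  linarith

lemma re_disc_le {L γ₁ γ₂ e η : ℂ} {A M : ℝ} (h1 : γ₁.re = A) (h2 : γ₂.re = A)
    (h3 : γ₁.im = -L.im / 2) (h4 : |γ₂.im| ≤ M / 2) (hL : ‖L‖ ≤ M) (he : ‖e‖ ≤ M / 2)
    (hη : ‖η‖ ≤ 3) (hη2 : ‖2 - η‖ ≤ 3) :
    (-(η / 2) * L - η * (2 - η) ^ 2 / 4 * γ₁ - (2 - η) * η ^ 2 / 4 * γ₂ +
      (2 - η) * η ^ 2 / 4 * e).re ≤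
    A * (-η.re + (η.re ^ 2 - η.im ^ 2) / 2) + 2 * M * (|η.re| + ‖η‖ ^ 2) := by
  have hM : 0 ≤ M := (norm_nonneg L).trans hL
  have hLr := (Complex.abs_re_le_norm L).trans hL
  have hLi := (Complex.abs_im_le_norm L).trans hL
  have e1 : -(η / 2) * L - η * (2 - η) ^ 2 / 4 * γ₁ - (2 - η) * η ^ 2 / 4 * γ₂ +
      (2 - η) * η ^ 2 / 4 * e = -(η * (L / 2 + γ₁)) + η ^ 2 * (γ₁ - γ₂ / 2) +
      η ^ 3 * ((γ₂ - γ₁) / 4) + (2 - η) * η ^ 2 / 4 * e := by ring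
  rw [e1, Complex.add_re, Complex.add_re, Complex.add_re]
  have a1 : (-(η * (L / 2 + γ₁))).re ≤ -η.re * A + M / 2 * |η.re| := by
    have i1 : (L / 2 + γ₁).im = 0 := by
      rw [Complex.add_im, h3]
      have : (L / 2).im = L.im / 2 := by simp
      rw [this]; ring
    have i2 : (L / 2 + γ₁).re = L.re / 2 + A := by
      rw [Complex.add_re, h1]; simp
    rw [Complex.neg_re, Complex.mul_re, i1, i2]
    have : |η.re * L.re| ≤ |η.re| * M := by rw [abs_mul]; gcongr
    have := (abs_le.1 this).1
    linarith
  have b1 : |γ₁.im| ≤ M / 2 := by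
    rw [h3, abs_le]; have := abs_le.1 hLi; constructor <;> linarith
  have hsq : ‖η‖ ^ 2 = η.re ^ 2 + η.im ^ 2 := by
    rw [← Complex.normSq_eq_norm_sq, Complex.normSq_apply]; ring
  have a2 : (η ^ 2 * (γ₁ - γ₂ / 2)).re ≤ A / 2 * (η.re ^ 2 - η.im ^ 2) + 3 / 4 * M * ‖η‖ ^ 2 := by
    have i2 : (γ₁ - γ₂ / 2).re = A / 2 := by
      rw [Complex.sub_re, h1]
      have : (γ₂ / 2).re = A / 2 := by rw [← h2]; simp
      rw [this]; ring
    have i1 : |(γ₁ - γ₂ / 2).im| ≤ 3 / 4 * M := by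
      have : (γ₁ - γ₂ / 2).im = γ₁.im - γ₂.im / 2 := by simp
      rw [this, abs_le]; have := abs_le.1 b1; have := abs_le.1 h4; constructor <;> linarith
    rw [Complex.mul_re, i2]
    have i3 : |(η ^ 2).im * (γ₁ - γ₂ / 2).im| ≤ ‖η‖ ^ 2 * (3 / 4 * M) := by
      rw [abs_mul]
      gcongr
      exact (Complex.abs_im_le_norm _).trans_eq (norm_pow _ _)
    have i4 : (η ^ 2).re = η.re ^ 2 - η.im ^ 2 := by rw [pow_two, Complex.mul_re]; ring
    rw [i4]
    have := (abs_le.1 i3).1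
    linarith
  have a3 : (η ^ 3 * ((γ₂ - γ₁) / 4)).re ≤ 3 / 4 * M * ‖η‖ ^ 2 := by
    refine (Complex.re_le_norm _).trans ?_
    rw [norm_mul, norm_pow, norm_div]
    have i1 : ‖γ₂ - γ₁‖ ≤ M := by
      refine (Complex.norm_le_abs_re_add_abs_im _).trans ?_
      rw [Complex.sub_re, h1, h2, sub_self, abs_zero, zero_add, Complex.sub_im, abs_le]
      have := abs_le.1 b1; have := abs_le.1 h4; constructor <;> linarith
    have i2 : ‖η‖ ^ 3 ≤ 3 * ‖η‖ ^ 2 := by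
      rw [pow_succ, mul_comm]; gcongr
    have i3 : ‖(4:ℂ)‖ = 4 := by simp
    rw [i3]
    calc ‖η‖ ^ 3 * (‖γ₂ - γ₁‖ / 4) ≤ 3 * ‖η‖ ^ 2 * (M / 4) := by gcongr
      _ = _ := by ring
  have a4 : ((2 - η) * η ^ 2 / 4 * e).re ≤ M / 2 * ‖η‖ ^ 2 := by
    refine (Complex.re_le_norm _).trans ?_
    rw [norm_mul, norm_div, norm_mul, norm_pow]
    have i3 : ‖(4:ℂ)‖ = 4 := by simp
    rw [i3]
    calc ‖2 - η‖ * ‖η‖ ^ 2 / 4 * ‖e‖ ≤ 4 * ‖η‖ ^ 2 / 4 * (M / 2) := by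
          gcongr; linarith
      _ = _ := by ring
  have : 0 ≤ M * |η.re| := by positivity
  linarith

namespace Model

variable {Ω : Set (E N)} {p : E N} (m : Model Ω p)

lemma half_disc {z w k₁ k₂ : E N} {γ₁ γ₂ η : ℂ} {M s₁ : ℝ} (hz : z ∈ Ω) (hzs : z ∈ ball p (m.s / 2))
    (hM : 0 < M) (hMs : 3 * √M ≤ m.s / 2)
    (h1 : γ₁.re = 4 * (2 + m.C) * M) (h2 : γ₂.re = 4 * (2 + m.C) * M)
    (h3 : γ₁.im = -(m.a z (z - w)).im / 2) (h4 : |γ₂.im| ≤ M / 2)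
    (hL : ‖m.a z (z - w)‖ ≤ M) (hzw : ‖z - w‖ ≤ √M)
    (hk₁ : m.a z k₁ = -γ₁) (he : ‖m.a z k₂ + γ₂‖ ≤ M / 2)
    (hk1 : 42 * ‖k₁‖ ≤ 3 * √M) (hk2 : 42 * ‖k₂‖ ≤ 3 * √M)
    (hs₁ : s₁ = -m.r z / (16 * (2 + m.C) * M)) (hs1 : s₁ ≤ 1)
    (hη : ‖η‖ ≤ 3) (hη2 : ‖2 - η‖ ≤ 3) (hr0 : -s₁ < η.re) (hr1 : η.re ≤ 1) :
    z - (η / 2) • (z - w) + (η * (2 - η) ^ 2 / 4) • k₁ + ((2 - η) * η ^ 2 / 4) • k₂ ∈ Ω := by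
  have hC := m.C_ge
  have hs := m.s_pos
  have hzs' : z ∈ ball p m.s := ball_subset_ball (by linarith) hzs
  have hz0 := m.neg_r_pos hz hzs'
  set φ := z - (η / 2) • (z - w) + (η * (2 - η) ^ 2 / 4) • k₁ + ((2 - η) * η ^ 2 / 4) • k₂ with hφ
  have d1 : φ - z = -((η / 2) • (z - w)) + (η * (2 - η) ^ 2 / 4) • k₁ +
      ((2 - η) * η ^ 2 / 4) • k₂ := by rw [hφ]; abel
  have n4 : ‖(4:ℂ)‖ = 4 := by simp
  have n2 : ‖(2:ℂ)‖ = 2 := by simp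
  have hdn : ‖φ - z‖ ≤ ‖η‖ * √M := by
    rw [d1]
    refine norm_add₃_le.trans ?_
    rw [norm_neg, norm_smul, norm_smul, norm_smul, norm_div, norm_div, norm_div, norm_mul,
      norm_mul, norm_pow, norm_pow, n4, n2]
    have j1 : ‖η‖ * ‖2 - η‖ ^ 2 / 4 ≤ ‖η‖ * 3 ^ 2 / 4 := by gcongr
    have j2 : ‖2 - η‖ * ‖η‖ ^ 2 / 4 ≤ 3 * (‖η‖ * 3) / 4 := by
      rw [pow_two]; gcongr
    calc ‖η‖ / 2 * ‖z - w‖ + ‖η‖ * ‖2 - η‖ ^ 2 / 4 * ‖k₁‖ + ‖2 - η‖ * ‖η‖ ^ 2 / 4 * ‖k₂‖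
        ≤ ‖η‖ / 2 * √M + ‖η‖ * 3 ^ 2 / 4 * (3 * √M / 42) + 3 * (‖η‖ * 3) / 4 * (3 * √M / 42) := by
          gcongr <;> linarith
      _ ≤ _ := by nlinarith [mul_nonneg (norm_nonneg η) (Real.sqrt_nonneg M)]
  have hφs : φ ∈ ball p m.s := by
    have : ‖φ - z‖ ≤ 3 * √M := hdn.trans (by gcongr)
    rw [← dist_eq_norm] at this
    have h5 := mem_ball.1 hzs
    rw [mem_ball]
    linarith [dist_triangle φ z p]
  rw [m.mem_iff φ hφs]
  have ht := (abs_le.1 (m.taylor z hzs' φ hφs)).2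
  have hd2 : ‖φ - z‖ ^ 2 ≤ ‖η‖ ^ 2 * M := by
    calc _ ≤ (‖η‖ * √M) ^ 2 := by gcongr
      _ = _ := by rw [mul_pow, Real.sq_sqrt hM.le]
  have ha : m.a z (φ - z) = -(η / 2) * m.a z (z - w) - η * (2 - η) ^ 2 / 4 * γ₁ -
      (2 - η) * η ^ 2 / 4 * γ₂ + (2 - η) * η ^ 2 / 4 * (m.a z k₂ + γ₂) := by
    rw [d1, map_add, map_add, map_neg, map_smul, map_smul, map_smul, hk₁]
    simp only [smul_eq_mul]; ring
  have hre := re_disc_le h1 h2 h3 h4 hL he hη hη2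
  rw [← ha] at hre
  have hsM : 2 * (4 * (2 + m.C)) * M * s₁ = -m.r z / 2 := by
    rw [hs₁]; field_simp; ring
  have hsq : ‖η‖ ^ 2 = η.re ^ 2 + η.im ^ 2 := by
    rw [← Complex.normSq_eq_norm_sq, Complex.normSq_apply]; ring
  have hCM : m.C * ‖φ - z‖ ^ 2 ≤ m.C * (‖η‖ ^ 2 * M) := by gcongr
  have hcase : -4 * η.re + |η.re| + 3 * η.re ^ 2 ≤ 8 * s₁ := by
    rcases le_or_gt 0 η.re with h | h
    · rw [abs_of_nonneg h]
      have : 0 ≤ s₁ := by rw [hs₁]; positivity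
      nlinarith [mul_nonneg h (sub_nonneg.2 hr1)]
    · rw [abs_of_neg h]; nlinarith
  have hfin : 4 * (2 + m.C) * M * (-η.re + (η.re ^ 2 - η.im ^ 2) / 2) + 2 * M * (|η.re| + ‖η‖ ^ 2) +
      m.C * (‖η‖ ^ 2 * M) ≤ 2 * (4 * (2 + m.C)) * M * s₁ := by
    have hpos : 0 ≤ (2 + m.C) * M := by positivity
    have k1 := mul_le_mul_of_nonneg_left hcase hpos
    have k2 : 0 ≤ (2 + m.C) * M * η.im ^ 2 := by positivity
    have k3 : 0 ≤ m.C * M * |η.re| := by positivity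
    rw [hsq]
    linarith
  linarith

lemma neg_r_le_of_ball {z : E N} {s' : ℝ} (hs' : s' ≤ m.s) (hz : z ∈ ball p s') :
    |m.r z| ≤ 3 * m.C * s' := by
  have h := m.r_lip m.p_mem (ball_subset_ball hs' hz)
  rw [m.r_frontier m.p_mem m.mem_frontier, sub_zero] at h
  refine h.trans ?_
  have := m.C_pos
  gcongr
  rw [← dist_eq_norm]; exact (mem_ball.1 hz).le

lemma Mf_le_of_ball {z w : E N} {s' : ℝ} (hs' : s' ≤ m.s) (hz : z ∈ ball p s')
    (hw : w ∈ ball p s') : m.Mf z w ≤ 12 * m.C * s' := by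
  have h1 := (abs_le.1 (m.neg_r_le_of_ball hs' hz)).1
  have h2 := (abs_le.1 (m.neg_r_le_of_ball hs' hw)).1
  have h3 := m.a_apply_le (ball_subset_ball hs' hz) (z - w)
  have h4 : ‖z - w‖ ≤ 2 * s' := norm_sub_le_two hw hz
  have h5 := norm_nonneg (z - w)
  have hC := m.C_ge
  have hs1 := m.s_le
  have hs0 : 0 ≤ s' := by linarith
  have h6 : m.C * ‖z - w‖ ≤ m.C * (2 * s') := by gcongr
  have h7 : ‖z - w‖ ^ 2 ≤ 2 * (2 * s') := by
    rw [pow_two]; gcongr; linarith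
  unfold Mf
  nlinarith

/-- Radius for the upper estimate. -/
def κ : ℝ := m.s / (400 * m.C ^ 2 * (1 + ‖m.n‖))

lemma κ_pos : 0 < m.κ := by
  have := m.s_pos; have := m.C_pos
  unfold κ; positivity

lemma κ_bounds : 400 * m.κ ≤ m.s ∧ 400 * m.C ^ 2 * ‖m.n‖ * m.κ ≤ 1 ∧
    400 * m.C * ‖m.n‖ * m.κ ≤ 1 := by
  have hs := m.s_pos; have hC := m.C_ge; have hs1 := m.s_le
  have hκ := m.κ_pos
  have e : 400 * m.C ^ 2 * (1 + ‖m.n‖) * m.κ = m.s := by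
    unfold κ; field_simp
  have hn := norm_nonneg m.n
  have h2 : 1 ≤ m.C ^ 2 := one_le_pow₀ hC
  have h3 : m.C ≤ m.C ^ 2 := by nlinarith
  have h4 : 0 ≤ m.C ^ 2 * ‖m.n‖ * m.κ := by positivity
  have h5 : m.κ ≤ m.C ^ 2 * m.κ := by nlinarith
  have h6 : m.C * (‖m.n‖ * m.κ) ≤ m.C ^ 2 * (‖m.n‖ * m.κ) := by gcongr
  refine ⟨?_, ?_, ?_⟩ <;> nlinarith

/-- Radius of the ball on which the upper estimate holds. -/
def s₃ : ℝ := m.κ ^ 2 / (12 * m.C ^ 2)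

lemma s₃_pos : 0 < m.s₃ := by
  have := m.κ_pos; have := m.C_pos
  unfold s₃; positivity

lemma s₃_le : m.s₃ ≤ m.κ := by
  have h1 := m.κ_pos; have hC := m.C_ge
  have h2 := m.κ_bounds.1; have := m.s_le
  have : 1 ≤ m.C ^ 2 := one_le_pow₀ hC
  unfold s₃
  rw [div_le_iff₀ (by positivity)]
  nlinarith

/-- Constant of the upper estimate for large distances. -/
def C₆ : ℝ := 384 * (2 + m.C) * m.C ^ 2

lemma exists_normal_vector {z : E N} (hz : z ∈ ball p m.s₃) {M : ℝ} (hM : 0 ≤ M)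
    (hMκ : √M ≤ m.κ) {γ : ℂ} (h : γ.re = 4 * (2 + m.C) * M) (hi : |γ.im| ≤ M / 2) :
    ∃ k : E N, m.a z k = -γ ∧ 42 * ‖k‖ ≤ 3 * √M ∧ m.C * √M * ‖k‖ ≤ M / 2 := by
  have hC := m.C_ge
  obtain ⟨b1, b2, b3⟩ := m.κ_bounds
  have hκ := m.κ_pos
  have hs3 := m.s₃_le
  have hzs : z ∈ ball p m.s := ball_subset_ball (by linarith) hz
  have hn := m.a_n_close hzs
  have hd : ‖z - p‖ ≤ m.κ := by rw [← dist_eq_norm]; linarith [mem_ball.1 hz]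
  have h1 : m.C * ‖z - p‖ * ‖m.n‖ ≤ 1 / 2 := by
    calc m.C * ‖z - p‖ * ‖m.n‖ ≤ m.C * m.κ * ‖m.n‖ := by gcongr
      _ ≤ _ := by linarith
  have h2 : 1 / 2 ≤ ‖m.a z m.n‖ := by
    have : ‖(1:ℂ)‖ ≤ ‖m.a z m.n + 1‖ + ‖m.a z m.n‖ := by
      calc ‖(1:ℂ)‖ = ‖(m.a z m.n + 1) - m.a z m.n‖ := by ring_nf
        _ ≤ _ := norm_sub_le _ _
    rw [norm_one] at this
    linarith
  have h0 : m.a z m.n ≠ 0 := norm_pos_iff.1 (by linarith)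
  have hγ : ‖γ‖ ≤ 13 * m.C * M := by
    refine (Complex.norm_le_abs_re_add_abs_im _).trans ?_
    rw [h, abs_of_nonneg (by positivity)]
    nlinarith
  have hk : ‖(-γ / m.a z m.n) • m.n‖ ≤ 26 * m.C * M * ‖m.n‖ := by
    rw [norm_smul, norm_div, norm_neg]
    gcongr
    rw [div_le_iff₀ (by linarith)]
    have : 0 ≤ 26 * m.C * M := by positivity
    nlinarith
  have hq : √M * √M = M := Real.mul_self_sqrt hM
  have hq0 := Real.sqrt_nonneg M
  have hn0 := norm_nonneg m.n
  refine ⟨(-γ / m.a z m.n) • m.n, ?_, ?_, ?_⟩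
  · rw [map_smul, smul_eq_mul, div_mul_cancel₀ _ h0]
  · calc _ ≤ 42 * (26 * m.C * M * ‖m.n‖) := by gcongr
      _ = 42 * (26 * m.C * ‖m.n‖ * √M) * √M := by nth_rewrite 1 [← hq]; ring
      _ ≤ 42 * (26 * m.C * ‖m.n‖ * m.κ) * √M := by gcongr
      _ ≤ _ := by gcongr; linarith
  · calc _ ≤ m.C * √M * (26 * m.C * M * ‖m.n‖) := by gcongr
      _ = 26 * (m.C ^ 2 * ‖m.n‖ * √M) * M := by ring
      _ ≤ 26 * (m.C ^ 2 * ‖m.n‖ * m.κ) * M := by gcongr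
      _ ≤ M / 2 := by nlinarith

lemma lempert_le_large {z w : E N} (hz : z ∈ Ω) (hw : w ∈ Ω) (hzs : z ∈ ball p m.s₃)
    (hws : w ∈ ball p m.s₃) : lempert Ω z w ≤ Real.log (m.C₆ * (1 + m.Bf z w)) := by
  have hC := m.C_ge
  obtain ⟨b1, b2, b3⟩ := m.κ_bounds
  have hκ := m.κ_pos
  have hs3 := m.s₃_le
  have hs := m.s_pos
  have hz2 : z ∈ ball p (m.s / 2) := ball_subset_ball (by linarith) hzs
  have hw2 : w ∈ ball p (m.s / 2) := ball_subset_ball (by linarith) hws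
  have hz1 : z ∈ ball p m.s := ball_subset_ball (by linarith) hz2
  have hw1 : w ∈ ball p m.s := ball_subset_ball (by linarith) hw2
  have hrz := m.neg_r_pos hz hz1
  have hrw := m.neg_r_pos hw hw1
  set M := m.C * m.Mf z w with hMdef
  have hL0 := norm_nonneg (m.a z (z - w))
  have hV0 := sq_nonneg ‖z - w‖
  have hMf : 0 < m.Mf z w := by unfold Mf; linarith
  have hMfM : m.Mf z w ≤ M := by rw [hMdef]; nlinarith
  have hM : 0 < M := by positivity
  have hMle : M ≤ m.κ ^ 2 := by
    have := m.Mf_le_of_ball (by linarith : m.s₃ ≤ m.s) hzs hws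
    calc M ≤ m.C * (12 * m.C * m.s₃) := by rw [hMdef]; gcongr
      _ = _ := by unfold s₃; field_simp
  have hMκ : √M ≤ m.κ := (Real.sqrt_le_sqrt hMle).trans_eq (Real.sqrt_sq hκ.le)
  have hrzM : -m.r z ≤ M := by unfold Mf at hMfM; linarith
  have hrwM : -m.r w ≤ M := by unfold Mf at hMfM; linarith
  have hLM : ‖m.a z (z - w)‖ ≤ M := by unfold Mf at hMfM; linarith
  have hVM : ‖z - w‖ ^ 2 ≤ M := by unfold Mf at hMfM; linarith
  have hVs : ‖z - w‖ ≤ √M := Real.le_sqrt_of_sq_le hVM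
  have hLM' : ‖m.a w (w - z)‖ ≤ M := by
    have e1 : ‖m.a w (w - z)‖ = ‖m.a w (z - w)‖ := by rw [← neg_sub z w, map_neg, norm_neg]
    have h1 := m.a_sub_apply_le hw1 hz1 (z - w)
    have h2 := norm_le_norm_add_norm_sub' (m.a w (z - w)) (m.a z (z - w))
    have : ‖m.a w (z - w)‖ ≤ ‖m.a z (z - w)‖ + m.C * ‖z - w‖ ^ 2 := by
      rw [norm_sub_rev w z] at h1; nlinarith
    rw [e1, hMdef]
    refine this.trans ?_
    unfold Mf
    nlinarith
  set γ₁ : ℂ := ⟨4 * (2 + m.C) * M, -(m.a z (z - w)).im / 2⟩ with hγ₁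
  set γ₂ : ℂ := ⟨4 * (2 + m.C) * M, -(m.a w (w - z)).im / 2⟩ with hγ₂
  have i1 : |γ₁.im| ≤ M / 2 := by
    have := abs_le.1 ((Complex.abs_im_le_norm _).trans hLM)
    simp only [hγ₁]; rw [abs_le]; constructor <;> linarith
  have i2 : |γ₂.im| ≤ M / 2 := by
    have := abs_le.1 ((Complex.abs_im_le_norm _).trans hLM')
    simp only [hγ₂]; rw [abs_le]; constructor <;> linarith
  obtain ⟨k₁, hk₁, hk₁n, hk₁e⟩ := m.exists_normal_vector hzs hM.le hMκ (γ := γ₁) rfl i1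
  obtain ⟨k₂, hk₂, hk₂n, hk₂e⟩ := m.exists_normal_vector hws hM.le hMκ (γ := γ₂) rfl i2
  have he1 : ‖m.a z k₂ + γ₂‖ ≤ M / 2 := by
    have : m.a z k₂ + γ₂ = m.a z k₂ - m.a w k₂ := by rw [hk₂]; ring
    rw [this]
    refine (m.a_sub_apply_le hz1 hw1 k₂).trans (le_trans ?_ hk₂e)
    gcongr
  have he2 : ‖m.a w k₁ + γ₁‖ ≤ M / 2 := by
    have : m.a w k₁ + γ₁ = m.a w k₁ - m.a z k₁ := by rw [hk₁]; ring
    rw [this]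
    refine (m.a_sub_apply_le hw1 hz1 k₁).trans (le_trans ?_ hk₁e)
    rw [norm_sub_rev]
    gcongr
  set s₁ := -m.r z / (16 * (2 + m.C) * M) with hs₁
  set t₁ := -m.r w / (16 * (2 + m.C) * M) with ht₁
  have hs₁0 : 0 < s₁ := by positivity
  have ht₁0 : 0 < t₁ := by positivity
  have hs₁1 : s₁ ≤ 1 := by
    rw [hs₁, div_le_one (by positivity)]; nlinarith
  have ht₁1 : t₁ ≤ 1 := by
    rw [ht₁, div_le_one (by positivity)]; nlinarith
  set φ : ℂ → E N := fun ζ => z - ((1 - ζ) / 2) • (z - w) +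
    ((1 - ζ) * (1 + ζ) ^ 2 / 4) • k₁ + ((1 + ζ) * (1 - ζ) ^ 2 / 4) • k₂ with hφ
  have hφd : Differentiable ℂ φ := by
    simp only [hφ]; fun_prop
  have hφm : MapsTo φ (ball (((s₁ - t₁) / 2 : ℝ) : ℂ) ((2 + s₁ + t₁) / 2)) Ω := by
    intro ζ hζ
    rw [mem_ball, dist_eq_norm] at hζ
    have hb1 : ‖1 - ζ‖ ≤ 3 := by
      have e : 1 - ζ = (((1 - (s₁ - t₁) / 2 : ℝ) : ℂ)) - (ζ - ((s₁ - t₁) / 2 : ℝ)) := by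
        push_cast; ring
      rw [e]
      refine (norm_sub_le _ _).trans ?_
      rw [Complex.norm_real, Real.norm_eq_abs, abs_of_nonneg (by linarith)]
      linarith
    have hb2 : ‖1 + ζ‖ ≤ 3 := by
      have e : 1 + ζ = (((1 + (s₁ - t₁) / 2 : ℝ) : ℂ)) + (ζ - ((s₁ - t₁) / 2 : ℝ)) := by
        push_cast; ring
      rw [e]
      refine (norm_add_le _ _).trans ?_
      rw [Complex.norm_real, Real.norm_eq_abs, abs_of_nonneg (by linarith)]
      linarith
    have hre := abs_lt.1 ((Complex.abs_re_le_norm _).trans_lt hζ)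
    rw [Complex.sub_re, Complex.ofReal_re] at hre
    rcases le_or_gt 0 ζ.re with h | h
    · have e1 : 2 - (1 - ζ) = 1 + ζ := by ring
      have key := m.half_disc (k₁ := k₁) (k₂ := k₂) (η := 1 - ζ) hz hz2 hM (by linarith) (γ₁ := γ₁)
        (γ₂ := γ₂) rfl rfl rfl i2 hLM hVs hk₁ he1 hk₁n hk₂n hs₁ hs₁1 hb1 (by rw [e1]; exact hb2)
        (by simp; linarith) (by simp; linarith)
      rw [e1] at key
      exact key
    · have e1 : 2 - (1 + ζ) = 1 - ζ := by ring
      have key := m.half_disc (k₁ := k₂) (k₂ := k₁) (η := 1 + ζ) hw hw2 hM (by linarith) (γ₁ := γ₂)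
        (γ₂ := γ₁) rfl rfl rfl i1 hLM' (by rwa [norm_sub_rev]) hk₂ he2 hk₂n hk₁n ht₁ ht₁1 hb2
        (by rw [e1]; exact hb1) (by simp; linarith) (by simp; linarith)
      rw [e1] at key
      have e2 : φ ζ = w - ((1 + ζ) / 2) • (w - z) + ((1 + ζ) * (1 - ζ) ^ 2 / 4) • k₂ +
          ((1 - ζ) * (1 + ζ) ^ 2 / 4) • k₁ := by
        simp only [hφ]; module
      rw [e2]; exact key
  have key := lempert_le_log hφd hs₁0 ht₁0 hφm
  have f1 : φ 1 = z := by simp [hφ]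
  have f2 : φ (-1) = w := by simp [hφ]
  rw [f1, f2] at key
  refine key.trans ?_
  set q := √(-m.r z) * √(-m.r w) with hq
  have hq0 : 0 < q := by positivity
  have hq2 : q ^ 2 = m.r z * m.r w := by
    rw [hq, mul_pow, Real.sq_sqrt hrz.le, Real.sq_sqrt hrw.le]; ring
  have hB := m.Bf_nonneg z w
  have hX : (2 + s₁) * (2 + t₁) / (s₁ * t₁) ≤ (m.C₆ * (1 + m.Bf z w)) ^ 2 := by
    have g1 : s₁ * t₁ = q ^ 2 / (16 * (2 + m.C) * M) ^ 2 := by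
      rw [hs₁, ht₁, hq2]; field_simp
    have g2 : M ≤ m.C * (8 * m.C * (1 + m.Bf z w) * q) := by
      rw [hMdef]; gcongr; exact m.Mf_le_Bf hz hw hz1 hw1
    calc (2 + s₁) * (2 + t₁) / (s₁ * t₁) ≤ (3 * 3) / (s₁ * t₁) := by gcongr <;> linarith
      _ = (3 * (16 * (2 + m.C) * M) / q) ^ 2 := by rw [g1]; field_simp
      _ ≤ _ := by
        gcongr
        rw [div_le_iff₀ hq0]
        calc _ ≤ 3 * (16 * (2 + m.C) * (m.C * (8 * m.C * (1 + m.Bf z w) * q))) := by gcongr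
          _ = _ := by unfold C₆; ring
  have hC6 : 0 < m.C₆ := by unfold C₆; positivity
  have := Real.log_le_log (by positivity) hX
  rw [Real.log_pow] at this
  push_cast at this
  linarith

end Model

lemma lempert_self_nonpos {Ω : Set (E N)} {z : E N} (hz : z ∈ Ω) : lempert Ω z z ≤ 0 := by
  have h : (0:ℝ) ∈ discRadii Ω z z :=
    ⟨fun _ => z, differentiableOn_const z, fun _ _ => hz, rfl, 0, by simp, rfl, by simp⟩
  simpa [artanh] using lempert_le_artanh h

lemma le_log_one_add_two_mul {x : ℝ} (hx : 0 ≤ x) (hx1 : x ≤ 1) : x ≤ Real.log (1 + 2 * x) := by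
  rw [Real.le_log_iff_exp_le (by linarith)]
  have := Real.abs_exp_sub_one_le (x := x) (by rwa [abs_of_nonneg hx])
  rw [abs_of_nonneg hx] at this
  linarith [(abs_le.1 this).2]

namespace Model

variable {Ω : Set (E N)} {p : E N} (m : Model Ω p)

lemma Bf_mul {z w : E N} (hz : 0 < -m.r z) (hw : 0 < -m.r w) :
    ‖m.a z (z - w)‖ + ‖z - w‖ ^ 2 + ‖z - w‖ * √(-m.r z) =
      m.Bf z w * (√(-m.r z) * √(-m.r w)) := by
  unfold Bf; field_simp

lemma Bf_small {z w : E N} (hz : z ∈ Ω) (hw : w ∈ Ω) (hzs : z ∈ ball p m.s)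
    (hws : w ∈ ball p m.s) (hB : 2 * m.C * m.Bf z w ≤ 1) :
    √(-m.r w) ≤ 2 * √(-m.r z) ∧ ‖m.a z (z - w)‖ ≤ 2 * m.Bf z w * (-m.r z) ∧
      ‖z - w‖ ≤ 2 * m.Bf z w * √(-m.r z) := by
  have hz0 := m.neg_r_pos hz hzs
  have hw0 := m.neg_r_pos hw hws
  have hx := Real.sqrt_pos.2 hz0
  have hy := Real.sqrt_pos.2 hw0
  have hx2 := Real.sq_sqrt hz0.le
  have hy2 := Real.sq_sqrt hw0.le
  have hC := m.C_ge
  have hmul := m.Bf_mul hz0 hw0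
  have hr := (abs_le.1 (m.r_sub_le hzs hws)).1
  have hB0 := m.Bf_nonneg z w
  have ha := norm_nonneg (m.a z (z - w))
  have hV := norm_nonneg (z - w)
  set x := √(-m.r z)
  set y := √(-m.r w)
  set B := m.Bf z w
  have hxy : 0 < x * y := by positivity
  have hVx : 0 ≤ ‖z - w‖ * x := by positivity
  have h1 : m.C * (‖m.a z (z - w)‖ + ‖z - w‖ ^ 2) ≤ x * y / 2 := by
    calc _ ≤ m.C * (B * (x * y)) := by gcongr; linarith
      _ = (2 * m.C * B) * (x * y) / 2 := by ring
      _ ≤ 1 * (x * y) / 2 := by gcongr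
      _ = _ := by ring
  have hyx : y ≤ 2 * x := by
    by_contra! h
    nlinarith
  have h2 : B * (x * y) ≤ B * (x * (2 * x)) := by gcongr
  refine ⟨hyx, ?_, ?_⟩
  · have := sq_nonneg ‖z - w‖
    rw [← hx2]; nlinarith
  · have := sq_nonneg ‖z - w‖
    refine le_of_mul_le_mul_right ?_ hx
    nlinarith

lemma lempert_le_small {z w : E N} (hz : z ∈ Ω) (hw : w ∈ Ω) (hzs : z ∈ ball p m.s₃)
    (hws : w ∈ ball p m.s₃) (hB : 16 * m.C * m.Bf z w ≤ 1) :
    lempert Ω z w ≤ 16 * m.C * m.Bf z w := by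
  have hC := m.C_ge
  obtain ⟨b1, b2, b3⟩ := m.κ_bounds
  have hκ := m.κ_pos
  have hs3 := m.s₃_le
  have hs := m.s_pos
  have hz1 : z ∈ ball p m.s := ball_subset_ball (by linarith) hzs
  have hw1 : w ∈ ball p m.s := ball_subset_ball (by linarith) hws
  have hrz := m.neg_r_pos hz hz1
  have hB0 := m.Bf_nonneg z w
  have hCB : 0 ≤ m.C * m.Bf z w := by positivity
  obtain ⟨-, ha, hV⟩ := m.Bf_small hz hw hz1 hw1 (by linarith)
  have hx := Real.sqrt_pos.2 hrz
  have hx2 := Real.sq_sqrt hrz.le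
  have hxκ : √(-m.r z) ≤ m.κ := by
    rw [← Real.sqrt_sq hκ.le]
    apply Real.sqrt_le_sqrt
    have h1 := m.neg_r_le_of_ball (by linarith : m.s₃ ≤ m.s) hzs
    have h2 : 3 * m.C * m.s₃ = m.κ ^ 2 / (4 * m.C) := by unfold s₃; field_simp; norm_num
    have h3 : m.κ ^ 2 / (4 * m.C) ≤ m.κ ^ 2 := div_le_self (sq_nonneg _) (by linarith)
    linarith [(abs_le.1 h1).1]
  set x := √(-m.r z)
  rcases hB0.eq_or_lt with h0 | h0
  · rw [← h0] at hV ⊢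
    have : z = w := by
      rw [← sub_eq_zero, ← norm_le_zero_iff]; linarith
    rw [← this]
    have := lempert_self_nonpos hz
    linarith
  set τ := 8 * m.C * m.Bf z w with hτ
  have hτ0 : 0 < τ := by positivity
  have hτ1 : τ ≤ 1 / 2 := by rw [hτ]; linarith
  set φ : ℂ → E N := fun ζ => z + (ζ / τ) • (w - z) with hφ
  have key : τ ∈ discRadii Ω z w := by
    refine ⟨φ, ?_, ?_, ?_, (τ : ℂ), ?_, ?_, ?_⟩
    · apply Differentiable.differentiableOn; simp only [hφ]; fun_prop
    · intro ζ hζ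
      rw [mem_ball_zero_iff] at hζ
      have hd : φ ζ - z = (ζ / τ) • (w - z) := by simp [hφ]
      have hζτ : ‖ζ / (τ : ℂ)‖ ≤ 1 / τ := by
        rw [norm_div, Complex.norm_real, Real.norm_of_nonneg hτ0.le]; gcongr
      have hdn : ‖φ ζ - z‖ ≤ x / (4 * m.C) := by
        rw [hd, norm_smul, norm_sub_rev w z]
        calc _ ≤ 1 / τ * (2 * m.Bf z w * x) := by gcongr
          _ = _ := by rw [hτ]; field_simp; ring
      have hdx : x / (4 * m.C) ≤ x := div_le_self hx.le (by linarith)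
      have hφs : φ ζ ∈ ball p m.s := by
        rw [← dist_eq_norm] at hdn
        have h5 := mem_ball.1 hzs
        rw [mem_ball]
        linarith [dist_triangle (φ ζ) z p]
      rw [m.mem_iff _ hφs]
      have ht := (abs_le.1 (m.taylor z hz1 _ hφs)).2
      have har : (m.a z (φ ζ - z)).re ≤ -m.r z / 4 := by
        refine (Complex.re_le_norm _).trans ?_
        have e : ‖m.a z (w - z)‖ = ‖m.a z (z - w)‖ := by rw [← neg_sub z w, map_neg, norm_neg]
        rw [hd, map_smul, norm_smul, e]
        calc _ ≤ 1 / τ * (2 * m.Bf z w * (-m.r z)) := by gcongr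
          _ = -m.r z / 4 / m.C := by rw [hτ]; field_simp; ring
          _ ≤ _ := div_le_self (by linarith) hC
      have hq : m.C * ‖φ ζ - z‖ ^ 2 ≤ -m.r z / 16 := by
        calc _ ≤ m.C * (x / (4 * m.C)) ^ 2 := by have := m.C_pos; gcongr
          _ = x ^ 2 / 16 / m.C := by field_simp; ring
          _ ≤ _ := by rw [hx2]; exact div_le_self (by linarith) hC
      linarith
    · simp [hφ]
    · rw [mem_ball_zero_iff, Complex.norm_real, Real.norm_of_nonneg hτ0.le]; linarith
    · have : (τ : ℂ) ≠ 0 := by exact_mod_cast hτ0.ne'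
      simp [hφ, div_self this]
    · rw [Complex.norm_real, Real.norm_of_nonneg hτ0.le]
  refine (lempert_le_artanh key).trans ((artanh_le_two_mul hτ0.le hτ1).trans_eq ?_)
  rw [hτ]; ring

/-- Constant of the upper estimate. -/
def C₇ : ℝ := m.C₆ * (32 * m.C + 1)

lemma C₆_ge : 1 ≤ m.C₆ := by
  have hC := m.C_ge
  have : 1 ≤ m.C ^ 2 := one_le_pow₀ hC
  unfold C₆; nlinarith

lemma C₇_pos : 0 < m.C₇ := by
  have := m.C₆_ge; have := m.C_pos
  unfold C₇; positivity

lemma lempert_le {z w : E N} (hz : z ∈ Ω) (hw : w ∈ Ω) (hzs : z ∈ ball p m.s₃)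
    (hws : w ∈ ball p m.s₃) : lempert Ω z w ≤ Real.log (1 + m.C₇ * m.Bf z w) := by
  have hC := m.C_ge
  have h6 := m.C₆_ge
  have hB := m.Bf_nonneg z w
  have hCB : 0 ≤ m.C * m.Bf z w := by positivity
  rcases le_or_gt (32 * m.C * m.Bf z w) 1 with h | h
  · refine (m.lempert_le_small hz hw hzs hws (by linarith)).trans
      ((le_log_one_add_two_mul (by linarith) (by linarith)).trans
        (Real.log_le_log (by linarith) ?_))
    unfold C₇
    nlinarith
  · refine (m.lempert_le_large hz hw hzs hws).trans (Real.log_le_log (by positivity) ?_)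
    unfold C₇
    nlinarith

end Model

lemma norm_cayley_lt_one {a b : ℂ} (ha : 0 < a.re) (hb : 0 < b.re) :
    ‖(a - b) / (a + (starRingEnd ℂ) b)‖ < 1 := by
  have h0 : a + (starRingEnd ℂ) b ≠ 0 := by
    intro h
    have := congrArg Complex.re h
    simp at this; linarith
  rw [norm_div, div_lt_one (norm_pos_iff.2 h0)]
  refine lt_of_pow_lt_pow_left₀ 2 (norm_nonneg _) ?_
  simp only [← Complex.normSq_eq_norm_sq, Complex.normSq_apply, Complex.add_re, Complex.sub_re,
    Complex.sub_im, Complex.add_im, Complex.conj_re, Complex.conj_im]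
  nlinarith [mul_pos ha hb]

/-- A Schwarz lemma for functions with positive real part near the centre, with a barrier `q`. -/
lemma norm_deriv_le_of_barrier {h q : ℂ → ℂ} {ρ : ℂ → ℝ} {σ r₁ : ℝ}
    (hh : DifferentiableOn ℂ h (ball 0 1)) (hq : DifferentiableOn ℂ q (ball 0 1))
    (hρ : ContinuousOn ρ (ball 0 1)) (hρ0 : ρ 0 < σ) (hr₁ : 0 < r₁)
    (hpos : ∀ ζ ∈ ball (0:ℂ) 1, ρ ζ ≤ σ → 0 < (h ζ).re ∧ 0 ≤ (q ζ).re)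
    (hbar : ∀ ζ ∈ ball (0:ℂ) 1, ρ ζ = σ → r₁ ≤ ‖ζ‖ ∧ Real.exp (-(q ζ).re) ≤ r₁) :
    ‖deriv h 0‖ ≤ 2 * (h 0).re * Real.exp (q 0).re := by
  have hb0 : (0:ℂ) ∈ ball (0:ℂ) 1 := by simp
  have h0 := (hpos 0 hb0 hρ0.le).1
  set b := h 0 with hb
  set mm : ℂ → ℂ := fun ζ => (h ζ - b) / (h ζ + (starRingEnd ℂ) b) with hmm
  have hden : ∀ ζ ∈ ball (0:ℂ) 1, ρ ζ ≤ σ → h ζ + (starRingEnd ℂ) b ≠ 0 := by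
    intro ζ hζ hσ h1
    have := congrArg Complex.re h1
    simp at this; linarith [(hpos ζ hζ hσ).1]
  have hmm1 : ∀ ζ ∈ ball (0:ℂ) 1, ρ ζ ≤ σ → ‖mm ζ‖ ≤ 1 := fun ζ hζ hσ =>
    (norm_cayley_lt_one (hpos ζ hζ hσ).1 h0).le
  have hmm0 : mm 0 = 0 := by simp [hmm, ← hb]
  set W : Set ℂ := ball 0 1 ∩ ρ ⁻¹' Iio σ with hW
  have hWo : IsOpen W := hρ.isOpen_inter_preimage isOpen_ball isOpen_Iio
  have h0W : (0:ℂ) ∈ W := ⟨hb0, hρ0⟩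
  have hmd : ∀ ζ ∈ ball (0:ℂ) 1, ρ ζ ≤ σ → DifferentiableAt ℂ mm ζ := by
    intro ζ hζ hσ
    have d1 := hh.differentiableAt (isOpen_ball.mem_nhds hζ)
    exact (d1.sub_const b).div (d1.add_const _) (hden ζ hζ hσ)
  have hgd : DifferentiableOn ℂ (dslope mm 0) W :=
    (Complex.differentiableOn_dslope (hWo.mem_nhds h0W)).2
      fun ζ hζ => (hmd ζ hζ.1 hζ.2.le).differentiableWithinAt
  have hgn : ∀ ζ : ℂ, ζ ≠ 0 → ‖dslope mm 0 ζ‖ = ‖mm ζ‖ / ‖ζ‖ := by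
    intro ζ hζ
    rw [dslope_of_ne _ hζ, slope_def_field, hmm0, sub_zero, sub_zero, norm_div]
  set f : ℂ → ℂ := fun ζ => dslope mm 0 ζ * Complex.exp (-q ζ) with hf
  have hfn : ∀ ζ, ‖f ζ‖ = ‖dslope mm 0 ζ‖ * Real.exp (-(q ζ).re) := by
    intro ζ; simp only [hf]; rw [norm_mul, Complex.norm_exp, Complex.neg_re]
  have key : ∀ R : ℝ, 0 < R → R < 1 → ‖f 0‖ ≤ 1 / R := by
    intro R hR hR1
    set U : Set ℂ := ball 0 R ∩ W with hU
    have hUo : IsOpen U := isOpen_ball.inter hWo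
    have hbR : closedBall (0:ℂ) R ⊆ ball 0 1 := closedBall_subset_ball hR1
    have hclU : closure U ⊆ closedBall 0 R ∩ {ζ | ρ ζ ≤ σ} := by
      have hcl : IsClosed (closedBall (0:ℂ) R ∩ ρ ⁻¹' Iic σ) :=
        (hρ.mono hbR).preimage_isClosed_of_isClosed isClosed_closedBall isClosed_Iic
      refine closure_minimal (fun ζ hζ => ?_) hcl
      have h1 : ρ ζ < σ := hζ.2.2
      exact ⟨ball_subset_closedBall hζ.1, h1.le⟩
    have h0U : (0:ℂ) ∈ U := ⟨by simpa using hR, h0W⟩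
    have hdc : DiffContOnCl ℂ f U := by
      refine ⟨?_, ?_⟩
      · exact (hgd.mono fun ζ hζ => hζ.2).mul
          ((hq.mono fun ζ hζ => hζ.2.1).neg.cexp)
      · intro ζ hζ
        have h1 := hclU hζ
        have h2 := hbR h1.1
        refine ContinuousAt.continuousWithinAt ?_
        refine ContinuousAt.mul ?_ (hq.differentiableAt
          (isOpen_ball.mem_nhds h2)).continuousAt.neg.cexp
        by_cases hz0 : ζ = 0
        · rw [hz0]
          exact (hgd.differentiableAt (hWo.mem_nhds h0W)).continuousAt
        · rw [continuousAt_dslope_of_ne hz0]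
          exact (hmd ζ h2 h1.2).continuousAt
    refine Complex.norm_le_of_forall_mem_frontier_norm_le
      (isBounded_ball.subset inter_subset_left) hdc ?_ (subset_closure h0U)
    intro ζ hζ
    rw [hUo.frontier_eq] at hζ
    obtain ⟨h1, h2⟩ := hclU hζ.1
    have h2 : ρ ζ ≤ σ := h2
    have h3 := hbR h1
    rw [mem_closedBall_zero_iff] at h1
    have hq0 := (hpos ζ h3 h2).2
    have hmz := hmm1 ζ h3 h2
    have hexp : Real.exp (-(q ζ).re) ≤ 1 := by rw [Real.exp_le_one_iff]; linarith
    rw [hfn]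
    rcases h2.lt_or_eq with hlt | heq
    · have hζR : ‖ζ‖ = R := by
        refine le_antisymm h1 ?_
        by_contra! hlt'
        exact hζ.2 ⟨by rwa [mem_ball_zero_iff], h3, hlt⟩
      have hζ0 : ζ ≠ 0 := norm_pos_iff.1 (by linarith)
      rw [hgn ζ hζ0, hζR]
      calc _ ≤ 1 / R * 1 := by gcongr
        _ = _ := mul_one _
    · obtain ⟨g1, g2⟩ := hbar ζ h3 heq
      have hζp : 0 < ‖ζ‖ := hr₁.trans_le g1
      rw [hgn ζ (norm_pos_iff.1 hζp)]
      calc _ ≤ 1 / r₁ * r₁ := by gcongr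
        _ = 1 := by field_simp
        _ ≤ 1 / R := by rw [le_div_iff₀ hR]; linarith
  have hf1 : ‖f 0‖ ≤ 1 := by
    refine le_of_forall_gt_imp_ge_of_dense fun t ht => ?_
    have := key (1 / t) (by positivity) (by rw [div_lt_one (by linarith)]; exact ht)
    simpa using this
  have hder : deriv mm 0 = deriv h 0 / ((2 * b.re : ℝ) : ℂ) := by
    have d1 := (hh.differentiableAt (isOpen_ball.mem_nhds hb0)).hasDerivAt
    have hd0 := hden 0 hb0 hρ0.le
    have d2 := (d1.sub_const b).fun_div (d1.add_const ((starRingEnd ℂ) b)) hd0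
    rw [d2.deriv, ← hb, sub_self, zero_mul, sub_zero, Complex.add_conj]
    have hne : ((2 * b.re : ℝ) : ℂ) ≠ 0 := by
      exact_mod_cast (by linarith : (2 * b.re) ≠ 0)
    field_simp
  rw [hfn, dslope_same, hder, norm_div, Complex.norm_real, Real.norm_of_nonneg (by linarith),
    Real.exp_neg, ← div_eq_mul_inv, div_le_one (Real.exp_pos _), div_le_iff₀ (by linarith)] at hf1
  linarith

namespace Model

variable {Ω : Set (E N)} {p : E N} (m : Model Ω p)

lemma norm_deriv_comp_le {φ : ℂ → E N} (hφ : DifferentiableOn ℂ φ (ball 0 1))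
    (hm : MapsTo φ (ball (0:ℂ) 1) Ω) {σ r₁ A : ℝ} (hσ : 0 < σ) (hσs : σ ≤ m.s / 3)
    (h0 : φ 0 ∈ ball p (m.s / 3)) (hr₁ : 0 < r₁) (hA : 0 ≤ A)
    (hexit : ∀ ζ ∈ ball (0:ℂ) 1, ‖ζ‖ < r₁ → ‖φ ζ - φ 0‖ < σ)
    (hAr : Real.exp (-(A * (m.c * σ ^ 2))) ≤ r₁) {G : E N → ℂ} (hG : Differentiable ℂ G)
    (hGpos : ∀ y ∈ Ω, y ∈ ball p m.s → 0 < (G y).re) :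
    ‖deriv (fun ζ => G (φ ζ)) 0‖ ≤ 2 * (G (φ 0)).re * Real.exp (2 * A * (-m.r (φ 0))) := by
  have hs := m.s_pos
  have hb0 : (0:ℂ) ∈ ball (0:ℂ) 1 := by simp
  have h0s : φ 0 ∈ ball p m.s := ball_subset_ball (by linarith) h0
  have hin : ∀ ζ ∈ ball (0:ℂ) 1, ‖φ ζ - φ 0‖ ≤ σ → φ ζ ∈ ball p m.s := by
    intro ζ hζ h
    rw [← dist_eq_norm] at h
    have := mem_ball.1 h0
    rw [mem_ball]
    linarith [dist_triangle (φ ζ) (φ 0) p]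
  have hP : ∀ ζ ∈ ball (0:ℂ) 1, ‖φ ζ - φ 0‖ ≤ σ →
      m.c * ‖φ ζ - φ 0‖ ^ 2 ≤ (m.P (φ 0) (φ ζ)).re := by
    intro ζ hζ h
    have h1 := m.P_re_ge h0s (hin ζ hζ h)
    linarith [m.neg_r_pos (hm hb0) h0s, m.neg_r_pos (hm hζ) (hin ζ hζ h)]
  have key := norm_deriv_le_of_barrier (h := fun ζ => G (φ ζ))
    (q := fun ζ => A * m.P (φ 0) (φ ζ)) (ρ := fun ζ => ‖φ ζ - φ 0‖) (σ := σ) (r₁ := r₁)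
    (hG.comp_differentiableOn hφ)
    (((m.P_differentiable (φ 0)).comp_differentiableOn hφ).const_mul _)
    ((hφ.continuousOn.sub continuousOn_const).norm) (by simpa using hσ) hr₁ ?_ ?_
  · refine key.trans_eq ?_
    congr 2
    simp only [Complex.re_ofReal_mul, m.P_self, Complex.ofReal_re]
    ring
  · intro ζ hζ h
    refine ⟨hGpos _ (hm hζ) (hin ζ hζ h), ?_⟩
    rw [Complex.re_ofReal_mul]
    have := hP ζ hζ h
    have hc := m.c_pos
    exact mul_nonneg hA (le_trans (by positivity) this)
  · intro ζ hζ h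
    have h' : ‖φ ζ - φ 0‖ = σ := h
    refine ⟨?_, ?_⟩
    · by_contra! hlt
      exact absurd h' (hexit ζ hζ hlt).ne
    · refine le_trans ?_ hAr
      rw [Complex.re_ofReal_mul]
      have := hP ζ hζ h'.le
      rw [h'] at this
      gcongr

end Model

lemma norm_deriv_le_of_forall_dual {F : Type*} [NormedAddCommGroup F] [NormedSpace ℂ F]
    {φ : ℂ → F} {z : ℂ} (hφ : DifferentiableAt ℂ φ z) {b : ℝ}
    (h : ∀ ℓ : F →L[ℂ] ℂ, ‖ℓ‖ ≤ 1 → ‖deriv (fun ζ => ℓ (φ ζ)) z‖ ≤ b) : ‖deriv φ z‖ ≤ b := by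
  obtain ⟨ℓ, h1, h2⟩ := exists_dual_vector'' ℂ (deriv φ z)
  have h3 : HasDerivAt (fun ζ => ℓ (φ ζ)) (ℓ (deriv φ z)) z :=
    ℓ.hasFDerivAt.comp_hasDerivAt z hφ.hasDerivAt
  have h4 := h ℓ h1
  rw [h3.deriv, h2] at h4
  simpa using h4

namespace Model

variable {Ω : Set (E N)} {p : E N} (m : Model Ω p)

/-- Size of the neighbourhood which discs leave slowly. -/
def σ : ℝ := m.c * m.s ^ 2 / (1000 * m.C)

lemma σ_pos : 0 < m.σ := by
  have := m.c_pos; have := m.s_pos; have := m.C_pos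
  unfold σ; positivity

lemma σ_mul : 1000 * m.C * m.σ = m.c * m.s ^ 2 := by
  have := m.C_pos
  unfold σ; field_simp

lemma σ_le : 1000 * m.σ ≤ m.s := by
  have h1 := m.c_pos; have h2 := m.s_pos; have h3 := m.C_ge; have h4 := m.s_le; have h5 := m.c_le
  have h := m.σ_mul
  have h6 := m.σ_pos
  have : m.c * m.s ^ 2 ≤ 1 * (m.s * 1) := by rw [pow_two]; gcongr
  nlinarith

lemma norm_deriv_le_near_exit {φ : ℂ → E N} (hφ : DifferentiableOn ℂ φ (ball 0 1))
    (hm : MapsTo φ (ball (0:ℂ) 1) Ω) (h0 : φ 0 ∈ ball p m.σ) {R : ℝ} (hR : R ≤ 1 / 2)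
    (hexit : ∀ ζ : ℂ, ‖ζ‖ < R → ‖φ ζ - φ 0‖ < m.σ) {ζ₀ : ℂ} (hζ₀ : ‖ζ₀‖ < R) :
    ‖deriv φ ζ₀‖ ≤ 12 * m.s / √(R - ‖ζ₀‖) := by
  have hs := m.s_pos
  have hσ := m.σ_pos
  have hσs := m.σ_le
  have hC := m.C_pos
  have hc := m.c_pos
  have hin : ∀ ζ : ℂ, ‖ζ‖ < R → φ ζ ∈ ball p (2 * m.σ) := by
    intro ζ hζ
    have h1 := hexit ζ hζ
    rw [← dist_eq_norm] at h1
    have := mem_ball.1 h0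
    rw [mem_ball]
    linarith [dist_triangle (φ ζ) (φ 0) p]
  set t := 1 - ‖ζ₀‖ with ht
  have ht0 : 1 / 2 < t := by rw [ht]; linarith
  have htn : ‖(t : ℂ)‖ = t := by rw [Complex.norm_real, Real.norm_of_nonneg (by linarith)]
  have haff : ∀ ξ ∈ ball (0:ℂ) 1, ζ₀ + t * ξ ∈ ball (0:ℂ) 1 := by
    intro ξ hξ
    rw [mem_ball_zero_iff] at *
    refine (norm_add_le _ _).trans_lt ?_
    rw [norm_mul, htn]; nlinarith
  set ψ : ℂ → E N := fun ξ => φ (ζ₀ + t * ξ) with hψ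
  have hψd : DifferentiableOn ℂ ψ (ball 0 1) :=
    hφ.comp (Differentiable.differentiableOn (by fun_prop)) haff
  have hψm : MapsTo ψ (ball (0:ℂ) 1) Ω := fun ξ hξ => hm (haff ξ hξ)
  have hψ0 : ψ 0 = φ ζ₀ := by simp [hψ]
  have hζ1 : ζ₀ ∈ ball (0:ℂ) 1 := by rw [mem_ball_zero_iff]; linarith
  have hφat := hφ.differentiableAt (isOpen_ball.mem_nhds hζ1)
  set r₁ := R - ‖ζ₀‖ with hr₁
  have hr₁0 : 0 < r₁ := by rw [hr₁]; linarith
  have hr₁1 : r₁ ≤ 1 := by rw [hr₁]; linarith [norm_nonneg ζ₀]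
  have hlog : Real.log r₁ ≤ 0 := Real.log_nonpos hr₁0.le hr₁1
  set D := m.c * (m.s / 3) ^ 2 with hD
  have hD0 : 0 < D := by positivity
  set A := -Real.log r₁ / D with hA
  have hA0 : 0 ≤ A := div_nonneg (by linarith) hD0.le
  have hφζ : φ ζ₀ ∈ ball p (2 * m.σ) := hin ζ₀ hζ₀
  have hrx : -m.r (φ ζ₀) ≤ D / 4 := by
    have h1 := (abs_le.1 (m.neg_r_le_of_ball (by linarith) hφζ)).1
    have h2 := m.σ_mul
    rw [hD]; nlinarith
  have hexp : Real.exp (2 * A * (-m.r (φ ζ₀))) ≤ 1 / √r₁ := by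
    have e : 1 / √r₁ = Real.exp (2 * A * (D / 4)) := by
      have : 2 * A * (D / 4) = -Real.log √r₁ := by
        rw [Real.log_sqrt hr₁0.le, hA]; field_simp; ring
      rw [this, Real.exp_neg, Real.exp_log (Real.sqrt_pos.2 hr₁0), one_div]
    rw [e]; gcongr
  have key : ‖deriv ψ 0‖ ≤ 6 * m.s / √r₁ := by
    have hb0 : (0:ℂ) ∈ ball (0:ℂ) 1 := by simp
    refine norm_deriv_le_of_forall_dual (hψd.differentiableAt (isOpen_ball.mem_nhds hb0))
      fun ℓ hℓ => ?_
    have hℓn : ∀ y ∈ ball p m.s, |(ℓ (y - p)).re| ≤ m.s := by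
      intro y hy
      refine (Complex.abs_re_le_norm _).trans ((ℓ.le_opNorm _).trans ?_)
      have : ‖y - p‖ ≤ m.s := by rw [← dist_eq_norm]; exact (mem_ball.1 hy).le
      calc _ ≤ 1 * m.s := by gcongr
        _ = _ := one_mul _
    have hG := m.norm_deriv_comp_le (φ := ψ) hψd hψm (σ := m.s / 3) (r₁ := r₁) (A := A)
      (by positivity) le_rfl (by rw [hψ0]; exact ball_subset_ball (by linarith) hφζ) hr₁0 hA0
      ?_ ?_ (G := fun y => ((2 * m.s : ℝ) : ℂ) + ℓ (y - p)) ?_ ?_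
    · have e : deriv (fun ζ => ((2 * m.s : ℝ) : ℂ) + ℓ (ψ ζ - p)) 0 =
          deriv (fun ζ => ℓ (ψ ζ)) 0 := by
        have : (fun ζ => ((2 * m.s : ℝ) : ℂ) + ℓ (ψ ζ - p)) =
          fun ζ => ((2 * m.s : ℝ) : ℂ) - ℓ p + ℓ (ψ ζ) := by
          funext ζ; rw [map_sub]; ring
        rw [this, deriv_const_add]
      rw [e] at hG
      refine hG.trans ?_
      rw [hψ0, Complex.add_re, Complex.ofReal_re]
      have := (abs_le.1 (hℓn (φ ζ₀) (ball_subset_ball (by linarith) hφζ))).2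
      calc _ ≤ 2 * (2 * m.s + m.s) * (1 / √r₁) := by gcongr
        _ = _ := by ring
    · intro ξ hξ hξr
      rw [hψ0]
      have h1 : φ (ζ₀ + t * ξ) ∈ ball p (2 * m.σ) := by
        apply hin
        refine (norm_add_le _ _).trans_lt ?_
        rw [norm_mul, htn]
        have : t ≤ 1 := by rw [ht]; linarith [norm_nonneg ζ₀]
        have := mul_le_mul_of_nonneg_right this (norm_nonneg ξ)
        linarith
      have := norm_sub_le_two hφζ h1
      simp only [hψ]
      linarith
    · rw [← hD, hA, div_mul_cancel₀ _ hD0.ne', neg_neg, Real.exp_log hr₁0]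
    · fun_prop
    · intro y _ hy
      rw [Complex.add_re, Complex.ofReal_re]
      linarith [(abs_le.1 (hℓn y hy)).1]
  have hder : deriv ψ 0 = (t : ℂ) • deriv φ ζ₀ := by
    have h1 : HasDerivAt (fun ξ : ℂ => ζ₀ + t * ξ) (t : ℂ) 0 := by
      simpa using ((hasDerivAt_id (0:ℂ)).const_mul (t:ℂ)).const_add ζ₀
    have h2 : HasDerivAt φ (deriv φ ζ₀) (ζ₀ + t * 0) := by simpa using hφat.hasDerivAt
    exact (h2.scomp 0 h1).deriv
  rw [hder, norm_smul, htn] at key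
  have h5 := norm_nonneg (deriv φ ζ₀)
  have h6 : 12 * m.s / √r₁ = 2 * (6 * m.s / √r₁) := by ring
  rw [h6]
  nlinarith

/-- Uniform radius on which discs centred near `p` stay close to their centre. -/
def R₀ : ℝ := (m.σ / (24 * m.s)) ^ 2

lemma R₀_pos : 0 < m.R₀ := by
  have := m.σ_pos; have := m.s_pos
  unfold R₀; positivity

lemma R₀_le : m.R₀ ≤ 1 / 2 := by
  have h1 := m.σ_pos; have h2 := m.s_pos; have h3 := m.σ_le
  unfold R₀
  have : m.σ / (24 * m.s) ≤ 1 / 2 := by rw [div_le_iff₀ (by positivity)]; linarith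
  calc _ ≤ (1 / 2 : ℝ) ^ 2 := by gcongr
    _ ≤ _ := by norm_num

lemma norm_sub_lt_of_norm_lt {φ : ℂ → E N} (hφ : DifferentiableOn ℂ φ (ball 0 1))
    (hm : MapsTo φ (ball (0:ℂ) 1) Ω) (h0 : φ 0 ∈ ball p m.σ) {ζ : ℂ} (hζ : ‖ζ‖ < m.R₀) :
    ‖φ ζ - φ 0‖ < m.σ := by
  have hσ := m.σ_pos
  have hs := m.s_pos
  have hR₀ := m.R₀_pos
  have hR₀1 := m.R₀_le
  by_contra! hcon
  have hsub : closedBall (0:ℂ) ‖ζ‖ ⊆ ball 0 1 := closedBall_subset_ball (by linarith)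
  have hcont : ContinuousOn (fun ξ => ‖φ ξ - φ 0‖) (ball 0 1) :=
    (hφ.continuousOn.sub continuousOn_const).norm
  set S := closedBall (0:ℂ) ‖ζ‖ ∩ (fun ξ => ‖φ ξ - φ 0‖) ⁻¹' Ici m.σ with hS
  have hScl : IsClosed S :=
    (hcont.mono hsub).preimage_isClosed_of_isClosed isClosed_closedBall isClosed_Ici
  have hScp : IsCompact S := (isCompact_closedBall 0 ‖ζ‖).of_isClosed_subset hScl inter_subset_left
  obtain ⟨ξ, hξS, hξmin⟩ := hScp.exists_isMinOn ⟨ζ, by simp, hcon⟩ continuous_norm.continuousOn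
  have hξn : ‖ξ‖ ≤ ‖ζ‖ := by simpa using hξS.1
  have hξσ : m.σ ≤ ‖φ ξ - φ 0‖ := hξS.2
  have hξ0 : 0 < ‖ξ‖ := by
    rw [norm_pos_iff]; rintro rfl
    simp at hξσ; linarith
  set R := ‖ξ‖ with hR
  have hexit : ∀ x : ℂ, ‖x‖ < R → ‖φ x - φ 0‖ < m.σ := by
    intro x hx
    by_contra! hx2
    have : R ≤ ‖x‖ := hξmin (show x ∈ S from ⟨by rw [mem_closedBall_zero_iff]; linarith, hx2⟩)
    linarith
  set u : ℂ := ξ / R with hu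
  have hun : ‖u‖ = 1 := by
    rw [hu, norm_div, Complex.norm_real, Real.norm_of_nonneg hξ0.le, ← hR, div_self hξ0.ne']
  have htu : ∀ t : ℝ, 0 ≤ t → ‖(t : ℂ) * u‖ = t := fun t ht => by
    rw [norm_mul, hun, mul_one, Complex.norm_real, Real.norm_of_nonneg ht]
  have hmem : ∀ t ∈ Icc (0:ℝ) R, (t : ℂ) * u ∈ ball (0:ℂ) 1 := fun t ht => by
    rw [mem_ball_zero_iff, htu t ht.1]; linarith [ht.2]
  have key : ∀ t ∈ Icc (0:ℝ) R, ‖φ ((t : ℂ) * u) - φ 0‖ ≤ 24 * m.s * (√R - √(R - t)) := by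
    intro t ht
    refine image_norm_le_of_norm_deriv_right_le_deriv_boundary'
      (f := fun t : ℝ => φ ((t : ℂ) * u) - φ 0) (f' := fun t : ℝ => u • deriv φ ((t : ℂ) * u))
      (B := fun t : ℝ => 24 * m.s * (√R - √(R - t))) (B' := fun t : ℝ => 12 * m.s / √(R - t))
      (a := 0) (b := R) ?_ ?_ ?_ ?_ ?_ ?_ ht
    · refine ContinuousOn.sub ?_ continuousOn_const
      exact hφ.continuousOn.comp (by fun_prop) hmem
    · intro x hx
      have h1 := (hφ.differentiableAt
        (isOpen_ball.mem_nhds (hmem x ⟨hx.1, hx.2.le⟩))).hasDerivAt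
      have h2 : HasDerivAt (fun t : ℝ => (t : ℂ) * u) u x := by
        simpa using ((hasDerivAt_id x).ofReal_comp).mul_const u
      exact ((h1.scomp x h2).sub_const _).hasDerivWithinAt
    · simp
    · fun_prop
    · intro x hx
      have hp : 0 < R - x := by linarith [hx.2]
      have h1 : HasDerivAt (fun t : ℝ => R - t) (-1) x := by
        simpa using (hasDerivAt_id x).const_sub R
      have h2 := ((h1.sqrt hp.ne').const_sub √R).const_mul (24 * m.s)
      refine (h2.congr_deriv ?_).hasDerivWithinAt
      ring
    · intro x hx
      rw [norm_smul, hun, one_mul]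
      have := m.norm_deriv_le_near_exit hφ hm h0 (R := R) (by linarith) hexit (ζ₀ := (x : ℂ) * u)
        (by rw [htu x hx.1]; exact hx.2)
      rwa [htu x hx.1] at this
  have h1 := key R ⟨hξ0.le, le_rfl⟩
  have h2 : (R : ℂ) * u = ξ := by
    rw [hu]; have : (R : ℂ) ≠ 0 := by exact_mod_cast hξ0.ne'
    field_simp
  rw [h2, sub_self, Real.sqrt_zero, sub_zero] at h1
  have h3 : √R < m.σ / (24 * m.s) := by
    rw [Real.sqrt_lt' (by positivity)]
    exact hξn.trans_lt hζ
  rw [lt_div_iff₀ (by positivity)] at h3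
  linarith

/-- Exponent in the Schwarz lemma near `p`. -/
def C₃ : ℝ := -2 * Real.log m.R₀ / (m.c * m.σ ^ 2)

lemma C₃_pos : 0 < m.C₃ := by
  have h1 := Real.log_neg m.R₀_pos (by linarith [m.R₀_le])
  have := m.c_pos; have := m.σ_pos
  unfold C₃
  apply div_pos <;> [linarith; positivity]

/-- Localised Schwarz lemma near `p`. -/
lemma norm_deriv_comp_le_exp {φ : ℂ → E N} (hφ : DifferentiableOn ℂ φ (ball 0 1))
    (hm : MapsTo φ (ball (0:ℂ) 1) Ω) (h0 : φ 0 ∈ ball p m.σ) {G : E N → ℂ}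
    (hG : Differentiable ℂ G) (hGpos : ∀ y ∈ Ω, y ∈ ball p m.s → 0 < (G y).re) :
    ‖deriv (fun ζ => G (φ ζ)) 0‖ ≤ 2 * (G (φ 0)).re * Real.exp (m.C₃ * (-m.r (φ 0))) := by
  have hσ := m.σ_pos
  have hs := m.s_pos
  have hσs := m.σ_le
  have h3 := m.C₃_pos
  have h := m.norm_deriv_comp_le hφ hm hσ (by linarith)
    (ball_subset_ball (by linarith) h0) m.R₀_pos (A := m.C₃ / 2) (by positivity)
    (fun ζ _ hζ => m.norm_sub_lt_of_norm_lt hφ hm h0 hζ) ?_ hG hGpos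
  · have e : 2 * (m.C₃ / 2) = m.C₃ := by ring
    rwa [e] at h
  · have hc := m.c_pos
    have e : -(m.C₃ / 2 * (m.c * m.σ ^ 2)) = Real.log m.R₀ := by
      unfold C₃; field_simp
    rw [e, Real.exp_log m.R₀_pos]

end Model

/-- Infinitesimally nonexpanding functions with respect to analytic discs. -/
def DiscLipschitz (Ω : Set (E N)) (u : E N → ℝ) : Prop :=
  ∀ φ : ℂ → E N, DifferentiableOn ℂ φ (ball 0 1) → MapsTo φ (ball (0:ℂ) 1) Ω →
    ∀ ε > 0, ∀ᶠ ζ in 𝓝 (0:ℂ), |u (φ ζ) - u (φ 0)| ≤ (1 + ε) * ‖ζ‖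

lemma DiscLipschitz.neg {Ω : Set (E N)} {u : E N → ℝ} (hu : DiscLipschitz Ω u) :
    DiscLipschitz Ω (fun x => -u x) := by
  intro φ hφ hm ε hε
  filter_upwards [hu φ hφ hm ε hε] with ζ hζ
  rwa [← neg_sub', abs_neg]

lemma DiscLipschitz.eventually {Ω : Set (E N)} {u : E N → ℝ} (hu : DiscLipschitz Ω u)
    {φ : ℂ → E N} (hφ : DifferentiableOn ℂ φ (ball 0 1)) (hm : MapsTo φ (ball (0:ℂ) 1) Ω)
    {b : ℂ} (hb : ‖b‖ < 1) {ε : ℝ} (hε : 0 < ε) :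
    ∀ᶠ c in 𝓝 b, |u (φ c) - u (φ b)| ≤ (1 + ε) * ‖mob (-b) c‖ := by
  have hmaps : MapsTo (mob b) (ball 0 1) (ball 0 1) := fun ζ hζ => by
    rw [mem_ball_zero_iff] at *; exact norm_mob_lt hb hζ
  have h1 := hu (φ ∘ mob b) (hφ.comp (mob_differentiableOn hb) hmaps) (hm.comp hmaps) ε hε
  have hbn : ‖-b‖ < 1 := by rwa [norm_neg]
  have hbm : b ∈ ball (0:ℂ) 1 := by rwa [mem_ball_zero_iff]
  have hc : ContinuousAt (mob (-b)) b :=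
    ((mob_differentiableOn hbn).differentiableAt (isOpen_ball.mem_nhds hbm)).continuousAt
  have h0 : mob (-b) b = 0 := by simp [mob]
  rw [ContinuousAt, h0] at hc
  filter_upwards [hc.eventually h1, isOpen_ball.mem_nhds hbm] with c h2 h3
  rw [mem_ball_zero_iff] at h3
  simpa [mob_zero, mob_mob_neg hb h3] using h2

lemma hasDerivAt_artanh {x : ℝ} (h1 : -1 < x) (h2 : x < 1) :
    HasDerivAt artanh (1 / (1 - x ^ 2)) x := by
  have e1 : 0 < 1 + x := by linarith
  have e2 : 0 < 1 - x := by linarith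
  have d1 : HasDerivAt (fun x : ℝ => 1 + x) 1 x := by simpa using (hasDerivAt_id x).const_add 1
  have d2 : HasDerivAt (fun x : ℝ => 1 - x) (-1) x := by simpa using (hasDerivAt_id x).const_sub 1
  have d3 := ((d1.fun_div d2 e2.ne').log (div_pos e1 e2).ne').div_const 2
  have e3 : 1 - x ^ 2 ≠ 0 := by nlinarith
  refine d3.congr_deriv ?_
  have e4 : 1 - x ^ 2 = (1 + x) * (1 - x) := by ring
  rw [e4]
  field_simp
  ring

lemma DiscLipschitz.sub_le_artanh {Ω : Set (E N)} {u : E N → ℝ} (hu : DiscLipschitz Ω u)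
    {φ : ℂ → E N} (hφ : DifferentiableOn ℂ φ (ball 0 1)) (hm : MapsTo φ (ball (0:ℂ) 1) Ω)
    {b : ℂ} (hb : ‖b‖ < 1) : u (φ b) - u (φ 0) ≤ artanh ‖b‖ := by
  have hnorm : ∀ t ∈ Icc (0:ℝ) 1, ‖(t : ℂ) * b‖ < 1 := fun t ht => by
    rw [norm_mul, Complex.norm_real, Real.norm_of_nonneg ht.1]
    nlinarith [norm_nonneg b, ht.2]
  have hcont : ∀ t : ℝ, ContinuousAt (fun x : ℝ => (x : ℂ) * b) t := fun t => by fun_prop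
  have hloc : ∀ t ∈ Icc (0:ℝ) 1, ∀ ε > 0, ∀ᶠ x : ℝ in 𝓝 t, |u (φ (x * b)) - u (φ (t * b))| ≤
      (1 + ε) * ‖mob (-(t * b)) (x * b)‖ := fun t ht ε hε =>
    (hcont t).eventually (hu.eventually hφ hm (hnorm t ht) hε)
  have hmobc : ∀ t ∈ Icc (0:ℝ) 1, ContinuousAt (fun x : ℝ => mob (-(t * b)) (x * b)) t := by
    intro t ht
    have h1 : ‖-((t : ℂ) * b)‖ < 1 := by rw [norm_neg]; exact hnorm t ht
    have h2 : (t : ℂ) * b ∈ ball (0:ℂ) 1 := by rw [mem_ball_zero_iff]; exact hnorm t ht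
    exact ContinuousAt.comp (f := fun x : ℝ => (x : ℂ) * b)
      ((mob_differentiableOn h1).differentiableAt (isOpen_ball.mem_nhds h2)).continuousAt (hcont t)
  have hb0 := norm_nonneg b
  have key := image_le_of_liminf_slope_right_le_deriv_boundary
    (f := fun t : ℝ => u (φ (t * b)) - u (φ 0)) (a := 0) (b := 1)
    (B := fun t => artanh (t * ‖b‖)) (B' := fun t => 1 / (1 - (t * ‖b‖) ^ 2) * ‖b‖)
    ?_ ?_ ?_ ?_ ?_ (show (1:ℝ) ∈ Icc (0:ℝ) 1 by simp)
  · simpa using key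
  · intro t ht
    refine ContinuousAt.continuousWithinAt ?_
    refine ContinuousAt.sub ?_ continuousAt_const
    rw [ContinuousAt, tendsto_iff_norm_sub_tendsto_zero]
    have h3 := (hmobc t ht).norm.const_mul (1 + 1)
    rw [ContinuousAt] at h3
    have h0 : mob (-(t * b)) (t * b) = 0 := by simp [mob]
    rw [h0, norm_zero, mul_zero] at h3
    exact squeeze_zero' (Eventually.of_forall fun _ => norm_nonneg _) (hloc t ht 1 one_pos) h3
  · simp [artanh]
  · intro t ht
    refine ContinuousAt.continuousWithinAt ?_
    have : t * ‖b‖ < 1 := by nlinarith [ht.2]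
    have h0 : 0 ≤ t * ‖b‖ := mul_nonneg ht.1 hb0
    exact ContinuousAt.comp (f := fun t : ℝ => t * ‖b‖)
      (hasDerivAt_artanh (by linarith) this).continuousAt (by fun_prop)
  · intro t ht
    have : t * ‖b‖ < 1 := by nlinarith [ht.2]
    have h0 : 0 ≤ t * ‖b‖ := mul_nonneg ht.1 hb0
    have h1 : HasDerivAt (fun t : ℝ => t * ‖b‖) ‖b‖ t := by
      simpa using (hasDerivAt_id t).mul_const ‖b‖
    exact ((hasDerivAt_artanh (by linarith) this).comp t h1).hasDerivWithinAt
  · intro t ht r hr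
    have ht' : t ∈ Icc (0:ℝ) 1 := ⟨ht.1, ht.2.le⟩
    refine Eventually.frequently ?_
    set g : ℝ → ℝ := fun x => ‖b‖ / ‖1 + (starRingEnd ℂ) (-((t : ℂ) * b)) * (x * b)‖ with hg
    have hden : 1 + (starRingEnd ℂ) (-((t : ℂ) * b)) * (t * b) =
        ((1 - (t * ‖b‖) ^ 2 : ℝ) : ℂ) := by
      have : (starRingEnd ℂ) b * b = ((‖b‖ ^ 2 : ℝ) : ℂ) := by
        rw [mul_comm, Complex.mul_conj, Complex.normSq_eq_norm_sq]
      rw [map_neg, map_mul, Complex.conj_ofReal]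
      calc _ = 1 - (t : ℂ) ^ 2 * ((starRingEnd ℂ) b * b) := by ring
        _ = _ := by rw [this]; push_cast; ring
    have htb : t * ‖b‖ < 1 := by nlinarith [ht.2]
    have htb0 : 0 ≤ t * ‖b‖ := mul_nonneg ht.1 hb0
    have hpos : 0 < 1 - (t * ‖b‖) ^ 2 := by nlinarith
    have hgt : g t = 1 / (1 - (t * ‖b‖) ^ 2) * ‖b‖ := by
      simp only [hg]; rw [hden, Complex.norm_real, Real.norm_of_nonneg hpos.le]; ring
    have hgc : ContinuousAt g t := by
      refine ContinuousAt.div continuousAt_const (by fun_prop) ?_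
      rw [hden, Complex.norm_real, Real.norm_of_nonneg hpos.le]; exact hpos.ne'
    have hex : ∃ ε > 0, (1 + ε) * g t < r := by
      have h2 : ContinuousAt (fun ε : ℝ => (1 + ε) * g t) 0 := by fun_prop
      have h3 : (1 + (0:ℝ)) * g t < r := by rw [hgt]; simpa using hr
      have h4 : ∀ᶠ ε in 𝓝 (0:ℝ), (1 + ε) * g t < r := h2.eventually (gt_mem_nhds h3)
      obtain ⟨d, hd, hd2⟩ := Metric.eventually_nhds_iff.1 h4
      refine ⟨d / 2, by positivity, hd2 ?_⟩
      rw [dist_zero_right, Real.norm_of_nonneg (by positivity)]; linarith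
    obtain ⟨ε, hε, hεr⟩ := hex
    have h5 : ∀ᶠ x in 𝓝 t, (1 + ε) * g x < r :=
      (continuousAt_const.mul hgc).eventually (gt_mem_nhds hεr)
    filter_upwards [nhdsWithin_le_nhds h5, nhdsWithin_le_nhds (hloc t ht' ε hε),
      self_mem_nhdsWithin] with x hx1 hx2 hx3
    have hx3 : t < x := hx3
    have hxt : 0 < x - t := by linarith
    refine lt_of_le_of_lt ?_ hx1
    rw [slope_def_field, div_le_iff₀ hxt, sub_sub_sub_cancel_right]
    refine (le_abs_self _).trans (hx2.trans_eq ?_)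
    have e : (x : ℂ) * b + -(t * b) = ((x - t : ℝ) : ℂ) * b := by push_cast; ring
    simp only [hg]
    rw [mob, e, norm_div, norm_mul, Complex.norm_real, Real.norm_of_nonneg hxt.le]
    ring

lemma le_artanh_sInf {S : Set ℝ} (hS : S.Nonempty) (h01 : ∀ r ∈ S, 0 ≤ r ∧ r < 1) {x : ℝ}
    (h : ∀ r ∈ S, x ≤ artanh r) : x ≤ artanh (sInf S) := by
  have hb : BddBelow S := ⟨0, fun r hr => (h01 r hr).1⟩
  have h1 : sInf S < 1 := by
    obtain ⟨r, hr⟩ := hS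
    exact (csInf_le hb hr).trans_lt (h01 r hr).2
  have h0 : 0 ≤ sInf S := Real.sInf_nonneg fun r hr => (h01 r hr).1
  have he := Real.exp_pos (2 * x)
  have hle : (Real.exp (2 * x) - 1) / (Real.exp (2 * x) + 1) ≤ sInf S := by
    refine le_csInf hS fun r hr => ?_
    obtain ⟨r0, r1⟩ := h01 r hr
    have h2 := h r hr
    unfold artanh at h2
    have h3 : 2 * x ≤ Real.log ((1 + r) / (1 - r)) := by linarith
    have hr1 : 0 < 1 - r := by linarith
    rw [Real.le_log_iff_exp_le (div_pos (by linarith) hr1), le_div_iff₀ hr1] at h3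
    rw [div_le_iff₀ (by positivity)]
    linarith
  rw [div_le_iff₀ (by positivity)] at hle
  have hr1 : 0 < 1 - sInf S := by linarith
  have : 2 * x ≤ Real.log ((1 + sInf S) / (1 - sInf S)) := by
    rw [Real.le_log_iff_exp_le (div_pos (by linarith) hr1), le_div_iff₀ hr1]
    linarith
  unfold artanh
  linarith

lemma DiscLipschitz.sub_le_lempert {Ω : Set (E N)} {u : E N → ℝ} (hu : DiscLipschitz Ω u)
    {a b : E N} (hne : (discRadii Ω a b).Nonempty) : u a - u b ≤ lempert Ω a b := by
  rw [lempert_eq]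
  refine le_artanh_sInf hne (fun r hr => discRadii_nonneg hr) ?_
  rintro r ⟨φ, hφ, hm, rfl, c, hc, rfl, rfl⟩
  have := hu.neg.sub_le_artanh hφ hm (mem_ball_zero_iff.1 hc)
  linarith

lemma sum_lempert_nonneg (Ω : Set (E N)) {n : ℕ} (q : Fin (n + 1) → E N) :
    0 ≤ ∑ i : Fin n, lempert Ω (q i.castSucc) (q i.succ) :=
  Finset.sum_nonneg fun _ _ => lempert_nonneg _ _ _

lemma kobayashi_le_lempert {Ω : Set (E N)} {z w : E N} (hz : z ∈ Ω) (hw : w ∈ Ω) :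
    kobayashi Ω z w ≤ lempert Ω z w := by
  refine csInf_le ⟨0, ?_⟩ ⟨1, ![z, w], rfl, rfl, ?_, ?_⟩
  · rintro r ⟨n, q, -, -, -, rfl⟩
    exact sum_lempert_nonneg Ω q
  · intro i; fin_cases i <;> simpa
  · simp

lemma DiscLipschitz.sub_le_kobayashi {Ω : Set (E N)} {u : E N → ℝ} (hu : DiscLipschitz Ω u)
    (hne : ∀ a ∈ Ω, ∀ b ∈ Ω, (discRadii Ω a b).Nonempty) {z w : E N} (hz : z ∈ Ω) (hw : w ∈ Ω) :
    u z - u w ≤ kobayashi Ω z w := by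
  refine le_csInf ⟨_, 1, ![z, w], rfl, rfl, ?_, rfl⟩ ?_
  · intro i; fin_cases i <;> simpa
  · rintro r ⟨n, q, rfl, rfl, hq, rfl⟩
    clear hz hw
    induction n with
    | zero => simp
    | succ n ih =>
      rw [Fin.sum_univ_succ]
      have h1 := hu.sub_le_lempert (hne _ (hq (Fin.castSucc 0)) _ (hq (Fin.succ 0)))
      have h2 := ih (fun i => q i.succ) fun i => hq _
      simp only [Fin.succ_castSucc, Fin.succ_last] at h2
      rw [Fin.castSucc_zero] at h1 ⊢
      linarith

/-- Points of a domain are joined by the restriction to `[0, 1]` of an entire curve. -/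
lemma exists_entire_curve {Ω : Set (E N)} (hop : IsOpen Ω) (hconn : IsConnected Ω) {a b : E N}
    (ha : a ∈ Ω) (hb : b ∈ Ω) : ∃ φ : ℂ → E N, Differentiable ℂ φ ∧ φ 0 = a ∧ φ 1 = b ∧
      ∀ t ∈ Icc (0:ℝ) 1, φ t ∈ Ω := by
  obtain ⟨γ, hγ⟩ := (hop.isConnected_iff_isPathConnected.1 hconn).joinedIn a ha b hb
  let f : C(unitInterval, E N) := γ
  have hU : {g : C(unitInterval, E N) | MapsTo g univ Ω} ∈ 𝓝 f :=
    (ContinuousMap.isOpen_setOfPred_mapsTo isCompact_univ hop).mem_nhds fun x _ => hγ x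
  obtain ⟨n, hn, hn0⟩ :=
    (((bernsteinApproximation_uniform f).eventually hU).and (eventually_ne_atTop 0)).exists
  let φ : ℂ → E N := fun ζ => ∑ k : Fin (n + 1),
    ((n.choose k : ℂ) * ζ ^ (k : ℕ) * (1 - ζ) ^ (n - k : ℕ)) • f (bernstein.z k)
  have key : ∀ x : unitInterval, φ ((x : ℝ) : ℂ) = bernsteinApproximation n f x := by
    intro x
    rw [bernsteinApproximation.apply]
    refine Finset.sum_congr rfl fun k _ => ?_
    rw [bernstein_apply, ← Complex.coe_smul]
    push_cast
    rfl
  refine ⟨φ, ?_, ?_, ?_, ?_⟩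
  · simp only [φ]
    fun_prop
  · have := key 0
    rw [bernsteinApproximation.apply_zero] at this
    simpa [f] using this
  · have := key 1
    rw [bernsteinApproximation.apply_one hn0] at this
    simpa [f] using this
  · intro t ht
    have := key ⟨t, ht⟩
    simp only at this
    rw [this]
    exact hn (mem_univ _)

lemma norm_sin_sq_sub_le (w : ℂ) :
    ‖Complex.sin w ^ 2 - ((Real.sin w.re ^ 2 : ℝ) : ℂ)‖ ≤ Real.exp (2 * |w.im|) - 1 := by
  have h1 : Complex.sin w ^ 2 - ((Real.sin w.re ^ 2 : ℝ) : ℂ) =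
      (Complex.cos ((2 * w.re : ℝ) : ℂ) - Complex.cos (2 * w)) / 2 := by
    push_cast
    rw [Complex.cos_two_mul, Complex.cos_two_mul, Complex.cos_sq', Complex.cos_sq']
    ring
  have h2 : (2 * w : ℂ) = ((2 * w.re : ℝ) : ℂ) + ((2 * w.im : ℝ) : ℂ) * Complex.I := by
    conv_lhs => rw [← Complex.re_add_im w]
    push_cast; ring
  have h3 : Complex.sin w ^ 2 - ((Real.sin w.re ^ 2 : ℝ) : ℂ) =
      (((Real.cos (2 * w.re) * (1 - Real.cosh (2 * w.im)) : ℝ) : ℂ) +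
        ((Real.sin (2 * w.re) * Real.sinh (2 * w.im) : ℝ) : ℂ) * Complex.I) / 2 := by
    rw [h1, h2, Complex.cos_add_mul_I]
    push_cast
    ring
  have h4 : |Real.sinh (2 * w.im)| = Real.sinh (2 * |w.im|) := by
    rw [Real.abs_sinh, abs_mul, abs_two]
  have h5 : Real.cosh (2 * w.im) = Real.cosh (2 * |w.im|) := by
    rw [← Real.cosh_abs, abs_mul, abs_two]
  have h6 := Real.one_le_cosh (2 * |w.im|)
  have h7 : 0 ≤ Real.sinh (2 * |w.im|) := Real.sinh_nonneg_iff.2 (by positivity)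
  have h8 := Real.cosh_add_sinh (2 * |w.im|)
  have h9 : 1 ≤ Real.exp (2 * |w.im|) := Real.one_le_exp (by positivity)
  rw [h3, norm_div, Complex.norm_two]
  have g1 : ‖((Real.cos (2 * w.re) * (1 - Real.cosh (2 * w.im)) : ℝ) : ℂ)‖ ≤
      Real.cosh (2 * |w.im|) - 1 := by
    rw [Complex.norm_real, norm_mul, Real.norm_eq_abs, Real.norm_eq_abs, h5, abs_sub_comm,
      abs_of_nonneg (by linarith : 0 ≤ Real.cosh (2 * |w.im|) - 1)]
    have g0 : 0 ≤ Real.cosh (2 * |w.im|) - 1 := by linarith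
    calc _ ≤ 1 * (Real.cosh (2 * |w.im|) - 1) := by
          gcongr
          exact Real.abs_cos_le_one _
      _ = _ := one_mul _
  have g2 : ‖((Real.sin (2 * w.re) * Real.sinh (2 * w.im) : ℝ) : ℂ) * Complex.I‖ ≤
      Real.sinh (2 * |w.im|) := by
    rw [norm_mul, Complex.norm_I, mul_one, Complex.norm_real, norm_mul, Real.norm_eq_abs,
      Real.norm_eq_abs, h4]
    calc _ ≤ 1 * Real.sinh (2 * |w.im|) := by
          gcongr
          exact Real.abs_sin_le_one _
      _ = _ := one_mul _
  linarith [norm_add_le ((Real.cos (2 * w.re) * (1 - Real.cosh (2 * w.im)) : ℝ) : ℂ)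
    (((Real.sin (2 * w.re) * Real.sinh (2 * w.im) : ℝ) : ℂ) * Complex.I)]

/-- A disc inside a prescribed neighbourhood of `[0, 1]` passing through `0` and `1`. -/
lemma exists_disc_through_zero_one {U : Set ℂ} (hU : IsOpen U)
    (h01 : ∀ t ∈ Icc (0:ℝ) 1, (t : ℂ) ∈ U) :
    ∃ g : ℂ → ℂ, DifferentiableOn ℂ g (ball 0 1) ∧ MapsTo g (ball 0 1) U ∧ g 0 = 0 ∧
      ∃ c ∈ ball (0:ℂ) 1, g c = 1 := by
  have hK : IsCompact ((fun t : ℝ => (t : ℂ)) '' Icc (0:ℝ) 1) :=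
    isCompact_Icc.image Complex.continuous_ofReal
  obtain ⟨δ, hδ, hsub⟩ := hK.exists_thickening_subset_open hU (by
    rintro _ ⟨t, ht, rfl⟩; exact h01 t ht)
  set η := Real.log (1 + δ) / (2 * Real.pi) with hη
  have hlog : 0 < Real.log (1 + δ) := Real.log_pos (by linarith)
  have hη0 : 0 < η := by positivity
  have hre : ∀ ζ ∈ ball (0:ℂ) 1, 0 < ((1 + ζ) / (1 - ζ)).re := by
    intro ζ hζ
    rw [mem_ball_zero_iff] at hζ
    have hne : 1 - ζ ≠ 0 := by
      intro h
      have : ζ = 1 := by linear_combination -h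
      rw [this] at hζ; simp at hζ
    rw [Complex.div_re, ← add_div]
    refine div_pos ?_ (Complex.normSq_pos.2 hne)
    have h1 : Complex.normSq ζ < 1 := by
      rw [Complex.normSq_eq_norm_sq]; nlinarith [norm_nonneg ζ]
    rw [Complex.normSq_apply] at h1
    simp
    nlinarith
  have hd : DifferentiableOn ℂ (fun ζ : ℂ => Complex.log ((1 + ζ) / (1 - ζ))) (ball 0 1) := by
    intro ζ hζ
    have hne : 1 - ζ ≠ 0 := by
      intro h
      have := hre ζ hζ
      rw [h] at this; simp at this
    refine DifferentiableAt.differentiableWithinAt (DifferentiableAt.clog ?_ (Or.inl (hre ζ hζ)))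
    fun_prop (disch := assumption)
  refine ⟨fun ζ => Complex.sin (η * Complex.log ((1 + ζ) / (1 - ζ))) ^ 2,
    ((hd.const_mul _).csin).pow 2, ?_, by simp, ?_⟩
  · intro ζ hζ
    set w : ℂ := η * Complex.log ((1 + ζ) / (1 - ζ)) with hw
    refine hsub (mem_thickening_iff.2 ⟨_, ⟨Real.sin w.re ^ 2, ⟨sq_nonneg _, Real.sin_sq_le_one _⟩,
      rfl⟩, ?_⟩)
    rw [dist_eq_norm]
    refine (norm_sin_sq_sub_le w).trans_lt ?_
    have h1 : |w.im| < η * (Real.pi / 2) := by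
      rw [hw, Complex.im_ofReal_mul, abs_mul, abs_of_pos hη0, Complex.log_im]
      gcongr
      exact Complex.abs_arg_lt_pi_div_two_iff.2 (Or.inl (hre ζ hζ))
    have hpi := Real.pi_pos
    have h2 : 2 * |w.im| < Real.log (1 + δ) := by
      have : η * (Real.pi / 2) = Real.log (1 + δ) / 4 := by rw [hη]; field_simp; norm_num
      linarith
    rw [Real.lt_log_iff_exp_lt (by linarith)] at h2
    linarith
  · set x := Real.exp (Real.pi / 2 / η) with hx
    have hpi := Real.pi_pos
    have hx1 : 1 < x := Real.one_lt_exp_iff.2 (by positivity)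
    refine ⟨(((x - 1) / (x + 1) : ℝ) : ℂ), ?_, ?_⟩
    · rw [mem_ball_zero_iff, Complex.norm_real, Real.norm_of_nonneg
        (div_nonneg (by linarith) (by linarith)), div_lt_one (by linarith)]
      linarith
    · have h1 : (1 + (((x - 1) / (x + 1) : ℝ) : ℂ)) / (1 - (((x - 1) / (x + 1) : ℝ) : ℂ)) =
          (x : ℂ) := by
        have : (1 + (x - 1) / (x + 1)) / (1 - (x - 1) / (x + 1)) = x := by
          have : x + 1 ≠ 0 := by linarith
          have e : 1 - (x - 1) / (x + 1) = 2 / (x + 1) := by field_simp; ring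
          rw [e]; field_simp; ring
        exact_mod_cast congrArg (fun t : ℝ => (t : ℂ)) this
      simp only [h1]
      rw [← Complex.ofReal_log (by linarith), hx, Real.log_exp, ← Complex.ofReal_mul,
        mul_div_cancel₀ _ hη0.ne', Complex.ofReal_div]
      simp

lemma discRadii_nonempty {Ω : Set (E N)} (hop : IsOpen Ω) (hconn : IsConnected Ω) {a b : E N}
    (ha : a ∈ Ω) (hb : b ∈ Ω) : (discRadii Ω a b).Nonempty := by
  obtain ⟨φ, hφ, h0, h1, hmem⟩ := exists_entire_curve hop hconn ha hb
  obtain ⟨g, hg, hgm, hg0, c, hc, hgc⟩ :=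
    exists_disc_through_zero_one (hop.preimage hφ.continuous) hmem
  exact ⟨‖c‖, fun ζ => φ (g ζ), hφ.comp_differentiableOn hg, hgm, by simp only [hg0, h0], c, hc,
    by simp only [hgc, h1], rfl⟩

/-- Truncation of `g` at height `b`, constant outside the ball of radius `ρ` about `p`. -/
def cutoff (p : E N) (ρ : ℝ) (g : E N → ℝ) (b : ℝ) (y : E N) : ℝ :=
  open Classical in if y ∈ ball p ρ then min (g y) b else b

lemma cutoff_of_mem {p : E N} {ρ : ℝ} {g : E N → ℝ} {b : ℝ} {y : E N} (hy : y ∈ ball p ρ) :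
    cutoff p ρ g b y = min (g y) b := if_pos hy

lemma continuousAt_disc_zero {φ : ℂ → E N} (hφ : DifferentiableOn ℂ φ (ball 0 1)) :
    ContinuousAt φ 0 :=
  (hφ.differentiableAt (isOpen_ball.mem_nhds (by simp))).continuousAt

lemma eventually_cutoff_eq {Ω : Set (E N)} {p : E N} {ρ : ℝ} (hρ : 0 < ρ) {g : E N → ℝ}
    (hg : Continuous g) {b : ℝ} (hcut : ∀ y ∈ Ω, y ∈ ball p ρ → y ∉ ball p (ρ / 2) → b ≤ g y)
    {φ : ℂ → E N} (hφ : DifferentiableOn ℂ φ (ball 0 1)) (hm : MapsTo φ (ball (0:ℂ) 1) Ω)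
    (h0 : φ 0 ∈ ball p ρ → b < g (φ 0)) : ∀ᶠ ζ in 𝓝 (0:ℂ), cutoff p ρ g b (φ ζ) = b := by
  have hc := continuousAt_disc_zero hφ
  by_cases h : φ 0 ∈ ball p ρ
  · filter_upwards [(hg.continuousAt.comp hc).eventually (lt_mem_nhds (h0 h)),
      hc.eventually (isOpen_ball.mem_nhds h)] with ζ h1 h2
    rw [cutoff_of_mem h2]
    exact min_eq_right h1.le
  · have h3 : φ 0 ∈ (closedBall p (ρ / 2))ᶜ := by
      simp only [mem_compl_iff, mem_closedBall, mem_ball, not_le, not_lt] at *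
      linarith
    filter_upwards [hc.eventually (isClosed_closedBall.isOpen_compl.mem_nhds h3),
      isOpen_ball.mem_nhds (mem_ball_self (x := (0:ℂ)) one_pos)] with ζ h4 h5
    by_cases h6 : φ ζ ∈ ball p ρ
    · rw [cutoff_of_mem h6, min_eq_right]
      exact hcut _ (hm h5) h6 fun h7 => h4 (ball_subset_closedBall h7)
    · exact if_neg h6

/-- Infinitesimal chain rule for the truncations. -/
lemma discLipschitz_cutoff {Ω : Set (E N)} {p : E N} {ρ : ℝ} (hρ : 0 < ρ) {g : E N → ℝ}
    (hg : Continuous g) {b : ℝ} (hcut : ∀ y ∈ Ω, y ∈ ball p ρ → y ∉ ball p (ρ / 2) → b ≤ g y)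
    {F : ℝ → ℝ} (h : ∀ φ : ℂ → E N, DifferentiableOn ℂ φ (ball 0 1) →
      MapsTo φ (ball (0:ℂ) 1) Ω → φ 0 ∈ ball p ρ → g (φ 0) ≤ b →
      ∃ F' D, HasDerivAt F F' (g (φ 0)) ∧ 0 ≤ D ∧ |F'| * D ≤ 1 ∧
        ∀ ε > 0, ∀ᶠ ζ in 𝓝 (0:ℂ), |g (φ ζ) - g (φ 0)| ≤ (D + ε) * ‖ζ‖) :
    DiscLipschitz Ω (fun y => F (cutoff p ρ g b y)) := by
  intro φ hφ hm ε hε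
  by_cases h0 : φ 0 ∈ ball p ρ → b < g (φ 0)
  · have h1 := eventually_cutoff_eq hρ hg hcut hφ hm h0
    have h2 := h1.self_of_nhds
    filter_upwards [h1] with ζ h3
    rw [h2, h3, sub_self, abs_zero]
    positivity
  · push Not at h0
    obtain ⟨hb, hgb⟩ := h0
    obtain ⟨F', D, hF, hD, hFD, hloc⟩ := h φ hφ hm hb hgb
    have hc := continuousAt_disc_zero hφ
    set q : ℂ → ℝ := fun ζ => min (g (φ ζ)) b with hq
    have hq0 : q 0 = g (φ 0) := min_eq_left hgb
    have hqc : ContinuousAt q 0 := (hg.continuousAt.comp hc).min continuousAt_const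
    obtain ⟨e, he, hee⟩ : ∃ e > 0, (|F'| + e) * (D + e) ≤ 1 + ε := by
      have h2 : ContinuousAt (fun e : ℝ => (|F'| + e) * (D + e)) 0 := by fun_prop
      have h3 : (|F'| + 0) * (D + 0) < 1 + ε := by simp only [add_zero]; linarith
      obtain ⟨d, hd, hd2⟩ := Metric.eventually_nhds_iff.1 (h2.eventually (gt_mem_nhds h3))
      refine ⟨d / 2, by positivity, (hd2 ?_).le⟩
      rw [dist_zero_right, Real.norm_of_nonneg (by positivity)]; linarith
    have hFq : ∀ᶠ ζ in 𝓝 (0:ℂ), |F (q ζ) - F (q 0)| ≤ (|F'| + e) * |q ζ - q 0| := by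
      refine hqc.eventually (p := fun t => |F t - F (q 0)| ≤ (|F'| + e) * |t - q 0|) ?_
      rw [hq0]
      filter_upwards [hF.isLittleO.def he] with t ht
      rw [smul_eq_mul] at ht
      simp only [Real.norm_eq_abs] at ht
      have := abs_add_le (F t - F (g (φ 0)) - (t - g (φ 0)) * F') ((t - g (φ 0)) * F')
      rw [sub_add_cancel, abs_mul] at this
      linarith
    filter_upwards [hFq, hloc e he, hc.eventually (isOpen_ball.mem_nhds hb)] with ζ h1 h2 h3
    rw [cutoff_of_mem h3, cutoff_of_mem hb]
    refine h1.trans ?_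
    have h4 : |q ζ - q 0| ≤ |g (φ ζ) - g (φ 0)| := by
      have := abs_min_sub_min_le_max (g (φ ζ)) b (g (φ 0)) b
      rwa [sub_self, abs_zero, max_eq_left (abs_nonneg _)] at this
    calc (|F'| + e) * |q ζ - q 0| ≤ (|F'| + e) * ((D + e) * ‖ζ‖) := by
          gcongr; exact h4.trans h2
      _ = (|F'| + e) * (D + e) * ‖ζ‖ := by ring
      _ ≤ _ := by gcongr

lemma DiscLipschitz.sub {Ω : Set (E N)} {u v : E N → ℝ} (hu : DiscLipschitz Ω u)
    (hv : DiscLipschitz Ω v) (h : ∀ φ : ℂ → E N, DifferentiableOn ℂ φ (ball 0 1) →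
      MapsTo φ (ball (0:ℂ) 1) Ω → (∀ᶠ ζ in 𝓝 (0:ℂ), u (φ ζ) = u (φ 0)) ∨
        ∀ᶠ ζ in 𝓝 (0:ℂ), v (φ ζ) = v (φ 0)) :
    DiscLipschitz Ω (fun y => u y - v y) := by
  intro φ hφ hm ε hε
  rcases h φ hφ hm with h | h
  · filter_upwards [h, hv φ hφ hm ε hε] with ζ h1 h2
    rw [h1, sub_sub_sub_cancel_left, abs_sub_comm]
    exact h2
  · filter_upwards [h, hu φ hφ hm ε hε] with ζ h1 h2
    rw [h1, sub_sub_sub_cancel_right]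
    exact h2

lemma eventually_norm_sub_le {F : Type*} [NormedAddCommGroup F] [NormedSpace ℂ F] {h : ℂ → F}
    (hh : DifferentiableAt ℂ h 0) {D : ℝ} (hD : ‖deriv h 0‖ ≤ D) {ε : ℝ} (hε : 0 < ε) :
    ∀ᶠ ζ in 𝓝 (0:ℂ), ‖h ζ - h 0‖ ≤ (D + ε) * ‖ζ‖ := by
  filter_upwards [hh.hasDerivAt.isLittleO.def hε] with ζ h1
  rw [sub_zero] at h1
  have h2 := norm_add_le (h ζ - h 0 - ζ • deriv h 0) (ζ • deriv h 0)
  rw [sub_add_cancel, norm_smul] at h2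
  have h3 := mul_le_mul_of_nonneg_left hD (norm_nonneg ζ)
  linarith

namespace Model

variable {Ω : Set (E N)} {p : E N} (m : Model Ω p)

/-- The profile of the barrier functions near the diagonal. -/
def F (t : ℝ) : ℝ := -Real.log t / 2 + m.C₃ * t / 2

lemma neg_r_le_P {z y : E N} (hz : z ∈ Ω) (hy : y ∈ Ω) (hzs : z ∈ ball p m.s)
    (hys : y ∈ ball p m.s) : -m.r z ≤ ‖m.P z y‖ ∧ -m.r y ≤ ‖m.P z y‖ := by
  have h1 := (m.P_re_ge hzs hys).trans (Complex.re_le_norm _)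
  have h2 : 0 ≤ m.c * ‖y - z‖ ^ 2 := mul_nonneg m.c_pos.le (sq_nonneg _)
  have h3 := m.neg_r_pos hz hzs
  have h4 := m.neg_r_pos hy hys
  constructor <;> linarith

lemma P_far {z y : E N} (hz : z ∈ Ω) (hy : y ∈ Ω) (hzσ : z ∈ ball p (m.σ / 4))
    (hys : y ∈ ball p m.σ) (hyf : y ∉ ball p (m.σ / 2)) :
    m.σ / 4 ≤ ‖y - z‖ ∧ m.c * m.σ ^ 2 / 16 ≤ ‖m.P z y‖ := by
  have hσ := m.σ_pos
  have hσs := m.σ_le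
  have hzs : z ∈ ball p m.s := ball_subset_ball (by linarith) hzσ
  have hys' : y ∈ ball p m.s := ball_subset_ball (by linarith) hys
  have h1 := (m.P_re_ge hzs hys').trans (Complex.re_le_norm _)
  have h3 := m.neg_r_pos hz hzs
  have h4 := m.neg_r_pos hy hys'
  have h5 : m.σ / 4 ≤ ‖y - z‖ := by
    rw [← dist_eq_norm]
    simp only [mem_ball, not_lt] at hzσ hyf
    linarith [dist_triangle y z p]
  have h6 : m.c * (m.σ / 4) ^ 2 ≤ m.c * ‖y - z‖ ^ 2 := by
    have := m.c_pos
    gcongr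
  exact ⟨h5, by linarith⟩

lemma discLipschitz_F {z : E N} (hz : z ∈ Ω) (hzσ : z ∈ ball p (m.σ / 4)) {τ : ℝ}
    (hτ1 : m.C₃ * τ ≤ 1) (hτ2 : τ ≤ m.c * m.σ ^ 2 / 16) :
    DiscLipschitz Ω (fun y => m.F (cutoff p m.σ (fun y => ‖m.P z y‖) τ y)) := by
  have hσ := m.σ_pos
  have hσs := m.σ_le
  have hC₃ := m.C₃_pos
  have hzs : z ∈ ball p m.s := ball_subset_ball (by linarith) hzσ
  refine discLipschitz_cutoff hσ (m.P_differentiable z).continuous.norm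
    (fun y hy hy1 hy2 => hτ2.trans (m.P_far hz hy hzσ hy1 hy2).2) ?_
  intro φ hφ hm h0 hτ
  have hb0 : (0:ℂ) ∈ ball (0:ℂ) 1 := by simp
  have h0s : φ 0 ∈ ball p m.s := ball_subset_ball (by linarith) h0
  set t := ‖m.P z (φ 0)‖ with ht
  obtain ⟨h1, h2⟩ := m.neg_r_le_P hz (hm hb0) hzs h0s
  rw [← ht] at h1 h2
  have ht0 : 0 < t := (m.neg_r_pos hz hzs).trans_le h1
  have ht1 : m.C₃ * t ≤ 1 := le_trans (by gcongr) hτ1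
  have hd : DifferentiableAt ℂ (fun ζ => m.P z (φ ζ)) 0 :=
    (m.P_differentiable z).differentiableAt.comp 0 (hφ.differentiableAt (isOpen_ball.mem_nhds hb0))
  have hder : ‖deriv (fun ζ => m.P z (φ ζ)) 0‖ ≤ 2 * t * Real.exp (m.C₃ * t) := by
    refine (m.norm_deriv_comp_le_exp hφ hm h0 (m.P_differentiable z) ?_).trans ?_
    · intro y hy hys
      have g1 := m.P_re_ge hzs hys
      have g2 : 0 ≤ m.c * ‖y - z‖ ^ 2 := mul_nonneg m.c_pos.le (sq_nonneg _)
      linarith [m.neg_r_pos hz hzs, m.neg_r_pos hy hys]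
    · gcongr
      exact Complex.re_le_norm _
  refine ⟨-(1 / t) / 2 + m.C₃ * 1 / 2, 2 * t * Real.exp (m.C₃ * t), ?_, by positivity, ?_, ?_⟩
  · have d1 := (Real.hasDerivAt_log ht0.ne').neg.div_const 2
    have d2 := ((hasDerivAt_id t).const_mul m.C₃).div_const 2
    rw [one_div]
    exact d1.add d2
  · have e : -(1 / t) / 2 + m.C₃ * 1 / 2 = -((1 - m.C₃ * t) / (2 * t)) := by field_simp; ring
    have h3 : 0 ≤ (1 - m.C₃ * t) / (2 * t) := div_nonneg (by linarith) (by positivity)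
    rw [e, abs_neg, abs_of_nonneg h3]
    have h4 : 1 - m.C₃ * t ≤ Real.exp (-(m.C₃ * t)) := Real.one_sub_le_exp_neg _
    calc (1 - m.C₃ * t) / (2 * t) * (2 * t * Real.exp (m.C₃ * t))
        = (1 - m.C₃ * t) * Real.exp (m.C₃ * t) := by field_simp
      _ ≤ Real.exp (-(m.C₃ * t)) * Real.exp (m.C₃ * t) := by gcongr
      _ = 1 := by rw [← Real.exp_add]; simp
  · intro ε hε
    filter_upwards [eventually_norm_sub_le hd hder hε] with ζ hζ
    exact (abs_norm_sub_norm_le _ _).trans hζ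

lemma F_min_sub_ge {a τ : ℝ} (ha : 0 < a) (hτ : 0 < τ) (hτ1 : m.C₃ * τ ≤ 1) :
    (Real.log τ - Real.log (2 * a)) / 2 - 1 / 2 ≤ m.F (min (2 * a) τ) - m.F τ := by
  have hC₃ := m.C₃_pos
  unfold F
  rcases le_total (2 * a) τ with h | h
  · rw [min_eq_left h]
    have : 0 ≤ m.C₃ * (2 * a) := by positivity
    linarith
  · rw [min_eq_right h]
    have := Real.log_le_log hτ h
    linarith

/-- Radius for the lower estimates. -/
def s₄ : ℝ := min (m.σ / 4) (min 1 (min (1 / m.C₃) (m.c * m.σ ^ 2 / 16)) / (12 * m.C))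

lemma s₄_pos : 0 < m.s₄ := by
  have := m.σ_pos; have := m.C₃_pos; have := m.c_pos; have := m.C_pos
  unfold s₄; positivity

lemma s₄_bounds : m.s₄ ≤ m.σ / 4 ∧ 12 * m.C * m.s₄ ≤ 1 ∧ m.C₃ * (12 * m.C * m.s₄) ≤ 1 ∧
    12 * m.C * m.s₄ ≤ m.c * m.σ ^ 2 / 16 := by
  have hC₃ := m.C₃_pos; have hC := m.C_pos
  have h : 12 * m.C * m.s₄ ≤ min 1 (min (1 / m.C₃) (m.c * m.σ ^ 2 / 16)) := by
    rw [mul_comm, ← le_div_iff₀ (by positivity)]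
    exact min_le_right _ _
  refine ⟨min_le_left _ _, h.trans (min_le_left _ _), ?_,
    h.trans ((min_le_right _ _).trans (min_le_right _ _))⟩
  have := h.trans ((min_le_right _ _).trans (min_le_left _ _))
  rwa [le_div_iff₀ hC₃, mul_comm] at this

/-- Multiplicative constant in the logarithmic lower bound. -/
def c₀ : ℝ := 1 / (12 * m.C₅ * Real.exp 1)

lemma c₀_pos : 0 < m.c₀ := by
  have := m.C₅_pos
  unfold c₀; positivity

lemma log_le_kobayashi (hconn : IsConnected Ω) {z w : E N} (hz : z ∈ Ω) (hw : w ∈ Ω)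
    (hzs : z ∈ ball p m.s₄) (hws : w ∈ ball p m.s₄) :
    Real.log (m.c₀ * (1 + m.Bf z w)) ≤ kobayashi Ω z w := by
  obtain ⟨b1, b2, b3, b4⟩ := m.s₄_bounds
  have hσ := m.σ_pos
  have hσs := m.σ_le
  have hC₅ := m.C₅_pos
  have hC₃ := m.C₃_pos
  have hzσ : z ∈ ball p (m.σ / 4) := ball_subset_ball b1 hzs
  have hwσ : w ∈ ball p (m.σ / 4) := ball_subset_ball b1 hws
  have hzs' : z ∈ ball p m.s := ball_subset_ball (by linarith) hzσ
  have hws' : w ∈ ball p m.s := ball_subset_ball (by linarith) hwσ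
  have hz0 := m.neg_r_pos hz hzs'
  have hw0 := m.neg_r_pos hw hws'
  have hM := m.Mf_le_of_ball (by linarith) hzs hws
  have hM0 : 0 < m.Mf z w := by
    unfold Mf
    have := norm_nonneg (m.a z (z - w))
    have := sq_nonneg ‖z - w‖
    linarith
  have hC₅1 : 1 ≤ m.C₅ := by
    have := m.c_pos; have := m.C₄_pos; have := m.C_pos
    have h : 0 ≤ 4 / m.c + 2 * m.C₄ + 2 * m.C / m.c := by positivity
    unfold C₅; linarith
  set τ := m.Mf z w / (2 * m.C₅) with hτ
  have hτ0 : 0 < τ := by positivity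
  have hτM : m.C₅ * τ = m.Mf z w / 2 := by rw [hτ]; field_simp
  have hτle : τ ≤ 12 * m.C * m.s₄ := by nlinarith
  have hτ1 : m.C₃ * τ ≤ 1 := le_trans (by gcongr) b3
  have hτ2 := hτle.trans b4
  have hdisj : ∀ y ∈ Ω, y ∈ ball p m.σ → τ < ‖m.P z y‖ ∨ τ < ‖m.P w y‖ := by
    intro y hy hyσ
    by_contra! hcon
    have := m.Mf_le_of_P_le hz hw hy hzs' hws' (ball_subset_ball (by linarith) hyσ) hcon.1 hcon.2
    linarith
  set u : E N → E N → ℝ := fun x y => m.F (cutoff p m.σ (fun y => ‖m.P x y‖) τ y) with hu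
  have hconst : ∀ x ∈ Ω, x ∈ ball p (m.σ / 4) → ∀ φ : ℂ → E N,
      DifferentiableOn ℂ φ (ball 0 1) → MapsTo φ (ball (0:ℂ) 1) Ω →
      (φ 0 ∈ ball p m.σ → τ < ‖m.P x (φ 0)‖) → ∀ᶠ ζ in 𝓝 (0:ℂ), u x (φ ζ) = u x (φ 0) := by
    intro x hx hxσ φ hφ hm h0
    have h1 := eventually_cutoff_eq hσ (m.P_differentiable x).continuous.norm
      (fun y hy hy1 hy2 => hτ2.trans (m.P_far hx hy hxσ hy1 hy2).2) hφ hm h0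
    have h2 := h1.self_of_nhds
    filter_upwards [h1] with ζ h3
    simp only [hu]
    rw [h2, h3]
  have hL : DiscLipschitz Ω (fun y => u z y - u w y) := by
    refine (m.discLipschitz_F hz hzσ hτ1 hτ2).sub (m.discLipschitz_F hw hwσ hτ1 hτ2) ?_
    intro φ hφ hm
    by_cases h0 : φ 0 ∈ ball p m.σ
    · rcases hdisj _ (hm (by simp)) h0 with h1 | h1
      · exact Or.inl (hconst z hz hzσ φ hφ hm fun _ => h1)
      · exact Or.inr (hconst w hw hwσ φ hφ hm fun _ => h1)
    · exact Or.inl (hconst z hz hzσ φ hφ hm fun h => absurd h h0)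
  have key := hL.sub_le_kobayashi (fun a ha b hb => discRadii_nonempty m.isOpen hconn ha hb) hz hw
  have hself : ∀ x ∈ Ω, x ∈ ball p (m.σ / 4) → u x x = m.F (min (2 * (-m.r x)) τ) := by
    intro x hx hxσ
    have hxs : x ∈ ball p m.s := ball_subset_ball (by linarith) hxσ
    have hx0 := m.neg_r_pos hx hxs
    simp only [hu]
    rw [cutoff_of_mem (ball_subset_ball (by linarith) hxσ), m.P_self, Complex.norm_real,
      Real.norm_of_nonneg (by linarith)]
    congr 2; ring
  have hPself : ∀ x ∈ Ω, x ∈ ball p m.s → ‖m.P x x‖ = 2 * (-m.r x) := by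
    intro x hx hxs
    have hx0 := m.neg_r_pos hx hxs
    rw [m.P_self, Complex.norm_real, Real.norm_of_nonneg (by linarith)]
    ring
  have hzw : u z w = m.F τ := by
    simp only [hu]
    rw [cutoff_of_mem (ball_subset_ball (by linarith) hwσ), min_eq_right]
    have h1 := (m.neg_r_le_P hz hw hzs' hws').2
    have h2 := norm_nonneg (m.P z w)
    have h3 := m.Mf_le_of_P_le hz hw hw hzs' hws' hws' (t := 2 * ‖m.P z w‖) (by linarith)
      (by rw [hPself w hw hws']; linarith)
    rw [hτ, div_le_iff₀ (by positivity)]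
    linarith
  have hwz : u w z = m.F τ := by
    simp only [hu]
    rw [cutoff_of_mem (ball_subset_ball (by linarith) hzσ), min_eq_right]
    have h1 := (m.neg_r_le_P hw hz hws' hzs').2
    have h2 := norm_nonneg (m.P w z)
    have h3 := m.Mf_le_of_P_le hz hw hz hzs' hws' hzs' (t := 2 * ‖m.P w z‖)
      (by rw [hPself z hz hzs']; linarith) (by linarith)
    rw [hτ, div_le_iff₀ (by positivity)]
    linarith
  simp only [hself z hz hzσ, hself w hw hwσ, hzw, hwz] at key
  refine le_trans ?_ key
  have h1 := m.F_min_sub_ge hz0 hτ0 hτ1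
  have h2 := m.F_min_sub_ge hw0 hτ0 hτ1
  have hB := m.Bf_le_Mf hz hw hzs' hws'
  have hB0 := m.Bf_nonneg z w
  set D := √(-m.r z) * √(-m.r w) with hD
  have hD0 : 0 < D := mul_pos (Real.sqrt_pos.2 hz0) (Real.sqrt_pos.2 hw0)
  have h3 : Real.log D = (Real.log (-m.r z) + Real.log (-m.r w)) / 2 := by
    rw [hD, Real.log_mul (Real.sqrt_pos.2 hz0).ne' (Real.sqrt_pos.2 hw0).ne',
      Real.log_sqrt hz0.le, Real.log_sqrt hw0.le]
    ring
  have h4 : Real.log (m.c₀ * (1 + m.Bf z w)) ≤ Real.log (τ / (2 * D) / Real.exp 1) := by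
    have := m.c₀_pos
    refine Real.log_le_log (by positivity) ?_
    have he := Real.exp_pos 1
    rw [hτ, le_div_iff₀ he, le_div_iff₀ (by positivity), le_div_iff₀ (by positivity)]
    calc _ = (1 + m.Bf z w) * D / 3 := by unfold c₀; field_simp; ring
      _ ≤ _ := by linarith
  rw [Real.log_div (by positivity) (Real.exp_pos 1).ne', Real.log_exp,
    Real.log_div hτ0.ne' (by positivity), Real.log_mul two_ne_zero hD0.ne'] at h4
  rw [Real.log_mul two_ne_zero hz0.ne'] at h1
  rw [Real.log_mul two_ne_zero hw0.ne'] at h2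
  linarith

/-- Anisotropic distance from `z` at the scale of `z`. -/
def T (z y : E N) : ℝ := ‖m.P z y - m.P z z‖ / (-m.r z) + ‖y - z‖ / √(-m.r z)

lemma deriv_bounds_of_T_le {z : E N} (hz : z ∈ Ω) (hzs : z ∈ ball p m.s)
    (hC₃ : m.C₃ * (3 * (-m.r z)) ≤ 1) {φ : ℂ → E N} (hφ : DifferentiableOn ℂ φ (ball 0 1))
    (hm : MapsTo φ (ball (0:ℂ) 1) Ω) (h0 : φ 0 ∈ ball p m.σ) (hT : m.T z (φ 0) ≤ 1) :
    ‖deriv (fun ζ => m.P z (φ ζ)) 0‖ ≤ 18 * (-m.r z) ∧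
      ‖deriv φ 0‖ ≤ 72 / m.c * √(-m.r z) := by
  have hσ := m.σ_pos
  have hσs := m.σ_le
  have hc := m.c_pos
  have hc1 := m.c_le
  have hb0 : (0:ℂ) ∈ ball (0:ℂ) 1 := by simp
  have h0s : φ 0 ∈ ball p m.s := ball_subset_ball (by linarith) h0
  have ha := m.neg_r_pos hz hzs
  set a := -m.r z with hadef
  have hφat := hφ.differentiableAt (isOpen_ball.mem_nhds hb0)
  have hq := Real.sqrt_pos.2 ha
  have hqq := Real.sq_sqrt ha.le
  have hT1 : ‖m.P z (φ 0) - m.P z z‖ ≤ a := by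
    have h1 : 0 ≤ ‖φ 0 - z‖ / √a := by positivity
    have h2 : ‖m.P z (φ 0) - m.P z z‖ / a ≤ 1 := by unfold T at hT; rw [← hadef] at hT; linarith
    rwa [div_le_one ha] at h2
  have hT2 : ‖φ 0 - z‖ ≤ √a := by
    have h1 : 0 ≤ ‖m.P z (φ 0) - m.P z z‖ / a := by positivity
    have h2 : ‖φ 0 - z‖ / √a ≤ 1 := by unfold T at hT; rw [← hadef] at hT; linarith
    rwa [div_le_one hq] at h2
  have hP3 : (m.P z (φ 0)).re ≤ 3 * a := by
    have h1 := (Complex.abs_re_le_norm _).trans hT1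
    rw [m.P_self, Complex.sub_re, Complex.ofReal_re] at h1
    linarith [(abs_le.1 h1).2]
  have hr0 : -m.r (φ 0) ≤ 3 * a := by
    have g1 := m.P_re_ge hzs h0s
    have g2 : 0 ≤ m.c * ‖φ 0 - z‖ ^ 2 := mul_nonneg hc.le (sq_nonneg _)
    linarith
  have hexp : Real.exp (m.C₃ * (-m.r (φ 0))) ≤ 3 := by
    have hC := m.C₃_pos
    calc _ ≤ Real.exp 1 := by
          gcongr
          exact le_trans (by gcongr) hC₃
      _ ≤ 3 := Real.exp_one_lt_three.le
  have hbound : ∀ G : E N → ℂ, Differentiable ℂ G →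
      (∀ y ∈ Ω, y ∈ ball p m.s → 0 < (G y).re) → G (φ 0) = m.P z (φ 0) →
      ‖deriv (fun ζ => G (φ ζ)) 0‖ ≤ 18 * a := by
    intro G hG hGpos hG0
    refine (m.norm_deriv_comp_le_exp hφ hm h0 hG hGpos).trans ?_
    rw [hG0]
    calc _ ≤ 2 * (3 * a) * 3 := by gcongr
      _ = _ := by ring
  refine ⟨hbound _ (m.P_differentiable z) ?_ rfl, ?_⟩
  · intro y hy hys
    have g1 := m.P_re_ge hzs hys
    have g2 : 0 ≤ m.c * ‖y - z‖ ^ 2 := mul_nonneg hc.le (sq_nonneg _)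
    linarith [m.neg_r_pos hy hys]
  · refine norm_deriv_le_of_forall_dual hφat fun ℓ hℓ => ?_
    set μ : ℝ := m.c / 2 * √a with hμ
    have hμ0 : 0 < μ := by positivity
    have hdP : DifferentiableAt ℂ (fun ζ => m.P z (φ ζ)) 0 :=
      (m.P_differentiable z).differentiableAt.comp 0 hφat
    have hdℓ : DifferentiableAt ℂ (fun ζ => ℓ (φ ζ)) 0 := ℓ.differentiableAt.comp 0 hφat
    have h1 := hbound _ (m.P_differentiable z) (fun y hy hys => by
      have g1 := m.P_re_ge hzs hys
      have g2 : 0 ≤ m.c * ‖y - z‖ ^ 2 := mul_nonneg hc.le (sq_nonneg _)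
      linarith [m.neg_r_pos hy hys]) rfl
    have h2 := hbound (fun y => m.P z y + (μ : ℂ) * ℓ (y - φ 0))
      ((m.P_differentiable z).add (by fun_prop)) ?_ (by simp)
    · have e : (fun ζ => m.P z (φ ζ) + (μ : ℂ) * ℓ (φ ζ - φ 0)) =
          fun ζ => m.P z (φ ζ) + ((μ : ℂ) * ℓ (φ ζ) - (μ : ℂ) * ℓ (φ 0)) := by
        funext ζ; rw [map_sub]; ring
      have hd : HasDerivAt (fun ζ => m.P z (φ ζ) + (μ : ℂ) * ℓ (φ ζ - φ 0))
          (deriv (fun ζ => m.P z (φ ζ)) 0 + (μ : ℂ) * deriv (fun ζ => ℓ (φ ζ)) 0) 0 := by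
        rw [e]
        exact hdP.hasDerivAt.add ((hdℓ.hasDerivAt.const_mul _).sub_const _)
      rw [hd.deriv] at h2
      have h3 : ‖(μ : ℂ) * deriv (fun ζ => ℓ (φ ζ)) 0‖ ≤ 36 * a := by
        have := norm_sub_le (deriv (fun ζ => m.P z (φ ζ)) 0 +
          (μ : ℂ) * deriv (fun ζ => ℓ (φ ζ)) 0) (deriv (fun ζ => m.P z (φ ζ)) 0)
        rw [add_sub_cancel_left] at this
        linarith
      rw [norm_mul, Complex.norm_real, Real.norm_of_nonneg hμ0.le, mul_comm,
        ← le_div_iff₀ hμ0] at h3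
      refine h3.trans_eq ?_
      rw [hμ, div_eq_iff hμ0.ne', hμ]
      field_simp
      linarith
    · intro y hy hys
      have g1 := m.P_re_ge hzs hys
      have g2 := m.neg_r_pos hy hys
      have g3 : ‖ℓ (y - φ 0)‖ ≤ ‖y - z‖ + √a := by
        refine (ℓ.le_opNorm _).trans ?_
        have : ‖y - φ 0‖ ≤ ‖y - z‖ + √a := by
          have := norm_sub_le (y - z) (φ 0 - z)
          rw [sub_sub_sub_cancel_right] at this
          linarith
        calc _ ≤ 1 * ‖y - φ 0‖ := by gcongr
          _ ≤ _ := by linarith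
      have g4 : |((μ : ℂ) * ℓ (y - φ 0)).re| ≤ μ * (‖y - z‖ + √a) := by
        refine (Complex.abs_re_le_norm _).trans ?_
        rw [norm_mul, Complex.norm_real, Real.norm_of_nonneg hμ0.le]
        gcongr
      rw [Complex.add_re]
      have g5 := (abs_le.1 g4).1
      have g6 : μ * (‖y - z‖ + √a) ≤ m.c * ‖y - z‖ ^ 2 + 3 / 4 * a := by
        have g7 : m.c * √a ^ 2 ≤ 1 * √a ^ 2 := by gcongr
        rw [hμ]
        nlinarith [mul_nonneg hc.le (sq_nonneg (‖y - z‖ - √a / 4))]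
      linarith

lemma T_continuous (z : E N) : Continuous (m.T z) := by
  unfold T
  have := (m.P_differentiable z).continuous
  fun_prop

lemma min_T_le_kobayashi (hconn : IsConnected Ω) {z w : E N} (hz : z ∈ Ω) (hw : w ∈ Ω)
    (hzs : z ∈ ball p m.s₄) (hws : w ∈ ball p m.s₄) :
    m.c / 90 * min (m.T z w) 1 ≤ kobayashi Ω z w := by
  obtain ⟨b1, b2, b3, b4⟩ := m.s₄_bounds
  have hσ := m.σ_pos
  have hσs := m.σ_le
  have hC₃ := m.C₃_pos
  have hc := m.c_pos
  have hc1 := m.c_le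
  have hs₄ := m.s₄_pos
  have hC := m.C_pos
  have hzσ : z ∈ ball p (m.σ / 4) := ball_subset_ball b1 hzs
  have hwσ : w ∈ ball p (m.σ / 4) := ball_subset_ball b1 hws
  have hzs' : z ∈ ball p m.s := ball_subset_ball (by linarith) hzσ
  have ha := m.neg_r_pos hz hzs'
  have hq := Real.sqrt_pos.2 ha
  have hale : -m.r z ≤ 3 * m.C * m.s₄ :=
    (neg_le_abs _).trans (m.neg_r_le_of_ball (by linarith) hzs)
  have hC₃a : m.C₃ * (3 * (-m.r z)) ≤ 1 := by
    refine le_trans ?_ b3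
    have : 0 ≤ m.C * m.s₄ := by positivity
    have h : 3 * (-m.r z) ≤ 12 * m.C * m.s₄ := by linarith
    exact (mul_le_mul_of_nonneg_left h hC₃.le)
  have hqσ : √(-m.r z) ≤ m.σ / 4 := by
    rw [Real.sqrt_le_left (by positivity)]
    have : m.c * m.σ ^ 2 ≤ 1 * m.σ ^ 2 := by gcongr
    have : 0 ≤ m.C * m.s₄ := by positivity
    linarith
  have hL : DiscLipschitz Ω (fun y => m.c / 90 * cutoff p m.σ (m.T z) 1 y) := by
    refine discLipschitz_cutoff (F := fun t => m.c / 90 * t) hσ (m.T_continuous z) ?_ ?_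
    · intro y hy hy1 hy2
      have h1 := (m.P_far hz hy hzσ hy1 hy2).1
      have h2 : 1 ≤ ‖y - z‖ / √(-m.r z) := by
        rw [le_div_iff₀ hq]; linarith
      have h3 : 0 ≤ ‖m.P z y - m.P z z‖ / (-m.r z) := by positivity
      unfold T; linarith
    · intro φ hφ hm h0 hT
      have hb0 : (0:ℂ) ∈ ball (0:ℂ) 1 := by simp
      have hφat := hφ.differentiableAt (isOpen_ball.mem_nhds hb0)
      have hdP : DifferentiableAt ℂ (fun ζ => m.P z (φ ζ)) 0 :=
        (m.P_differentiable z).differentiableAt.comp 0 hφat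
      obtain ⟨d1, d2⟩ := m.deriv_bounds_of_T_le hz hzs' hC₃a hφ hm h0 hT
      refine ⟨m.c / 90, 18 + 72 / m.c, ?_, by positivity, ?_, ?_⟩
      · simpa using (hasDerivAt_id (m.T z (φ 0))).const_mul (m.c / 90)
      · rw [abs_of_pos (by positivity), mul_add]
        have : m.c / 90 * (72 / m.c) = 72 / 90 := by field_simp
        linarith
      · intro ε hε
        filter_upwards [eventually_norm_sub_le hdP d1 (ε := ε / 2 * (-m.r z)) (by positivity),
          eventually_norm_sub_le hφat d2 (ε := ε / 2 * √(-m.r z)) (by positivity)] with ζ h1 h2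
        have h3 : |‖m.P z (φ ζ) - m.P z z‖ - ‖m.P z (φ 0) - m.P z z‖| ≤
            (18 + ε / 2) * ‖ζ‖ * (-m.r z) := by
          refine (abs_norm_sub_norm_le _ _).trans ?_
          rw [sub_sub_sub_cancel_right]
          linarith
        have h4 : |‖φ ζ - z‖ - ‖φ 0 - z‖| ≤ (72 / m.c + ε / 2) * ‖ζ‖ * √(-m.r z) := by
          refine (abs_norm_sub_norm_le _ _).trans ?_
          rw [sub_sub_sub_cancel_right]
          linarith
        have e : m.T z (φ ζ) - m.T z (φ 0) =
            (‖m.P z (φ ζ) - m.P z z‖ - ‖m.P z (φ 0) - m.P z z‖) / (-m.r z) +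
              (‖φ ζ - z‖ - ‖φ 0 - z‖) / √(-m.r z) := by
          unfold T; ring
        rw [e]
        refine (abs_add_le _ _).trans ?_
        rw [abs_div, abs_div, abs_of_pos ha, abs_of_pos hq]
        rw [← div_le_iff₀ ha] at h3
        rw [← div_le_iff₀ hq] at h4
        linarith
  have key := hL.neg.sub_le_kobayashi
    (fun a ha b hb => discRadii_nonempty m.isOpen hconn ha hb) hz hw
  rw [cutoff_of_mem (ball_subset_ball (by linarith) hzσ),
    cutoff_of_mem (ball_subset_ball (by linarith) hwσ)] at key
  have hTz : m.T z z = 0 := by simp [T]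
  rw [hTz, min_eq_left zero_le_one] at key
  linarith

lemma min_Bf_le_T {z w : E N} (hz : z ∈ Ω) (hw : w ∈ Ω) (hzs : z ∈ ball p m.s)
    (hws : w ∈ ball p m.s) :
    min (m.Bf z w) 1 ≤ 30 * m.C ^ 2 * min (m.T z w) 1 := by
  have hC := m.C_ge
  have ha := m.neg_r_pos hz hzs
  have hb := m.neg_r_pos hw hws
  have hCC : 1 ≤ m.C ^ 2 := one_le_pow₀ hC
  have hrs := m.r_sub_le hzs hws
  have hBm := m.Bf_mul (z := z) (w := w) ha hb
  have hB0 := m.Bf_nonneg z w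
  set a := -m.r z with hadef
  have hq := Real.sqrt_pos.2 ha
  have hqq := Real.sq_sqrt ha.le
  set t := m.T z w with ht
  have ht0 : 0 ≤ t := by rw [ht]; unfold T; positivity
  rcases le_or_gt 1 (30 * m.C ^ 2 * t) with h | h
  · rcases le_total t 1 with h1 | h1
    · rw [min_eq_left h1]; exact (min_le_right _ _).trans h
    · rw [min_eq_right h1]; exact (min_le_right _ _).trans (by linarith)
  have ht1 : t ≤ 1 := by nlinarith
  rw [min_eq_left ht1]
  refine (min_le_left _ _).trans ?_
  have hn : ‖w - z‖ ≤ t * √a := by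
    rw [← div_le_iff₀ hq, ht]; unfold T; rw [← hadef]
    have : 0 ≤ ‖m.P z w - m.P z z‖ / a := by positivity
    linarith
  have hP : ‖m.P z w - m.P z z‖ ≤ t * a := by
    rw [← div_le_iff₀ ha, ht]; unfold T; rw [← hadef]
    have : 0 ≤ ‖w - z‖ / √a := by positivity
    linarith
  have hn2 : ‖w - z‖ ^ 2 ≤ t * a := by
    calc _ ≤ (t * √a) ^ 2 := by gcongr
      _ = t * (t * a) := by rw [mul_pow, hqq]; ring
      _ ≤ 1 * (t * a) := by gcongr
      _ = _ := one_mul _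
  have haz : ‖m.a z (z - w)‖ ≤ (1 + m.C) * (t * a) := by
    have e : m.a z (z - w) = m.P z w - m.P z z + m.Q (w - z) := by
      rw [m.P_self]; unfold P
      rw [← neg_sub w z, map_neg]
      push_cast; ring
    rw [e]
    have h1 := m.Q_bound (w - z)
    have h2 : m.C * ‖w - z‖ ^ 2 ≤ m.C * (t * a) := by gcongr
    linarith [norm_add_le (m.P z w - m.P z z) (m.Q (w - z))]
  rw [norm_sub_rev] at hn hn2
  have hnq : ‖z - w‖ * √a ≤ t * a := by
    calc _ ≤ t * √a * √a := by gcongr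
      _ = t * √a ^ 2 := by ring
      _ = _ := by rw [hqq]
  have hta : 0 ≤ t * a := by positivity
  have hsum : ‖m.a z (z - w)‖ + ‖z - w‖ ^ 2 ≤ 3 * m.C * (t * a) := by nlinarith
  have hba : a / 2 ≤ -m.r w := by
    have h1 : |m.r w - m.r z| ≤ 3 * m.C ^ 2 * t * a := by
      refine hrs.trans ?_
      calc _ ≤ m.C * (3 * m.C * (t * a)) := by gcongr
        _ = _ := by ring
    have h2 : 3 * m.C ^ 2 * t * a ≤ 1 / 10 * a := by gcongr; linarith
    have := (abs_le.1 h1).2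
    linarith
  have hD : a / 2 ≤ √a * √(-m.r w) := by
    rw [← Real.sqrt_mul ha.le]
    refine Real.le_sqrt_of_sq_le ?_
    nlinarith
  have hfin : m.Bf z w * (a / 2) ≤ 4 * m.C * (t * a) := by
    calc _ ≤ m.Bf z w * (√a * √(-m.r w)) := by gcongr
      _ = _ := hBm.symm
      _ ≤ _ := by nlinarith
  have : m.Bf z w ≤ 8 * m.C * t := by nlinarith
  have h8 : 8 * m.C ≤ 30 * m.C ^ 2 := by nlinarith
  exact this.trans (mul_le_mul_of_nonneg_right h8 ht0)

/-- Constant in the lower bound for the Kobayashi distance at small invariant distance. -/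
def c₁ : ℝ := m.c / (2700 * m.C ^ 2)

lemma c₁_pos : 0 < m.c₁ := by
  have := m.c_pos; have := m.C_pos
  unfold c₁; positivity

/-- Constant in the lower bound for the Kobayashi distance. -/
def c₈ : ℝ := min (m.c₀ / 2) (m.c₁ / (2 / m.c₀ + 1))

lemma c₈_pos : 0 < m.c₈ := by
  have := m.c₀_pos; have := m.c₁_pos
  unfold c₈; positivity

lemma le_kobayashi (hconn : IsConnected Ω) {z w : E N} (hz : z ∈ Ω) (hw : w ∈ Ω)
    (hzs : z ∈ ball p m.s₄) (hws : w ∈ ball p m.s₄) :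
    Real.log (1 + m.c₈ * m.Bf z w) ≤ kobayashi Ω z w := by
  have h1 := m.log_le_kobayashi hconn hz hw hzs hws
  have h2 := m.min_T_le_kobayashi hconn hz hw hzs hws
  have hsub : m.s₄ ≤ m.s := by
    linarith [m.s₄_bounds.1, m.σ_le, m.σ_pos]
  have h3 := m.min_Bf_le_T hz hw (ball_subset_ball hsub hzs) (ball_subset_ball hsub hws)
  have hB := m.Bf_nonneg z w
  have hc₀ := m.c₀_pos; have hc₁ := m.c₁_pos; have hc₈ := m.c₈_pos
  have hc := m.c_pos; have hC := m.C_pos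
  have h4 : m.c₁ * min (m.Bf z w) 1 ≤ kobayashi Ω z w := by
    refine le_trans ?_ h2
    calc _ ≤ m.c₁ * (30 * m.C ^ 2 * min (m.T z w) 1) := by gcongr
      _ = _ := by unfold c₁; field_simp; ring
  set B := m.Bf z w with hBdef
  set K := 2 / m.c₀ + 1 with hK
  have hK1 : 1 ≤ K := by have : 0 < 2 / m.c₀ := by positivity
                         linarith
  have hc₈a : m.c₈ ≤ m.c₀ / 2 := min_le_left _ _
  have hc₈b : m.c₈ * K ≤ m.c₁ := by
    rw [← le_div_iff₀ (by linarith)]; exact min_le_right _ _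
  have hlog : Real.log (1 + m.c₈ * B) ≤ m.c₈ * B := by
    have := Real.log_le_sub_one_of_pos (show 0 < 1 + m.c₈ * B by positivity)
    linarith
  rcases le_total B K with h | h
  · refine hlog.trans (le_trans ?_ h4)
    rcases le_total B 1 with h5 | h5
    · rw [min_eq_left h5]
      gcongr
      nlinarith
    · rw [min_eq_right h5, mul_one]
      exact le_trans (by gcongr) hc₈b
  · refine le_trans (Real.log_le_log (by positivity) ?_) h1
    have h5 : 1 ≤ m.c₀ / 2 * B := by
      have e : m.c₀ / 2 * (2 / m.c₀) = 1 := by field_simp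
      calc 1 = m.c₀ / 2 * (2 / m.c₀) := e.symm
        _ ≤ _ := by gcongr; linarith
    have h6 : m.c₈ * B ≤ m.c₀ / 2 * B := by gcongr
    linarith

end Model

/-- Localization of the estimates near a `C^{2,α}`-smooth strongly
pseudoconvex boundary point. -/
theorem stmt8 {N : ℕ} {α : ℝ} (hα : α ∈ Set.Ioc (0:ℝ) 1)
    (Ω : Set (E N)) (hop : IsOpen Ω) (hconn : IsConnected Ω)
    (p : E N) (hp : IsSPSCBoundaryPoint α Ω p)
    (π : E N → E N) (hπ : IsClosestPointSelection Ω π) :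
    ∃ V : Set (E N), IsOpen V ∧ p ∈ V ∧ ∃ c C : ℝ, 0 < c ∧ c < C ∧
      ∀ z ∈ Ω ∩ V, ∀ w ∈ Ω ∩ V,
        Real.log (1 + c * Afun Ω π z w) ≤ kobayashi Ω z w ∧
        kobayashi Ω z w ≤ lempert Ω z w ∧
        lempert Ω z w ≤ Real.log (1 + C * Afun Ω π z w) := by
  obtain ⟨m⟩ := nonempty_model hop hp
  obtain ⟨G, hG, hcmp⟩ := m.exists_Afun_compare hπ
  have hG0 : 0 < G := by linarith
  have hc₈ := m.c₈_pos
  have hC₇ := m.C₇_pos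
  have hs₂ := m.s₂_pos
  have hs₃ := m.s₃_pos
  have hs₄ := m.s₄_pos
  refine ⟨ball p (min m.s₂ (min m.s₃ m.s₄)), isOpen_ball, mem_ball_self (by positivity),
    m.c₈ / G, m.C₇ * G + m.c₈ / G, by positivity, by
      linarith [mul_pos hC₇ hG0], ?_⟩
  rintro z ⟨hz, hzV⟩ w ⟨hw, hwV⟩
  have sub₂ := ball_subset_ball (x := p) (min_le_left m.s₂ (min m.s₃ m.s₄))
  have sub₃ := ball_subset_ball (x := p)
    ((min_le_right m.s₂ (min m.s₃ m.s₄)).trans (min_le_left _ _))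
  have sub₄ := ball_subset_ball (x := p)
    ((min_le_right m.s₂ (min m.s₃ m.s₄)).trans (min_le_right _ _))
  obtain ⟨h1, h2⟩ := hcmp z hz w hw (sub₂ hzV) (sub₂ hwV)
  have hB := m.Bf_nonneg z w
  have hA : 0 ≤ Afun Ω π z w := by
    by_contra! h
    linarith [mul_neg_of_pos_of_neg hG0 h]
  refine ⟨(Real.log_le_log (by positivity) ?_).trans
    (m.le_kobayashi hconn hz hw (sub₄ hzV) (sub₄ hwV)), kobayashi_le_lempert hz hw,
    (m.lempert_le hz hw (sub₃ hzV) (sub₃ hwV)).trans (Real.log_le_log (by positivity) ?_)⟩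
  · have : m.c₈ / G * Afun Ω π z w ≤ m.c₈ / G * (G * m.Bf z w) := by gcongr
    rw [← mul_assoc, div_mul_cancel₀ _ hG0.ne'] at this
    linarith
  · have g1 : m.C₇ * m.Bf z w ≤ m.C₇ * (G * Afun Ω π z w) := by gcongr
    have g2 : 0 ≤ m.c₈ / G * Afun Ω π z w := by positivity
    linarith

end InvDist
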